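/- arXiv:2001.07213 — 3 statements merged into one kernel-verified Lean document; each statement's English description precedes it below -/
import Mathlib

section
/- Let d be a positive odd squarefree integer such that every prime p dividing d satisfies (2/p) = 1. Then 2^{rk₄ Cl⁺(8d)} = 2^{−ω(d)} · Σ_{d = D₀·D₁·D₂·D₃} (−1/D₃)·(D₂/D₀)·(D₁/D₃)·(D₃/D₀)·(D₀/D₃), where the sum ranges over all ordered 4-tuples (D₀, D₁, D₂, D₃) of positive integers with product d, the symbols are Jacobi symbols, ω(d) is the number of distinct prime factors of d, and rk₄ Cl⁺(8d) is the 4-rank of the narrow class group of ℚ(√(2d)). -/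
open NumberField IntermediateField
open scoped nonZeroDivisors

/-- The subgroup of invertible fractional ideals generated by principal fractional ideals
with a totally positive generator. -/
def narrowPrincipals (F : Type*) [Field F] :
    Subgroup (FractionalIdeal (𝓞 F)⁰ F)ˣ :=
  Subgroup.closure {I | ∃ x : F, (∀ φ : F →+* ℝ, 0 < φ x) ∧
    ((I : FractionalIdeal (𝓞 F)⁰ F) : Submodule (𝓞 F) F) = Submodule.span (𝓞 F) {x}}

/-- The narrow class group: nonzero fractional ideals modulo principal fractional ideals
generated by totally positive elements. -/
abbrev NarrowClassGroup (F : Type*) [Field F] :=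
  (FractionalIdeal (𝓞 F)⁰ F)ˣ ⧸ narrowPrincipals F

/-- `ℚ(√n)` as a subfield of `ℂ`. -/
noncomputable def quadField (n : ℕ) : IntermediateField ℚ ℂ := ℚ⟮(Real.sqrt n : ℂ)⟯

/-- `|G²/G⁴|`, i.e. `2^{rk₄ G}` where `rk₄` is the 4-rank of `G`. -/
noncomputable def fourRankPow (G : Type*) [CommGroup G] : ℕ :=
  Nat.card ((powMonoidHom 2 : G →* G).range ⧸
    ((powMonoidHom 4 : G →* G).range.subgroupOf (powMonoidHom 2 : G →* G).range))


theorem aux_crt_square (a : ℤ) : ∀ n : ℕ, 0 < n → Squarefree n →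
    (∀ p : ℕ, p.Prime → p ∣ n → ∃ r : ℤ, (p : ℤ) ∣ r ^ 2 - a) → ∃ r : ℤ, (n : ℤ) ∣ r ^ 2 - a := by
  intro n
  induction n using Nat.strong_induction_on with
  | _ n ih =>
  intro hn hsf h
  by_cases h1 : n = 1
  · subst h1; exact ⟨0, by simp⟩
  have hp := Nat.minFac_prime h1
  obtain ⟨k, hk⟩ := Nat.minFac_dvd n
  set p := n.minFac with hpdef
  clear_value p
  subst hk
  have hk0 : 0 < k := Nat.pos_of_mul_pos_left hn
  have hcop : Nat.Coprime p k := Nat.coprime_of_squarefree_mul hsf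
  obtain ⟨r1, hr1⟩ := h p hp (dvd_mul_right _ _)
  obtain ⟨r2, hr2⟩ := ih k (by nlinarith [hp.two_le]) hk0 hsf.of_mul_right
    (fun q hq hqk => h q hq (hqk.mul_left _))
  obtain ⟨u, v, huv⟩ := (Nat.isCoprime_iff_coprime.mpr hcop)
  refine ⟨r2 * (u * p) + r1 * (v * k), ?_⟩
  push_cast
  refine IsCoprime.mul_dvd (Nat.isCoprime_iff_coprime.mpr hcop) ?_ ?_
  · have : (r2 * (u * p) + r1 * (v * k)) = r1 + p * (u * (r2 - r1)) := by
      linear_combination r1 * huv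
    rw [this]
    have e : (r1 + p * (u * (r2 - r1))) ^ 2 - a = (r1 ^ 2 - a) + p * (u * (r2 - r1) * (2 * r1 + p * (u * (r2 - r1)))) := by ring
    rw [e]
    exact dvd_add hr1 (dvd_mul_right _ _)
  · have : (r2 * (u * p) + r1 * (v * k)) = r2 + k * (v * (r1 - r2)) := by
      linear_combination r2 * huv
    rw [this]
    have e : (r2 + k * (v * (r1 - r2))) ^ 2 - a = (r2 ^ 2 - a) + k * (v * (r1 - r2) * (2 * r2 + k * (v * (r1 - r2)))) := by ring
    rw [e]
    exact dvd_add hr2 (dvd_mul_right _ _)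

theorem aux_sq_not_sf (n : ℕ) (hn : 1 < n) (hsf : Squarefree n) (x : ℤ) : x ^ 2 ≠ n := by
  intro h
  have h2 : x.natAbs * x.natAbs = n := by
    zify; rw [← h, ← abs_mul, abs_of_nonneg (mul_self_nonneg x)]; ring
  have := hsf x.natAbs (by rw [h2])
  rw [Nat.isUnit_iff] at this
  rw [this] at h2
  omega

theorem aux_abs_sub_sq (n a b : ℕ) (ha : a < Nat.sqrt n + 1) (hb : b < Nat.sqrt n + 1) :
    ((a : ℤ) - b) ^ 2 ≤ n := by
  have h : ((Nat.sqrt n : ℕ) : ℤ) * (Nat.sqrt n : ℕ) ≤ n := by exact_mod_cast Nat.sqrt_le n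
  have ha' : (a : ℤ) ≤ (Nat.sqrt n : ℕ) := by exact_mod_cast Nat.lt_succ_iff.mp ha
  have hb' : (b : ℤ) ≤ (Nat.sqrt n : ℕ) := by exact_mod_cast Nat.lt_succ_iff.mp hb
  have ha0 : (0:ℤ) ≤ a := by positivity
  have hb0 : (0:ℤ) ≤ b := by positivity
  have : |(a:ℤ) - b| ≤ (Nat.sqrt n : ℕ) := abs_le.mpr ⟨by linarith, by linarith⟩
  have h3 := sq_abs ((a:ℤ) - b)
  nlinarith [abs_nonneg ((a:ℤ) - b)]

theorem aux_legendre (A C : ℕ) (hA : 0 < A) (hC : 1 < C) (hsf : Squarefree (A * C))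
    (r s : ℤ) (hr : (C : ℤ) ∣ r ^ 2 - A) (hs : (A : ℤ) ∣ s ^ 2 + C) :
    ∃ x y z : ℤ, ¬ (x = 0 ∧ y = 0 ∧ z = 0) ∧ A * x ^ 2 - C * y ^ 2 = z ^ 2 := by
  have hcop : Nat.Coprime A C := Nat.coprime_of_squarefree_mul hsf
  have hAC : 1 < A * C := by nlinarith
  have : NeZero A := ⟨by omega⟩
  have : NeZero C := ⟨by omega⟩
  let S : Finset (ℕ × ℕ × ℕ) := Finset.range (Nat.sqrt (A * C) + 1) ×ˢ
    (Finset.range (Nat.sqrt C + 1) ×ˢ Finset.range (Nat.sqrt A + 1))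
  let f : ℕ × ℕ × ℕ → ZMod A × ZMod C := fun t =>
    (((t.1 : ℤ) - s * t.2.2 : ℤ), ((t.1 : ℤ) - r * t.2.1 : ℤ))
  have hcard : (Finset.univ : Finset (ZMod A × ZMod C)).card < S.card := by
    simp only [S, Finset.card_product, Finset.card_range, Finset.card_univ, Fintype.card_prod,
      ZMod.card]
    have h1 := Nat.lt_succ_sqrt (A * C)
    have h2 := Nat.lt_succ_sqrt C
    have h3 := Nat.lt_succ_sqrt A
    simp only [Nat.succ_eq_add_one] at h1 h2 h3
    set e := Nat.sqrt (A * C) + 1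
    set c := Nat.sqrt C + 1
    set a := Nat.sqrt A + 1
    have h4 : A * C < (c * a) * (c * a) := by
      calc A * C < (a * a) * (c * c) := Nat.mul_lt_mul'' h3 h2
        _ = _ := by ring
    have h5 : (A * C) * (A * C) < (e * e) * ((c * a) * (c * a)) := Nat.mul_lt_mul'' h1 h4
    by_contra hcon
    push Not at hcon
    have := Nat.mul_le_mul hcon hcon
    nlinarith
  obtain ⟨⟨z1, x1, y1⟩, h1, ⟨z2, x2, y2⟩, h2, hne, hf⟩ :=
    Finset.exists_ne_map_eq_of_card_lt_of_maps_to hcard (f := f)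
      (fun _ _ => by simp)
  simp only [S, Finset.mem_product, Finset.mem_range] at h1 h2
  have hz := aux_abs_sub_sq _ _ _ h1.1 h2.1
  have hx := aux_abs_sub_sq _ _ _ h1.2.1 h2.2.1
  have hy := aux_abs_sub_sq _ _ _ h1.2.2 h2.2.2
  simp only [f, Prod.mk.injEq] at hf
  obtain ⟨hf1, hf2⟩ := hf
  rw [ZMod.intCast_eq_intCast_iff_dvd_sub] at hf1 hf2
  have hne' : ¬ ((x1:ℤ) - x2 = 0 ∧ (y1:ℤ) - y2 = 0 ∧ (z1 : ℤ) - z2 = 0) := by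
    rintro ⟨ha, hb, hc⟩
    apply hne
    simp only [Prod.mk.injEq]
    omega
  have hf1 : (A:ℤ) ∣ ((z1:ℤ) - z2) - s * ((y1:ℤ) - y2) := by
    obtain ⟨k, hk⟩ := hf1
    exact ⟨-k, by linear_combination -hk⟩
  have hf2 : (C:ℤ) ∣ ((z1:ℤ) - z2) - r * ((x1:ℤ) - x2) := by
    obtain ⟨k, hk⟩ := hf2
    exact ⟨-k, by linear_combination -hk⟩
  generalize (z1:ℤ) - z2 = z at *
  generalize (x1:ℤ) - x2 = x at *
  generalize (y1:ℤ) - y2 = y at *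
  push_cast at hz
  have hdA : (A:ℤ) ∣ z ^ 2 - A * x ^ 2 + C * y ^ 2 := by
    have e : z ^ 2 - A * x ^ 2 + C * y ^ 2 = (z - s * y) * (z + s * y) + (s ^ 2 + C) * y ^ 2 - A * x ^ 2 := by ring
    rw [e]
    exact dvd_sub (dvd_add (hf1.mul_right _) (hs.mul_right _)) (dvd_mul_right _ _)
  have hdC : (C:ℤ) ∣ z ^ 2 - A * x ^ 2 + C * y ^ 2 := by
    have e : z ^ 2 - A * x ^ 2 + C * y ^ 2 = (z - r * x) * (z + r * x) + (r ^ 2 - A) * x ^ 2 + C * y ^ 2 := by ring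
    rw [e]
    exact dvd_add (dvd_add (hf2.mul_right _) (hr.mul_right _)) (dvd_mul_right _ _)
  obtain ⟨k, hk⟩ := IsCoprime.mul_dvd (Nat.isCoprime_iff_coprime.mpr hcop) hdA hdC
  have hA' : (0:ℤ) < A := by exact_mod_cast hA
  have hC' : (0:ℤ) < C := by positivity
  have hACp : (0:ℤ) < A * C := by positivity
  have hx' : x ^ 2 < C := lt_of_le_of_ne hx (aux_sq_not_sf C hC hsf.of_mul_right x)
  have hz' : z ^ 2 < A * C := lt_of_le_of_ne hz (by
    have := aux_sq_not_sf (A * C) hAC hsf z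
    push_cast at this; exact this)
  have hk1 : -1 < k := by
    by_contra hcon
    have : k ≤ -1 := by omega
    nlinarith [sq_nonneg z, sq_nonneg y]
  have hk2 : k < 2 := by
    by_contra hcon
    have : 2 ≤ k := by omega
    nlinarith [sq_nonneg x]
  have : k = 0 ∨ k = 1 := by omega
  rcases this with rfl | rfl
  · exact ⟨x, y, z, hne', by linarith⟩
  · refine ⟨x ^ 2 + C, z - x * y, z * x + C * y, ?_, ?_⟩
    · rintro ⟨h, -, -⟩
      nlinarith [sq_nonneg x]
    · have : z ^ 2 + C * y ^ 2 = A * (x ^ 2 + C) := by linarith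
      linear_combination (-(x ^ 2 + (C:ℤ))) * this
theorem aux_jac (p : ℕ) (hp : p.Prime) (a : ℤ) :
    jacobiSym a p = 1 ↔ ¬ (p : ℤ) ∣ a ∧ ∃ r : ℤ, (p : ℤ) ∣ r ^ 2 - a := by
  have : Fact p.Prime := ⟨hp⟩
  rw [← jacobiSym.legendreSym.to_jacobiSym]
  constructor
  · intro h
    have h0 : ((a : ℤ) : ZMod p) ≠ 0 := by
      intro h0
      rw [← legendreSym.eq_zero_iff] at h0
      rw [h0] at h; exact absurd h (by norm_num)
    refine ⟨fun hd => h0 ((ZMod.intCast_zmod_eq_zero_iff_dvd a p).mpr hd), ?_⟩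
    obtain ⟨r, hr⟩ := (legendreSym.eq_one_iff p h0).mp h
    obtain ⟨r, rfl⟩ := ZMod.intCast_surjective r
    refine ⟨r, (ZMod.intCast_zmod_eq_zero_iff_dvd _ p).mp ?_⟩
    push_cast; rw [hr]; ring
  · rintro ⟨h, r, hr⟩
    have h0 : ((a : ℤ) : ZMod p) ≠ 0 := fun h0 => h ((ZMod.intCast_zmod_eq_zero_iff_dvd a p).mp h0)
    rw [legendreSym.eq_one_iff p h0]
    refine ⟨(r : ZMod p), ?_⟩
    have := (ZMod.intCast_zmod_eq_zero_iff_dvd _ p).mpr hr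
    push_cast at this
    rw [← sub_eq_zero, ← neg_eq_zero, ← this]; ring

theorem aux_jac_pm (p : ℕ) (hp : p.Prime) (a : ℤ) (h : ¬ (p : ℤ) ∣ a) :
    jacobiSym a p = 1 ∨ jacobiSym a p = -1 := by
  apply jacobiSym.eq_one_or_neg_one
  rw [Int.gcd_comm]
  exact Int.isCoprime_iff_gcd_eq_one.mp ((Prime.coprime_iff_not_dvd (Nat.prime_iff_prime_int.mp hp)).mpr h)

def auxSol (b c : ℕ) : Prop :=
  ∃ x y z : ℤ, ¬ (x = 0 ∧ y = 0 ∧ z = 0) ∧ b * x ^ 2 - c * y ^ 2 = z ^ 2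

theorem auxSol_prim {b c : ℕ} (h : auxSol b c) : ∃ x y z : ℤ,
    (∀ p : ℕ, p.Prime → ¬ ((p : ℤ) ∣ x ∧ (p : ℤ) ∣ y ∧ (p : ℤ) ∣ z)) ∧
      b * x ^ 2 - c * y ^ 2 = z ^ 2 := by
  obtain ⟨x, y, z, h0, h⟩ := h
  suffices H : ∀ n : ℕ, ∀ x y z : ℤ, x.natAbs + y.natAbs + z.natAbs = n →
      ¬ (x = 0 ∧ y = 0 ∧ z = 0) → b * x ^ 2 - c * y ^ 2 = z ^ 2 → ∃ x y z : ℤ,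
    (∀ p : ℕ, p.Prime → ¬ ((p : ℤ) ∣ x ∧ (p : ℤ) ∣ y ∧ (p : ℤ) ∣ z)) ∧
      b * x ^ 2 - c * y ^ 2 = z ^ 2 from H _ x y z rfl h0 h
  clear h h0 x y z
  intro n
  induction n using Nat.strong_induction_on with
  | _ n ih =>
  intro x y z hn h0 h
  by_cases hp : ∃ p : ℕ, p.Prime ∧ ((p : ℤ) ∣ x ∧ (p : ℤ) ∣ y ∧ (p : ℤ) ∣ z)
  · obtain ⟨p, hp, ⟨x, rfl⟩, ⟨y, rfl⟩, ⟨z, rfl⟩⟩ := hp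
    have hp0 : (p : ℤ) ≠ 0 := by exact_mod_cast hp.ne_zero
    have h0' : ¬ (x = 0 ∧ y = 0 ∧ z = 0) := by
      rintro ⟨rfl, rfl, rfl⟩; simp at h0
    refine ih (x.natAbs + y.natAbs + z.natAbs) ?_ x y z rfl h0' ?_
    · have : 0 < x.natAbs + y.natAbs + z.natAbs := by omega
      simp only [Int.natAbs_mul, Int.natAbs_natCast] at hn
      have := hp.two_le
      nlinarith
    · have : (p:ℤ) ^ 2 ≠ 0 := pow_ne_zero _ hp0
      apply mul_left_cancel₀ this
      linear_combination h
  · push Not at hp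
    exact ⟨x, y, z, fun p hpp h => hp p hpp h.1 h.2.1 h.2.2, h⟩

theorem aux_sf_dvd {n p : ℕ} (hp : p.Prime) (hsf : Squarefree n) (hpn : p ∣ n) (w : ℤ)
    (h : (p : ℤ) ^ 2 ∣ n * w ^ 2) : (p : ℤ) ∣ w := by
  have hp' := Nat.prime_iff_prime_int.mp hp
  obtain ⟨k, rfl⟩ := hpn
  have hk : ¬ (p : ℤ) ∣ k := by
    intro hk
    have hk : p ∣ k := by exact_mod_cast hk
    have := hsf p (mul_dvd_mul_left p hk)
    exact hp.not_isUnit this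
  have : (p : ℤ) ∣ k * w ^ 2 := by
    obtain ⟨t, ht⟩ := h
    refine ⟨t, mul_left_cancel₀ hp'.ne_zero ?_⟩
    push_cast at ht
    linear_combination ht
  exact hp'.dvd_of_dvd_pow ((hp'.dvd_or_dvd this).resolve_left hk)

theorem aux_inv_sq (p : ℕ) (hp : p.Prime) (a y z : ℤ) (hy : ¬ (p : ℤ) ∣ y)
    (h : (p : ℤ) ∣ z ^ 2 - a * y ^ 2) : ∃ r : ℤ, (p : ℤ) ∣ r ^ 2 - a := by
  obtain ⟨u, v, huv⟩ := (Prime.coprime_iff_not_dvd (Nat.prime_iff_prime_int.mp hp)).mpr hy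
  obtain ⟨k, hk⟩ := h
  refine ⟨v * z, v ^ 2 * k - a * u * (2 - u * p), ?_⟩
  have : v * y = 1 - u * p := by linarith
  have h2 : v ^ 2 * y ^ 2 = (1 - u * p) ^ 2 := by rw [← this]; ring
  linear_combination v ^ 2 * hk + a * h2

theorem auxSol_iff (b c : ℕ) (hodd : Odd (b * c)) (hsf : Squarefree (b * c))
    (hleg : ∀ p : ℕ, p.Prime → p ∣ b * c → jacobiSym 2 p = 1) :
    auxSol b (2 * c) ↔ (∀ p : ℕ, p.Prime → p ∣ b → jacobiSym (-c) p = 1) ∧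
      (∀ p : ℕ, p.Prime → p ∣ c → jacobiSym b p = 1) := by
  have hcop : Nat.Coprime b c := Nat.coprime_of_squarefree_mul hsf
  have hb2 : Odd b := (Nat.odd_mul.mp hodd).1
  have hc2 : Odd c := (Nat.odd_mul.mp hodd).2
  have key : ∀ p : ℕ, p.Prime → p ∣ b → (jacobiSym (-c) p = 1 ↔ jacobiSym (-(2 * c)) p = 1) := by
    intro p hp hpb
    have : (-(2 * c) : ℤ) = 2 * (-c) := by ring
    rw [this, jacobiSym.mul_left, hleg p hp (hpb.mul_right _), one_mul]
  have hsf2 : Squarefree (2 * c) := by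
    rw [Nat.squarefree_mul (by simpa using hc2)]
    exact ⟨Nat.prime_two.prime.squarefree, hsf.of_mul_right⟩
  have hbc2 : Nat.Coprime b (2 * c) := Nat.Coprime.mul_right (by simpa using hb2) hcop
  constructor
  · intro h
    obtain ⟨x, y, z, hpr, h⟩ := auxSol_prim h
    constructor
    · intro p hp hpb
      rw [key p hp hpb, aux_jac p hp]
      have hp' := Nat.prime_iff_prime_int.mp hp
      have hnd : ¬ p ∣ 2 * c := fun hd => hp.one_lt.ne' (Nat.eq_one_of_dvd_coprimes hbc2 hpb hd)
      have hpb' : (p : ℤ) ∣ b := by exact_mod_cast hpb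
      refine ⟨fun hd => hnd (by rw [dvd_neg] at hd; exact_mod_cast hd), ?_⟩
      apply aux_inv_sq p hp _ y z
      · intro hy
        have hz : (p : ℤ) ∣ z := by
          apply hp'.dvd_of_dvd_pow (n := 2)
          rw [← h]
          exact dvd_sub (hpb'.mul_right _) ((dvd_pow hy two_ne_zero).mul_left _)
        refine hpr p hp ⟨?_, hy, hz⟩
        apply aux_sf_dvd hp hsf.of_mul_left hpb
        have : (b : ℤ) * x ^ 2 = z ^ 2 + (2 * c : ℕ) * y ^ 2 := by linarith
        rw [this]
        exact dvd_add (pow_dvd_pow_of_dvd hz 2) ((pow_dvd_pow_of_dvd hy 2).mul_left _)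
      · have : z ^ 2 - (-(2 * c)) * y ^ 2 = b * x ^ 2 := by
          push_cast at h; linarith
        rw [this]
        exact hpb'.mul_right _
    · intro p hp hpc
      rw [aux_jac p hp]
      have hp' := Nat.prime_iff_prime_int.mp hp
      have hnd : ¬ p ∣ b := fun hd => hp.one_lt.ne' (Nat.eq_one_of_dvd_coprimes hcop hd hpc)
      have hpc' : (p : ℤ) ∣ (2 * c : ℕ) := by exact_mod_cast hpc.mul_left 2
      refine ⟨fun hd => hnd (by exact_mod_cast hd), ?_⟩
      apply aux_inv_sq p hp _ x z
      · intro hx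
        have hz : (p : ℤ) ∣ z := by
          apply hp'.dvd_of_dvd_pow (n := 2)
          rw [← h]
          exact dvd_sub ((dvd_pow hx two_ne_zero).mul_left _) (hpc'.mul_right _)
        refine hpr p hp ⟨hx, ?_, hz⟩
        apply aux_sf_dvd hp hsf2 (hpc.mul_left 2)
        have : ((2 * c : ℕ) : ℤ) * y ^ 2 = b * x ^ 2 - z ^ 2 := by linarith
        rw [this]
        exact dvd_sub ((pow_dvd_pow_of_dvd hx 2).mul_left _) (pow_dvd_pow_of_dvd hz 2)
      · have : z ^ 2 - b * x ^ 2 = -((2 * c : ℕ) * y ^ 2) := by linarith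
        rw [this, dvd_neg]
        exact hpc'.mul_right _
  · rintro ⟨h1, h2⟩
    have hb0 : 0 < b := hb2.pos
    have hc0 : 0 < c := hc2.pos
    obtain ⟨s, hs⟩ := aux_crt_square (-(2 * c)) b hb0 hsf.of_mul_left (fun p hp hpb =>
      ((aux_jac p hp _).mp ((key p hp hpb).mp (h1 p hp hpb))).2)
    obtain ⟨r, hr⟩ := aux_crt_square b (2 * c) (by omega) hsf2 (fun p hp hpc => by
      rcases (hp.dvd_mul).mp hpc with h | h
      · have : p = 2 := (Nat.prime_dvd_prime_iff_eq hp Nat.prime_two).mp h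
        subst this
        obtain ⟨k, hk⟩ := hb2
        exact ⟨1, -k, by rw [hk]; push_cast; ring⟩
      · exact ((aux_jac p hp _).mp (h2 p hp h)).2)
    refine aux_legendre b (2 * c) hb0 (by omega) ?_ r s hr ?_
    · rw [Nat.squarefree_mul hbc2]; exact ⟨hsf.of_mul_left, hsf2⟩
    · convert hs using 1; push_cast; ring

theorem auxSol_two (d : ℕ) (hodd : Odd d) (hsf : Squarefree d)
    (hleg : ∀ p : ℕ, p.Prime → p ∣ d → jacobiSym 2 p = 1) : auxSol 2 d := by
  by_cases h1 : d = 1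
  · subst h1; exact ⟨1, 1, 1, by simp, by norm_num⟩
  have h0 := hodd.pos
  obtain ⟨r, hr⟩ := aux_crt_square 2 d h0 hsf (fun p hp hpc =>
    ((aux_jac p hp _).mp (hleg p hp hpc)).2)
  refine aux_legendre 2 d (by omega) (by omega) ?_ r 1 (by exact_mod_cast hr) ?_
  · rw [Nat.squarefree_mul (by simpa using hodd)]
    exact ⟨Nat.prime_two.prime.squarefree, hsf⟩
  · obtain ⟨k, hk⟩ := hodd
    exact ⟨k + 1, by rw [hk]; push_cast; ring⟩

theorem aux_prod_jac (a : ℤ) (n : ℕ) (hsf : Squarefree n) :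
    ∏ p ∈ n.primeFactors, (1 + jacobiSym a p) = ∑ e ∈ n.divisors, jacobiSym a e := by
  let f : ArithmeticFunction ℤ := ⟨fun n => if n = 0 then 0 else jacobiSym a n, by simp⟩
  have hf : f.IsMultiplicative := by
    refine ⟨by simp [f], ?_⟩
    intro m n _
    simp only [f, ArithmeticFunction.coe_mk]
    by_cases hm : m = 0
    · simp [hm]
    by_cases hn : n = 0
    · simp [hn]
    have : NeZero m := ⟨hm⟩
    have : NeZero n := ⟨hn⟩
    simp [hm, hn, jacobiSym.mul_right]
  have := hf.prodPrimeFactors_one_add_of_squarefree hsf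
  have e1 : ∏ p ∈ n.primeFactors, (1 + f p) = ∏ p ∈ n.primeFactors, (1 + jacobiSym a p) := by
    refine Finset.prod_congr rfl fun p hp => ?_
    have := (Nat.prime_of_mem_primeFactors hp).ne_zero
    simp [f, this]
  have e2 : ∑ p ∈ n.divisors, f p = ∑ e ∈ n.divisors, jacobiSym a e := by
    refine Finset.sum_congr rfl fun p hp => ?_
    have := (Nat.pos_of_mem_divisors hp).ne'
    simp [f, this]
  rw [← e1, ← e2, this]

open Classical in
theorem aux_prod_ind (a : ℤ) (n : ℕ) (hn : n ≠ 0) (hc : ∀ p : ℕ, p.Prime → p ∣ n → ¬ (p : ℤ) ∣ a) :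
    ∏ p ∈ n.primeFactors, (1 + jacobiSym a p) =
      if (∀ p : ℕ, p.Prime → p ∣ n → jacobiSym a p = 1) then (2 : ℤ) ^ n.primeFactors.card else 0 := by
  split_ifs with h
  · rw [Finset.prod_congr rfl (g := fun _ => (2:ℤ))]
    · simp
    · intro p hp
      rw [h p (Nat.prime_of_mem_primeFactors hp) (Nat.dvd_of_mem_primeFactors hp)]; norm_num
  · push Not at h
    obtain ⟨p, hp, hpn, hne⟩ := h
    apply Finset.prod_eq_zero (i := p)
    · simp [hp, hpn, hn]
    · rw [(aux_jac_pm p hp a (hc p hp hpn)).resolve_left hne]; norm_num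

open Classical in
theorem aux_count (d : ℕ) (hpos : 0 < d) (hodd : Odd d) (hsf : Squarefree d)
    (hleg : ∀ p : ℕ, p.Prime → p ∣ d → jacobiSym 2 p = 1) :
    (2 : ℤ) ^ d.primeFactors.card * ((d.divisors.filter (fun b => auxSol b (2 * (d / b)))).card : ℤ) =
     ∑ t ∈ (d.divisors ×ˢ d.divisors ×ˢ d.divisors ×ˢ d.divisors).filter
            (fun t : ℕ × ℕ × ℕ × ℕ => t.1 * t.2.1 * t.2.2.1 * t.2.2.2 = d),
          ((jacobiSym (-1) t.2.2.2 * jacobiSym t.2.2.1 t.1 * jacobiSym t.2.1 t.2.2.2 *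
            jacobiSym t.2.2.2 t.1 * jacobiSym t.1 t.2.2.2 : ℤ)) := by
  have h1 : (2 : ℤ) ^ d.primeFactors.card * ((d.divisors.filter (fun b => auxSol b (2 * (d / b)))).card : ℤ)
      = ∑ b ∈ d.divisors, ∑ e ∈ b.divisors, ∑ f ∈ (d / b).divisors,
        jacobiSym (-(d / b : ℕ)) e * jacobiSym b f := by
    rw [Finset.card_filter]
    simp only [Nat.cast_sum, Nat.cast_ite, Nat.cast_one, Nat.cast_zero]
    rw [Finset.mul_sum]
    refine Finset.sum_congr rfl fun b hb => ?_
    obtain ⟨c, hc⟩ := (Nat.mem_divisors.mp hb).1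
    have hb0 : 0 < b := Nat.pos_of_mem_divisors hb
    have hdb : d / b = c := by rw [hc, Nat.mul_div_cancel_left _ hb0]
    rw [hdb]
    subst hc
    have hc0 : 0 < c := Nat.pos_of_mul_pos_left hpos
    have hcop : Nat.Coprime b c := Nat.coprime_of_squarefree_mul hsf
    rw [← Finset.sum_mul_sum, ← aux_prod_jac _ _ hsf.of_mul_left, ← aux_prod_jac _ _ hsf.of_mul_right,
      aux_prod_ind _ _ hb0.ne', aux_prod_ind _ _ hc0.ne', hcop.primeFactors_mul,
      Finset.card_union_of_disjoint hcop.disjoint_primeFactors]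
    · simp only [auxSol_iff b c hodd hsf hleg]
      split_ifs <;> first | (exfalso; tauto) | (ring)
    · intro p hp hpc hd
      exact hp.one_lt.ne' (Nat.eq_one_of_dvd_coprimes hcop (by exact_mod_cast hd) hpc)
    · intro p hp hpc hd
      rw [dvd_neg] at hd
      exact hp.one_lt.ne' (Nat.eq_one_of_dvd_coprimes hcop hpc (by exact_mod_cast hd))
  rw [h1, Finset.sum_congr rfl (fun b hb => Finset.sum_sigma' _ _ _), Finset.sum_sigma']
  refine Finset.sum_nbij' (fun t => (t.2.2, d / t.1 / t.2.2, t.1 / t.2.1, t.2.1))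
    (fun t => ⟨t.2.2.1 * t.2.2.2, ⟨t.2.2.2, t.1⟩⟩) ?_ ?_ ?_ ?_ ?_
  · rintro ⟨b, e, f⟩ h
    simp only [Finset.mem_sigma, Nat.mem_divisors] at h
    obtain ⟨⟨⟨c, rfl⟩, -⟩, ⟨⟨g, rfl⟩, hb⟩, hf, hc⟩ := h
    have he0 : 0 < e := Nat.pos_of_ne_zero (left_ne_zero_of_mul hb)
    have hb0 : 0 < e * g := Nat.pos_of_ne_zero hb
    simp only [Nat.mul_div_cancel_left _ hb0] at hf hc ⊢
    obtain ⟨k, rfl⟩ := hf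
    have hf0 : 0 < f := Nat.pos_of_ne_zero (left_ne_zero_of_mul hc)
    simp only [Nat.mul_div_cancel_left _ he0, Nat.mul_div_cancel_left _ hf0, Finset.mem_filter,
      Finset.mem_product, Nat.mem_divisors]
    refine ⟨⟨⟨⟨e * g * k, by ring⟩, hpos.ne'⟩, ⟨⟨e * g * f, by ring⟩, hpos.ne'⟩, ⟨⟨e * (f * k), by ring⟩, hpos.ne'⟩, ⟨⟨g * (f * k), by ring⟩, hpos.ne'⟩⟩, by ring⟩
  · rintro ⟨D0, D1, D2, D3⟩ h
    simp only [Finset.mem_filter] at h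
    obtain ⟨-, rfl⟩ := h
    have h23 : 0 < D2 * D3 := Nat.pos_of_ne_zero (by rintro h0; rw [mul_assoc, h0] at hpos; simp at hpos)
    have h01 : D0 * D1 ≠ 0 := by rintro h0; rw [h0] at hpos; simp at hpos
    have e : D0 * D1 * D2 * D3 / (D2 * D3) = D0 * D1 := by
      rw [mul_assoc, Nat.mul_div_cancel _ h23]
    simp only [Finset.mem_sigma, Nat.mem_divisors, e]
    exact ⟨⟨⟨D0 * D1, by ring⟩, hpos.ne'⟩, ⟨dvd_mul_left _ _, h23.ne'⟩, dvd_mul_right _ _, h01⟩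
  · rintro ⟨b, e, f⟩ h
    simp only [Finset.mem_sigma, Nat.mem_divisors] at h
    simp only [Nat.div_mul_cancel h.2.1.1]
  · rintro ⟨D0, D1, D2, D3⟩ h
    simp only [Finset.mem_filter] at h
    obtain ⟨-, rfl⟩ := h
    have h23 : 0 < D2 * D3 := Nat.pos_of_ne_zero (by rintro h0; rw [mul_assoc, h0] at hpos; simp at hpos)
    have h3 : 0 < D3 := Nat.pos_of_ne_zero (right_ne_zero_of_mul h23.ne')
    have h01 : D0 * D1 ≠ 0 := by rintro h0; rw [h0] at hpos; simp at hpos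
    have h0 : 0 < D0 := Nat.pos_of_ne_zero (left_ne_zero_of_mul h01)
    have e : D0 * D1 * D2 * D3 / (D2 * D3) = D0 * D1 := by
      rw [mul_assoc, Nat.mul_div_cancel _ h23]
    simp only [e, Nat.mul_div_cancel _ h3, Nat.mul_div_cancel_left _ h0]
  · rintro ⟨b, e, f⟩ h
    simp only [Finset.mem_sigma, Nat.mem_divisors] at h
    obtain ⟨⟨⟨c, rfl⟩, -⟩, ⟨⟨g, rfl⟩, hb⟩, hf, hc⟩ := h
    have he0 : 0 < e := Nat.pos_of_ne_zero (left_ne_zero_of_mul hb)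
    have hb0 : 0 < e * g := Nat.pos_of_ne_zero hb
    simp only [Nat.mul_div_cancel_left _ hb0] at hf hc ⊢
    obtain ⟨k, rfl⟩ := hf
    have hf0 : 0 < f := Nat.pos_of_ne_zero (left_ne_zero_of_mul hc)
    simp only [Nat.mul_div_cancel_left _ he0, Nat.mul_div_cancel_left _ hf0]
    have e1 : (-((f * k : ℕ) : ℤ)) = (-1) * (f * k) := by push_cast; ring
    rw [e1, jacobiSym.mul_left, jacobiSym.mul_left]
    push_cast
    rw [jacobiSym.mul_left]
    ring
/-- The subgroup of squares. -/
def auxSq (G : Type*) [CommGroup G] : Subgroup G := (powMonoidHom 2 : G →* G).range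

theorem aux_fourRank (G : Type*) [CommGroup G] [Finite (auxSq G)] :
    fourRankPow G = Nat.card {g : G // g ∈ auxSq G ∧ g ^ 2 = 1} := by
  unfold fourRankPow
  change Nat.card (auxSq G ⧸ (powMonoidHom 4 : G →* G).range.subgroupOf (auxSq G)) = _
  set H := auxSq G with hH
  let q : H →* H := powMonoidHom 2
  have h1 : (powMonoidHom 4 : G →* G).range.subgroupOf H = q.range := by
    ext ⟨x, hx⟩
    simp only [Subgroup.mem_subgroupOf, MonoidHom.mem_range, powMonoidHom_apply]
    constructor
    · rintro ⟨y, hy⟩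
      refine ⟨⟨y ^ 2, ⟨y, rfl⟩⟩, ?_⟩
      apply Subtype.ext
      simp only [q, powMonoidHom_apply, Subgroup.coe_pow]
      rw [← hy]; group
    · rintro ⟨⟨y, z, hz⟩, hy⟩
      refine ⟨z, ?_⟩
      have := congrArg Subtype.val hy
      simp only [q, powMonoidHom_apply, Subgroup.coe_pow] at this hz
      rw [← this, ← hz]; group
  rw [h1]
  have h2 := Subgroup.index_mul_card q.range
  have h3 := Subgroup.index_mul_card q.ker
  rw [Subgroup.index_ker] at h3
  have h4 : 0 < Nat.card q.range := Nat.card_pos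
  have h5 : q.range.index = Nat.card q.ker := by
    apply Nat.eq_of_mul_eq_mul_right h4
    rw [h2, ← h3, mul_comm]
  change q.range.index = _
  rw [h5]
  refine Nat.card_congr ⟨fun x => ⟨x.1.1, x.1.2, ?_⟩, fun g => ⟨⟨g.1, g.2.1⟩, ?_⟩, fun _ => rfl, fun _ => rfl⟩
  · have := congrArg Subtype.val (MonoidHom.mem_ker.mp x.2)
    simpa [q] using this
  · rw [MonoidHom.mem_ker]
    apply Subtype.ext
    simpa [q] using g.2.2

/-- Totally positive. -/
def auxTP {F : Type*} [Field F] (x : F) : Prop := ∀ φ : F →+* ℝ, 0 < φ x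

theorem auxTP_mul {F : Type*} [Field F] {x y : F} (hx : auxTP x) (hy : auxTP y) : auxTP (x * y) :=
  fun φ => by rw [map_mul]; exact mul_pos (hx φ) (hy φ)

theorem auxTP_inv {F : Type*} [Field F] {x : F} (hx : auxTP x) : auxTP (x⁻¹) :=
  fun φ => by rw [map_inv₀]; exact inv_pos.mpr (hx φ)

theorem auxTP_sq {F : Type*} [Field F] {x : F} (hx : x ≠ 0) : auxTP (x ^ 2) :=
  fun φ => by
    rw [map_pow]
    have : φ x ≠ 0 := by simpa using hx
    positivity

theorem aux_mem_narrow {F : Type*} [Field F] [NumberField F] (I : (FractionalIdeal (𝓞 F)⁰ F)ˣ) :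
    I ∈ narrowPrincipals F ↔ ∃ u : Fˣ, auxTP (u : F) ∧ toPrincipalIdeal (𝓞 F) F u = I := by
  constructor
  · intro h
    unfold narrowPrincipals at h
    induction h using Subgroup.closure_induction with
    | mem I hI =>
      obtain ⟨x, hx, hI⟩ := hI
      have hI' : (I : FractionalIdeal (𝓞 F)⁰ F) = FractionalIdeal.spanSingleton _ x := by
        apply FractionalIdeal.coeToSubmodule_injective
        simp only [hI, FractionalIdeal.coe_spanSingleton]
      have hx0 : x ≠ 0 := by
        rintro rfl
        rw [FractionalIdeal.spanSingleton_zero] at hI'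
        exact I.ne_zero hI'
      refine ⟨Units.mk0 x hx0, hx, ?_⟩
      rw [toPrincipalIdeal_eq_iff, hI']; rfl
    | one => exact ⟨1, fun φ => by simp, by simp⟩
    | mul I J _ _ hI hJ =>
      obtain ⟨u, hu, rfl⟩ := hI
      obtain ⟨v, hv, rfl⟩ := hJ
      exact ⟨u * v, by simpa using auxTP_mul hu hv, by rw [map_mul]⟩
    | inv I _ hI =>
      obtain ⟨u, hu, rfl⟩ := hI
      exact ⟨u⁻¹, by simpa using auxTP_inv hu, by rw [map_inv]⟩
  · rintro ⟨u, hu, rfl⟩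
    refine Subgroup.subset_closure ⟨u, hu, ?_⟩
    rw [coe_toPrincipalIdeal, FractionalIdeal.coe_spanSingleton]

theorem aux_finite {F : Type*} [Field F] [NumberField F] :
    Finite (auxSq (NarrowClassGroup F)) := by
  have : Finite ((FractionalIdeal (𝓞 F)⁰ F)ˣ ⧸ (toPrincipalIdeal (𝓞 F) F).range) :=
    Finite.of_equiv _ (ClassGroup.equiv (R := 𝓞 F) F).toEquiv
  let f : (FractionalIdeal (𝓞 F)⁰ F)ˣ →* NarrowClassGroup F :=
    (QuotientGroup.mk' (narrowPrincipals F)).comp (powMonoidHom 2)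
  have hf : (toPrincipalIdeal (𝓞 F) F).range ≤ f.ker := by
    rintro _ ⟨u, rfl⟩
    rw [MonoidHom.mem_ker]
    change (((toPrincipalIdeal (𝓞 F) F u) ^ 2 : (FractionalIdeal (𝓞 F)⁰ F)ˣ) : NarrowClassGroup F) = 1
    rw [QuotientGroup.eq_one_iff, aux_mem_narrow]
    exact ⟨u ^ 2, by simpa using auxTP_sq u.ne_zero, by rw [map_pow]⟩
  let g := QuotientGroup.lift _ f hf
  have : Finite (Set.range g) := Set.finite_range g
  refine Finite.of_injective (fun x => (⟨x.1, ?_⟩ : Set.range g)) ?_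
  · obtain ⟨y, hy⟩ := x.2
    obtain ⟨J, rfl⟩ := QuotientGroup.mk_surjective y
    exact ⟨QuotientGroup.mk J, hy⟩
  · intro x y h
    apply Subtype.ext
    simpa using h


structure AuxQF (F : Type*) [Field F] [NumberField F] (m : ℕ) (s : F) : Prop where
  ssq : s ^ 2 = m
  span : ∀ z : F, ∃ x y : ℚ, z = x + y * s
  norm : ∀ x y : ℚ, Algebra.norm ℚ ((x : F) + y * s) = x ^ 2 - m * y ^ 2
  conj : ∃ σ : F →+* F, σ s = -s
  pos : ∀ x y : ℚ, auxTP ((x : F) + y * s) ↔ 0 < x ∧ m * y ^ 2 < x ^ 2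
  sf : Squarefree m
  mod : m % 4 = 2

theorem aux_sf_unique {x y k l : ℕ} (hx : Squarefree x) (hy : Squarefree y) (hk : k ≠ 0) (hl : l ≠ 0)
    (h : k ^ 2 * x = l ^ 2 * y) : x = y := by
  refine Nat.eq_of_factorization_eq hx.ne_zero hy.ne_zero fun p => ?_
  have h1 := hx.natFactorization_le_one p
  have h2 := hy.natFactorization_le_one p
  have h3 := congrArg (fun n => n.factorization p) h
  simp only [Nat.factorization_mul (pow_ne_zero 2 hk) hx.ne_zero,
    Nat.factorization_mul (pow_ne_zero 2 hl) hy.ne_zero, Nat.factorization_pow,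
    Finsupp.add_apply, Finsupp.smul_apply, smul_eq_mul] at h3
  omega

theorem aux_sf_unique_rat {x y : ℕ} (hx : Squarefree x) (hy : Squarefree y) (q : ℚ) (hq : q ≠ 0)
    (h : (x : ℚ) = q ^ 2 * y) : x = y := by
  have hd : q.den ≠ 0 := q.den_ne_zero
  have hn : q.num ≠ 0 := by simpa using hq
  refine aux_sf_unique hx hy hd (l := q.num.natAbs) (by simpa using hn) ?_
  have hq' : q = q.num / q.den := (Rat.num_div_den q).symm
  have : (q.den : ℚ) ^ 2 * x = (q.num : ℚ) ^ 2 * y := by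
    rw [h]
    nth_rewrite 2 [hq']
    field_simp
  have h2 : (q.den : ℤ) ^ 2 * x = (q.num : ℤ) ^ 2 * y := by exact_mod_cast this
  zify
  rw [sq_abs]
  exact h2

theorem aux_rat_int (r : ℚ) (h : IsIntegral ℤ r) : ∃ a : ℤ, r = a := by
  obtain ⟨y, hy⟩ := IsIntegrallyClosed.isIntegral_iff.mp h
  exact ⟨y, by rw [← hy]; simp⟩

theorem aux_rat_int_sq (r : ℚ) (n : ℤ) (h : r ^ 2 = n) : ∃ a : ℤ, r = a := by
  apply aux_rat_int
  refine IsIntegral.of_pow (n := 2) (by norm_num) ?_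
  rw [h]
  exact isIntegral_algebraMap (R := ℤ) (x := n)

namespace AuxQF

variable {F : Type*} [Field F] [NumberField F] {m : ℕ} {s : F}

theorem one_lt (h : AuxQF F m s) : 1 < m := by have := h.mod; omega

theorem eq_zero (h : AuxQF F m s) {x y : ℚ} (e : x ^ 2 = m * y ^ 2) : x = 0 ∧ y = 0 := by
  by_cases hy : y = 0
  · subst hy; simp at e; exact ⟨e, rfl⟩
  · exfalso
    have := aux_sf_unique_rat (x := m) (y := 1) h.sf squarefree_one (x / y) (by
      intro h0
      have hx : x = 0 := by
        rcases div_eq_zero_iff.mp h0 with h1 | h1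
        · exact h1
        · exact absurd h1 hy
      have hm : (m : ℚ) ≠ 0 := by have := h.one_lt; positivity
      rw [hx] at e
      have : (m : ℚ) * y ^ 2 ≠ 0 := by positivity
      exact this (by rw [← e]; ring)) (by
      field_simp; push_cast; linarith)
    have := h.one_lt
    omega

theorem coord (h : AuxQF F m s) {x y x' y' : ℚ} (e : (x : F) + y * s = x' + y' * s) :
    x = x' ∧ y = y' := by
  have h1 := h.norm (x - x') (y - y')
  have h2 : (((x - x' : ℚ) : F) + ((y - y' : ℚ) : F) * s) = 0 := by
    push_cast; linear_combination e
  rw [h2, Algebra.norm_zero] at h1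
  have := h.eq_zero (x := x - x') (y := y - y') (by linarith)
  exact ⟨by linarith [this.1], by linarith [this.2]⟩

theorem integral (h : AuxQF F m s) {x y : ℚ} (e : IsIntegral ℤ ((x : F) + y * s)) :
    ∃ a b : ℤ, x = a ∧ y = b := by
  obtain ⟨σ, hσ⟩ := h.conj
  have e' : IsIntegral ℤ (σ ((x : F) + y * s)) := e.map σ.toIntAlgHom
  have hσ2 : σ ((x : F) + y * s) = x - y * s := by
    simp [hσ]; ring
  rw [hσ2] at e'
  have t := e.add e'
  have n := e.mul e'
  have ht : ((x : F) + y * s) + (x - y * s) = algebraMap ℚ F (2 * x) := by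
    simp; ring
  have hn : ((x : F) + y * s) * (x - y * s) = algebraMap ℚ F (x ^ 2 - m * y ^ 2) := by
    simp; linear_combination (-(y : F) ^ 2) * h.ssq
  rw [ht, isIntegral_algebraMap_iff (algebraMap ℚ F).injective] at t
  rw [hn, isIntegral_algebraMap_iff (algebraMap ℚ F).injective] at n
  obtain ⟨X, hX⟩ := aux_rat_int _ t
  obtain ⟨N, hN⟩ := aux_rat_int _ n
  have hm0 : (m : ℚ) ≠ 0 := by have := h.one_lt; positivity
  obtain ⟨w, hw⟩ := aux_rat_int_sq (m * (2 * y)) (m * (X ^ 2 - 4 * N)) (by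
    push_cast
    rw [← hX, ← hN]; ring)
  have hw2 : w ^ 2 = m * (X ^ 2 - 4 * N) := by
    have : (w : ℚ) ^ 2 = m * (X ^ 2 - 4 * N) := by
      rw [← hw, ← hX, ← hN]; ring
    exact_mod_cast this
  have hsf : Squarefree (m : ℤ) := Int.squarefree_natCast.mpr h.sf
  have hdw : (m : ℤ) ∣ w := (hsf.dvd_pow_iff_dvd (two_ne_zero)).mp ⟨_, hw2⟩
  obtain ⟨Y, rfl⟩ := hdw
  have hY : 2 * y = Y := by
    push_cast at hw
    exact mul_left_cancel₀ hm0 hw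
  have hm00 : (m : ℤ) ≠ 0 := by exact_mod_cast hm0
  have e1 : m * Y ^ 2 = X ^ 2 - 4 * N := mul_left_cancel₀ hm00 (by linear_combination hw2)
  obtain ⟨t, ht⟩ : ∃ t : ℤ, (m : ℤ) = 4 * t + 2 := ⟨m / 4, by have := h.mod; omega⟩
  rw [ht] at e1
  have hXe : Even X := by
    rw [← Int.even_pow' (n := 2) two_ne_zero]
    exact ⟨(2 * t + 1) * Y ^ 2 + 2 * N, by linarith⟩
  obtain ⟨X', rfl⟩ := hXe
  have hYe : Even Y := by
    rw [← Int.even_pow' (n := 2) two_ne_zero]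
    exact ⟨X' ^ 2 - N - t * Y ^ 2, by linarith⟩
  obtain ⟨Y', rfl⟩ := hYe
  refine ⟨X', Y', ?_, ?_⟩
  · push_cast at hX; linarith
  · push_cast at hY; linarith

theorem isInt_s (h : AuxQF F m s) : IsIntegral ℤ s := by
  refine IsIntegral.of_pow (n := 2) (by norm_num) ?_
  rw [h.ssq]
  exact_mod_cast isIntegral_algebraMap (R := ℤ) (A := F) (x := (m : ℤ))

theorem isInt_mk (h : AuxQF F m s) (a b : ℤ) : IsIntegral ℤ ((a : F) + b * s) := by
  have : ∀ a : ℤ, IsIntegral ℤ (a : F) := fun a => isIntegral_algebraMap (R := ℤ) (A := F) (x := a)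
  exact (this a).add ((this b).mul h.isInt_s)

theorem tp_rat (h : AuxQF F m s) {q : ℚ} (hq : 0 < q) : auxTP (q : F) := by
  have := (h.pos q 0).mpr ⟨hq, by simp; positivity⟩
  simpa using this

theorem tp_sq (h : AuxQF F m s) {η : F} (hη : auxTP η) {q : ℚ} (e : η ^ 2 = q) : ∃ u : ℚ, 0 < u ∧ q = u ^ 2 := by
  obtain ⟨u, v, rfl⟩ := h.span η
  have hu := ((h.pos u v).mp hη).1
  have := h.coord (x := u ^ 2 + m * v ^ 2) (y := 2 * u * v) (x' := q) (y' := 0) (by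
    push_cast
    linear_combination e - (v : F) ^ 2 * h.ssq)
  have hv : v = 0 := by
    rcases mul_eq_zero.mp this.2 with h1 | h1
    · exfalso; linarith
    · exact h1
  refine ⟨u, hu, ?_⟩
  rw [← this.1, hv]; ring

end AuxQF

/-- principal fractional ideal -/
noncomputable def auxSp {F : Type*} [Field F] [NumberField F] (x : F) : FractionalIdeal (𝓞 F)⁰ F :=
  FractionalIdeal.spanSingleton (𝓞 F)⁰ x

section
set_option linter.unusedSectionVars false
variable {F : Type*} [Field F] [NumberField F]

theorem auxSp_mul (x y : F) : auxSp (x * y) = auxSp x * auxSp y :=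
  (FractionalIdeal.spanSingleton_mul_spanSingleton x y).symm

theorem auxSp_one : auxSp (1 : F) = 1 := FractionalIdeal.spanSingleton_one

theorem auxSp_pow (x : F) (n : ℕ) : auxSp (x ^ n) = auxSp x ^ n :=
  (FractionalIdeal.spanSingleton_pow x n).symm

theorem auxSp_inv (x : F) : auxSp (x⁻¹) = (auxSp x)⁻¹ :=
  (FractionalIdeal.spanSingleton_inv F x).symm

theorem auxSp_ne {x : F} (hx : x ≠ 0) : auxSp x ≠ 0 :=
  FractionalIdeal.spanSingleton_ne_zero_iff.mpr hx

theorem aux_mem_one {x : F} : x ∈ (1 : FractionalIdeal (𝓞 F)⁰ F) ↔ IsIntegral ℤ x := by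
  rw [FractionalIdeal.mem_one_iff]
  constructor
  · rintro ⟨y, rfl⟩; exact y.2
  · intro h; exact ⟨⟨x, h⟩, rfl⟩

theorem aux_mem_sp {x y : F} : x ∈ auxSp y ↔ ∃ z : F, IsIntegral ℤ z ∧ x = z * y := by
  unfold auxSp
  rw [FractionalIdeal.mem_spanSingleton]
  constructor
  · rintro ⟨z, rfl⟩; exact ⟨z, z.2, rfl⟩
  · rintro ⟨z, hz, rfl⟩; exact ⟨⟨z, hz⟩, rfl⟩

theorem aux_mem_sp_self (x : F) : x ∈ auxSp x := aux_mem_sp.mpr ⟨1, isIntegral_one, by simp⟩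

theorem auxSp_le {x : F} {I : FractionalIdeal (𝓞 F)⁰ F} : auxSp x ≤ I ↔ x ∈ I :=
  FractionalIdeal.spanSingleton_le_iff_mem

theorem aux_int_mul {x z : F} {I : FractionalIdeal (𝓞 F)⁰ F} (hz : IsIntegral ℤ z) (hx : x ∈ I) :
    z * x ∈ I :=
  (I : Submodule (𝓞 F) F).smul_mem (⟨z, hz⟩ : 𝓞 F) hx

theorem aux_add_mem {x y : F} {I : FractionalIdeal (𝓞 F)⁰ F} (hx : x ∈ I) (hy : y ∈ I) :
    x + y ∈ I := (I : Submodule (𝓞 F) F).add_mem hx hy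

theorem aux_le_add_left (I J : FractionalIdeal (𝓞 F)⁰ F) : I ≤ I + J := by
  rw [← FractionalIdeal.sup_eq_add]; exact le_sup_left

theorem aux_le_add_right (I J : FractionalIdeal (𝓞 F)⁰ F) : J ≤ I + J := by
  rw [← FractionalIdeal.sup_eq_add]; exact le_sup_right

theorem aux_add_le {I J K : FractionalIdeal (𝓞 F)⁰ F} (h1 : I ≤ K) (h2 : J ≤ K) : I + J ≤ K := by
  rw [← FractionalIdeal.sup_eq_add]; exact sup_le h1 h2

theorem aux_add_self (I : FractionalIdeal (𝓞 F)⁰ F) : I + I = I := by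
  rw [← FractionalIdeal.sup_eq_add]; exact sup_idem _

theorem aux_one_le {I : FractionalIdeal (𝓞 F)⁰ F} (h : (1 : F) ∈ I) : 1 ≤ I := by
  rw [← auxSp_one]; exact auxSp_le.mpr h

theorem aux_sqrt_unique {I J : FractionalIdeal (𝓞 F)⁰ F} (hJ : J ≠ 0)
    (h : I ^ 2 = J ^ 2) : I = J := by
  set C := I / J with hC
  have hC2 : C ^ 2 = 1 := by rw [hC, div_pow, h, div_self (pow_ne_zero 2 hJ)]
  have h0 : 1 + C ≠ 0 := by
    intro h0
    have h1 := aux_le_add_left 1 C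
    rw [h0] at h1
    have : (1 : F) ∈ (0 : FractionalIdeal (𝓞 F)⁰ F) := h1 (aux_mem_one.mpr isIntegral_one)
    rw [FractionalIdeal.mem_zero_iff] at this
    exact one_ne_zero this
  have h1 : (1 + C) * C = (1 + C) * 1 := by
    rw [add_mul, one_mul, ← sq, hC2, mul_one, add_comm]
  have h2 := mul_left_cancel₀ h0 h1
  rw [hC] at h2
  exact (div_eq_one_iff_eq hJ).mp h2

theorem auxSp_eq_one {x : F} (h : auxSp x = 1) : IsIntegral ℤ x ∧ IsIntegral ℤ x⁻¹ := by
  constructor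
  · rw [← aux_mem_one, ← h]; exact aux_mem_sp_self x
  · rw [← aux_mem_one, ← inv_one, ← h, ← auxSp_inv]; exact aux_mem_sp_self _

theorem auxSp_int_le {a b : ℕ} (hb : b ≠ 0) (h : auxSp (a : F) ≤ auxSp (b : F)) : b ∣ a := by
  obtain ⟨z, hz, e⟩ := aux_mem_sp.mp (auxSp_le.mp h)
  have hb' : (b : F) ≠ 0 := by exact_mod_cast hb
  have : z = algebraMap ℚ F ((a : ℚ) / b) := by
    rw [map_div₀]; simp only [map_natCast]; rw [e]; field_simp
  rw [this, isIntegral_algebraMap_iff (algebraMap ℚ F).injective] at hz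
  obtain ⟨k, hk⟩ := aux_rat_int _ hz
  have hb'' : (b : ℚ) ≠ 0 := by exact_mod_cast hb
  have : (a : ℤ) = b * k := by
    rw [div_eq_iff hb''] at hk
    have : (a : ℚ) = b * k := by rw [hk]; ring
    exact_mod_cast this
  exact_mod_cast (Dvd.intro _ this.symm : (b : ℤ) ∣ a)

theorem auxNorm_sp (x : F) : FractionalIdeal.absNorm (auxSp x) = |Algebra.norm ℚ x| :=
  FractionalIdeal.absNorm_span_singleton (𝓞 F) x

end

namespace AuxQF

variable {F : Type*} [Field F] [NumberField F] {m : ℕ} {s : F}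

theorem exists_B (h : AuxQF F m s) {b c : ℕ} (hbc : b * c = m) :
    ∃ B : FractionalIdeal (𝓞 F)⁰ F, B ≠ 0 ∧ B ^ 2 = auxSp (b : F) ∧ (b : F) ∈ B ∧ s ∈ B := by
  have hm := h.one_lt
  have hb0 : b ≠ 0 := by rintro rfl; omega
  have hbF : (b : F) ≠ 0 := by exact_mod_cast hb0
  have hcop : Nat.Coprime b c := by
    apply Nat.coprime_of_squarefree_mul; rw [hbc]; exact h.sf
  have hIntg : ∀ n : ℤ, IsIntegral ℤ (n : F) := fun n => isIntegral_algebraMap (R := ℤ) (A := F) (x := n)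
  have hB2 : (auxSp (b : F) + auxSp s) ^ 2 = auxSp (b : F) := by
    have e1 : (auxSp (b : F) + auxSp s) ^ 2 =
        auxSp (b : F) * (auxSp (b : F) + auxSp s + auxSp (c : F)) := by
      have : auxSp s ^ 2 = auxSp (b : F) * auxSp (c : F) := by
        rw [← auxSp_pow, h.ssq, ← hbc, Nat.cast_mul, auxSp_mul]
      have e : (auxSp (b : F) + auxSp s) ^ 2 = auxSp (b : F) * auxSp (b : F) +
          (auxSp (b : F) * auxSp s + auxSp (b : F) * auxSp s) + auxSp s ^ 2 := by ring
      rw [e, aux_add_self, this]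
      ring
    have e2 : auxSp (b : F) + auxSp s + auxSp (c : F) = 1 := by
      apply le_antisymm
      · refine aux_add_le (aux_add_le ?_ ?_) ?_
        · rw [auxSp_le, aux_mem_one]; exact_mod_cast hIntg b
        · rw [auxSp_le, aux_mem_one]; exact h.isInt_s
        · rw [auxSp_le, aux_mem_one]; exact_mod_cast hIntg c
      · apply aux_one_le
        obtain ⟨u, v, huv⟩ := Nat.isCoprime_iff_coprime.mpr hcop
        have : (1 : F) = u * b + v * c := by exact_mod_cast huv.symm
        rw [this]
        apply aux_add_mem
        · exact aux_int_mul (hIntg u) (aux_le_add_left _ _ (aux_le_add_left _ _ (aux_mem_sp_self _)))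
        · exact aux_int_mul (hIntg v) (aux_le_add_right _ _ (aux_mem_sp_self _))
    rw [e1, e2, mul_one]
  refine ⟨auxSp (b : F) + auxSp s, ?_, hB2, aux_le_add_left _ _ (aux_mem_sp_self _),
    aux_le_add_right _ _ (aux_mem_sp_self _)⟩
  intro h0
  rw [h0] at hB2
  exact auxSp_ne hbF (by rw [← hB2]; simp)

theorem dvd_of_sq (h : AuxQF F m s) {b : ℕ} (hb : Squarefree b) {I : FractionalIdeal (𝓞 F)⁰ F}
    (hI : I ^ 2 = auxSp (b : F)) : b ∣ m := by
  have hb0 := hb.ne_zero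
  have hbF : (b : F) ≠ 0 := by exact_mod_cast hb0
  have key : ∀ p : ℕ, p.Prime → p ∣ b → p ∣ m := by
    intro p hp hpb
    by_contra hpm
    have hp' := Nat.prime_iff_prime_int.mp hp
    have hp2 : ¬ (p : ℤ) ∣ 2 := by
      intro h2
      have h2 : p ∣ 2 := by exact_mod_cast h2
      have : p = 2 := (Nat.prime_dvd_prime_iff_eq hp Nat.prime_two).mp h2
      have := h.mod
      apply hpm; subst p; omega
    have hle : I ≤ auxSp (p : F) := by
      intro α hα
      have hα2 : α ^ 2 ∈ auxSp (b : F) := by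
        rw [← hI, sq, sq]; exact FractionalIdeal.mul_mem_mul hα hα
      obtain ⟨δ, hδ, e⟩ := aux_mem_sp.mp hα2
      have hαi : IsIntegral ℤ α := by
        refine IsIntegral.of_pow (n := 2) (by norm_num) ?_
        rw [e]
        exact hδ.mul (by exact_mod_cast isIntegral_algebraMap (R := ℤ) (A := F) (x := (b : ℤ)))
      obtain ⟨x, y, rfl⟩ := h.span α
      obtain ⟨i, j, rfl⟩ := h.span δ
      obtain ⟨x, y, rfl, rfl⟩ := h.integral hαi
      obtain ⟨i, j, rfl, rfl⟩ := h.integral hδ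
      have e2 := h.coord (x := x ^ 2 + m * y ^ 2) (y := 2 * x * y) (x' := i * b) (y' := j * b) (by
        push_cast at e ⊢
        linear_combination e - (y : F) ^ 2 * h.ssq)
      have e3 : x ^ 2 + m * y ^ 2 = i * b := by exact_mod_cast e2.1
      have e4 : 2 * x * y = j * b := by exact_mod_cast e2.2
      have e5 : (x ^ 2 - m * y ^ 2) ^ 2 = (b : ℤ) ^ 2 * (i ^ 2 - m * j ^ 2) := by
        have : (x ^ 2 - m * y ^ 2) ^ 2 = (x ^ 2 + m * y ^ 2) ^ 2 - m * (2 * x * y) ^ 2 := by ring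
        rw [this, e3, e4]; ring
      have e6 : (b : ℤ) ∣ x ^ 2 - m * y ^ 2 := by
        rw [← Int.pow_dvd_pow_iff (n := 2) two_ne_zero]
        exact ⟨_, e5⟩
      have hpb' : (p : ℤ) ∣ b := by exact_mod_cast hpb
      have e7 : (p : ℤ) ∣ x ^ 2 + m * y ^ 2 := by rw [e3]; exact hpb'.mul_left _
      have e8 := hpb'.trans e6
      have hx : (p : ℤ) ∣ x := by
        have : (p : ℤ) ∣ 2 * x ^ 2 := by
          have e9 := dvd_add e7 e8
          rwa [show x ^ 2 + m * y ^ 2 + (x ^ 2 - m * y ^ 2) = 2 * x ^ 2 by ring] at e9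
        exact hp'.dvd_of_dvd_pow ((hp'.dvd_or_dvd this).resolve_left hp2)
      have hy : (p : ℤ) ∣ y := by
        have : (p : ℤ) ∣ 2 * (m * y ^ 2) := by
          have e9 := dvd_sub e7 e8
          rwa [show x ^ 2 + m * y ^ 2 - (x ^ 2 - m * y ^ 2) = 2 * (m * y ^ 2) by ring] at e9
        have := (hp'.dvd_or_dvd this).resolve_left hp2
        refine hp'.dvd_of_dvd_pow ((hp'.dvd_or_dvd this).resolve_left ?_)
        intro h; exact hpm (by exact_mod_cast h)
      obtain ⟨x', rfl⟩ := hx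
      obtain ⟨y', rfl⟩ := hy
      exact aux_mem_sp.mpr ⟨x' + y' * s, h.isInt_mk _ _, by push_cast; ring⟩
    have hle2 : auxSp (b : F) ≤ auxSp ((p ^ 2 : ℕ) : F) := by
      rw [← hI, Nat.cast_pow, auxSp_pow, sq, sq]
      exact mul_le_mul' hle hle
    have := auxSp_int_le (pow_ne_zero 2 hp.ne_zero) hle2
    rw [sq] at this
    exact hp.not_isUnit (hb p this)
  rw [← Nat.prod_primeFactors_of_squarefree hb]
  refine dvd_trans (Finset.prod_dvd_prod_of_subset _ m.primeFactors _ ?_) (Nat.prod_primeFactors_dvd m)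
  intro p hp
  have h1 := Nat.prime_of_mem_primeFactors hp
  exact Nat.mem_primeFactors.mpr ⟨h1, key p h1 (Nat.dvd_of_mem_primeFactors hp), h.sf.ne_zero⟩

theorem ambig (h : AuxQF F m s) {q : ℚ} (hq : 0 < q) {I : FractionalIdeal (𝓞 F)⁰ F}
    (hI : I ^ 2 = auxSp (q : F)) : ∃ b : ℕ, b ∣ m ∧ ∃ k : ℚ, 0 < k ∧
      ∀ B : FractionalIdeal (𝓞 F)⁰ F, B ≠ 0 → B ^ 2 = auxSp (b : F) → I = auxSp (k : F) * B := by
  obtain ⟨b, k, hbk, hb⟩ := Nat.sq_mul_squarefree (q.num.natAbs * q.den)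
  have hn : 0 < q.num := Rat.num_pos.mpr hq
  have hd : 0 < q.den := q.den_pos
  have hk : 0 < k := by
    rcases Nat.eq_zero_or_pos k with rfl | hk
    · exfalso
      have : 0 < q.num.natAbs * q.den := Nat.mul_pos (by omega) hd
      rw [← hbk] at this; simp at this
    · exact hk
  have hqe : q = ((k : ℚ) / q.den) ^ 2 * b := by
    have h1 : (k : ℤ) ^ 2 * b = q.num * q.den := by
      have : ((q.num.natAbs : ℕ) : ℤ) = q.num := by omega
      rw [← this]; exact_mod_cast hbk
    have h2 : (k : ℚ) ^ 2 * b = q.num * q.den := by exact_mod_cast h1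
    have h3 : q = q.num / q.den := (Rat.num_div_den q).symm
    have hd' : (q.den : ℚ) ≠ 0 := by positivity
    rw [div_pow, div_mul_eq_mul_div, h2]
    nth_rewrite 1 [h3]
    field_simp
  set t : ℚ := (k : ℚ) / q.den with ht
  have ht0 : 0 < t := by positivity
  have htF : (t : F) ≠ 0 := by exact_mod_cast ht0.ne'
  have hI' : (auxSp (t : F)⁻¹ * I) ^ 2 = auxSp (b : F) := by
    rw [mul_pow, hI, ← auxSp_pow, ← auxSp_mul]
    congr 1
    rw [hqe]; push_cast; field_simp
  refine ⟨b, h.dvd_of_sq hb hI', t, ht0, fun B hB0 hB => ?_⟩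
  have := aux_sqrt_unique hB0 (hI'.trans hB.symm)
  rw [← this, ← mul_assoc, ← auxSp_mul, mul_inv_cancel₀ htF, auxSp_one, one_mul]

theorem tors (h : AuxQF F m s) {α : F} (hα : auxTP α) {J : FractionalIdeal (𝓞 F)⁰ F}
    (hJ : J ^ 2 = auxSp α) : ∃ b : ℕ, b ∣ m ∧ ∃ β : F, auxTP β ∧
      ∀ B : FractionalIdeal (𝓞 F)⁰ F, B ≠ 0 → B ^ 2 = auxSp (b : F) → J = auxSp β * B := by
  have hn := congrArg FractionalIdeal.absNorm hJ
  rw [map_pow, auxNorm_sp] at hn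
  obtain ⟨x, y, rfl⟩ := h.span α
  obtain ⟨hx, hxy⟩ := (h.pos x y).mp hα
  rw [h.norm, abs_of_pos (by linarith)] at hn
  set r := FractionalIdeal.absNorm J with hr
  have hr0 : 0 ≤ r := FractionalIdeal.absNorm_nonneg J
  have hβ : auxTP (((r + x : ℚ) : F) + y * s) := by
    rw [h.pos]
    exact ⟨by linarith, by nlinarith⟩
  set β := (((r + x : ℚ) : F) + y * s) with hβe
  have hβ2 : β ^ 2 = ((2 * (r + x) : ℚ) : F) * (x + y * s) := by
    have hnF : (r : F) ^ 2 = x ^ 2 - m * y ^ 2 := by exact_mod_cast congrArg (fun q : ℚ => (q : F)) hn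
    rw [hβe]; push_cast
    linear_combination (y : F) ^ 2 * h.ssq + hnF
  have hβ0 : β ≠ 0 := by
    intro h0
    have e0 := h.coord (x := r + x) (y := y) (x' := 0) (y' := 0) (by rw [← hβe, h0]; simp)
    linarith [e0.1]
  have hq0 : (0 : ℚ) < (2 * (r + x))⁻¹ := by positivity
  have hqF : ((2 * (r + x) : ℚ) : F) ≠ 0 := by
    have : (2 * (r + x) : ℚ) ≠ 0 := by positivity
    exact_mod_cast this
  have hI : (auxSp β⁻¹ * J) ^ 2 = auxSp (((2 * (r + x))⁻¹ : ℚ) : F) := by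
    rw [mul_pow, hJ, ← auxSp_pow, ← auxSp_mul]
    congr 1
    rw [Rat.cast_inv, inv_pow, hβ2]
    have hα0 : (x : F) + y * s ≠ 0 := by
      intro h0
      rw [h0, mul_zero] at hβ2
      exact hβ0 (pow_eq_zero_iff two_ne_zero |>.mp hβ2)
    field_simp
  obtain ⟨b, hb, k, hk, hB⟩ := h.ambig hq0 hI
  refine ⟨b, hb, β * k, auxTP_mul hβ (h.tp_rat hk), fun B hB0 hB2 => ?_⟩
  rw [auxSp_mul, mul_assoc, ← hB B hB0 hB2, ← mul_assoc, ← auxSp_mul, mul_inv_cancel₀ hβ0, auxSp_one,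
    one_mul]

end AuxQF

theorem aux_bezout (x y z : ℤ) (h : ∀ p : ℕ, p.Prime → ¬ ((p : ℤ) ∣ x ∧ (p : ℤ) ∣ y ∧ (p : ℤ) ∣ z)) :
    ∃ u v w : ℤ, u * x + v * y + w * z = 1 := by
  have hg : Int.gcd (Int.gcd x y) z = 1 := by
    by_contra hne
    obtain ⟨p, hp, hpd⟩ := Nat.exists_prime_and_dvd hne
    have h1 : (p : ℤ) ∣ (Int.gcd (Int.gcd x y) z : ℤ) := by exact_mod_cast hpd
    have h2 : (p : ℤ) ∣ (Int.gcd x y : ℤ) := h1.trans (Int.gcd_dvd_left ..)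
    exact h p hp ⟨h2.trans (Int.gcd_dvd_left ..), h2.trans (Int.gcd_dvd_right ..),
      h1.trans (Int.gcd_dvd_right ..)⟩
  have e1 := Int.gcd_eq_gcd_ab x y
  have e2 := Int.gcd_eq_gcd_ab (Int.gcd x y) z
  rw [hg, e1] at e2
  generalize (x * x.gcdA y + y * x.gcdB y).gcdA z = k at e2
  generalize (x * x.gcdA y + y * x.gcdB y).gcdB z = l at e2
  refine ⟨x.gcdA y * k, x.gcdB y * k, l, ?_⟩
  push_cast at e2
  linarith

theorem aux_gcd3 {b c : ℕ} (hsf : Squarefree (b * c)) (h2 : 2 ∣ b * c) {x y z : ℤ}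
    (hpr : ∀ p : ℕ, p.Prime → ¬ ((p : ℤ) ∣ x ∧ (p : ℤ) ∣ y ∧ (p : ℤ) ∣ z))
    (h : b * x ^ 2 - c * y ^ 2 = z ^ 2) (p : ℕ) (hp : p.Prime) :
    ¬ ((p : ℤ) ∣ 2 * b * x ∧ (p : ℤ) ∣ 2 * c * y ∧ (p : ℤ) ∣ z) := by
  rintro ⟨hx, hy, hz⟩
  have hp' := Nat.prime_iff_prime_int.mp hp
  have hz2 : (p : ℤ) ^ 2 ∣ z ^ 2 := pow_dvd_pow_of_dvd hz 2
  have hcop := Nat.coprime_of_squarefree_mul hsf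
  have hnn : ¬ (p ∣ b ∧ p ∣ c) := fun ⟨h1, h2⟩ => Nat.not_coprime_of_dvd_of_dvd hp.one_lt h1 h2 hcop
  have hb : ¬ p ∣ b := by
    intro hb
    have hb' : (p : ℤ) ∣ b := by exact_mod_cast hb
    have hc : ¬ (p : ℤ) ∣ c := fun hc => hnn ⟨hb, by exact_mod_cast hc⟩
    have hy : (p : ℤ) ∣ y := by
      have : (p : ℤ) ∣ c * y ^ 2 := by
        rw [show (c : ℤ) * y ^ 2 = b * x ^ 2 - z ^ 2 by linarith]
        exact dvd_sub (hb'.mul_right _) (hz.trans (dvd_pow_self z two_ne_zero))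
      exact hp'.dvd_of_dvd_pow ((hp'.dvd_or_dvd this).resolve_left hc)
    refine hpr p hp ⟨aux_sf_dvd hp hsf.of_mul_left hb x ?_, hy, hz⟩
    rw [show (b : ℤ) * x ^ 2 = z ^ 2 + c * y ^ 2 by linarith]
    exact dvd_add hz2 ((pow_dvd_pow_of_dvd hy 2).mul_left _)
  have hc : ¬ p ∣ c := by
    intro hc
    have hc' : (p : ℤ) ∣ c := by exact_mod_cast hc
    have hb : ¬ (p : ℤ) ∣ b := fun hc => hb (by exact_mod_cast hc)
    have hx : (p : ℤ) ∣ x := by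
      have : (p : ℤ) ∣ b * x ^ 2 := by
        rw [show (b : ℤ) * x ^ 2 = c * y ^ 2 + z ^ 2 by linarith]
        exact dvd_add (hc'.mul_right _) (hz.trans (dvd_pow_self z two_ne_zero))
      exact hp'.dvd_of_dvd_pow ((hp'.dvd_or_dvd this).resolve_left hb)
    refine hpr p hp ⟨hx, aux_sf_dvd hp hsf.of_mul_right hc y ?_, hz⟩
    rw [show (c : ℤ) * y ^ 2 = b * x ^ 2 - z ^ 2 by linarith]
    exact dvd_sub ((pow_dvd_pow_of_dvd hx 2).mul_left _) hz2
  have hp2 : ¬ p ∣ 2 := by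
    intro h
    have : p = 2 := (Nat.prime_dvd_prime_iff_eq hp Nat.prime_two).mp h
    subst this
    rcases (Nat.Prime.dvd_mul hp).mp h2 with h | h
    · exact hb h
    · exact hc h
  have hb2 : ¬ (p : ℤ) ∣ 2 * b := by
    intro h
    have : p ∣ 2 * b := by exact_mod_cast h
    rcases (Nat.Prime.dvd_mul hp).mp this with h | h
    · exact hp2 h
    · exact hb h
  have hc2 : ¬ (p : ℤ) ∣ 2 * c := by
    intro h
    have : p ∣ 2 * c := by exact_mod_cast h
    rcases (Nat.Prime.dvd_mul hp).mp this with h | h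
    · exact hp2 h
    · exact hc h
  exact hpr p hp ⟨(hp'.dvd_or_dvd hx).resolve_left hb2, (hp'.dvd_or_dvd hy).resolve_left hc2, hz⟩

namespace AuxQF

variable {F : Type*} [Field F] [NumberField F] {m : ℕ} {s : F}

theorem sol_of_sq (h : AuxQF F m s) {b c : ℕ} (hbc : b * c = m) {B : FractionalIdeal (𝓞 F)⁰ F}
    (hB : B ^ 2 = auxSp (b : F)) {γ : F} (hγ : auxTP γ) {J : FractionalIdeal (𝓞 F)⁰ F}
    (hJ : B = auxSp γ * J ^ 2) : auxSol b c := by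
  have hm := h.one_lt
  have hb0 : b ≠ 0 := by rintro rfl; omega
  have hN : FractionalIdeal.absNorm B = b := by
    have h1 := congrArg FractionalIdeal.absNorm hB
    rw [map_pow, auxNorm_sp] at h1
    have h2 := h.norm b 0
    simp only [Rat.cast_natCast, Rat.cast_zero, zero_mul, add_zero] at h2
    rw [h2] at h1
    have h3 : |(b : ℚ) ^ 2 - m * 0 ^ 2| = (b : ℚ) ^ 2 := by
      rw [show (b : ℚ) ^ 2 - m * 0 ^ 2 = (b : ℚ) ^ 2 by ring]
      exact abs_of_nonneg (by positivity)
    rw [h3] at h1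
    exact (pow_left_inj₀ (FractionalIdeal.absNorm_nonneg B) (by positivity) two_ne_zero).mp h1
  have h1 := congrArg FractionalIdeal.absNorm hJ
  obtain ⟨X, Y, rfl⟩ := h.span γ
  obtain ⟨hX, hXY⟩ := (h.pos X Y).mp hγ
  rw [hN, map_mul, map_pow, auxNorm_sp, h.norm, abs_of_pos (by linarith)] at h1
  set r := FractionalIdeal.absNorm J with hr
  obtain ⟨n, i, j, hn, hi, hj⟩ : ∃ n i j : ℤ, n ≠ 0 ∧ X * r * n = i ∧ Y * r * n = j := by
    refine ⟨(X * r).den * (Y * r).den, (X * r).num * (Y * r).den, (Y * r).num * (X * r).den, ?_, ?_, ?_⟩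
    · have := (X * r).den_ne_zero
      have := (Y * r).den_ne_zero
      positivity
    · push_cast
      rw [← Rat.mul_den_eq_num (X * r)]; ring
    · push_cast
      rw [← Rat.mul_den_eq_num (Y * r)]; ring
  have e : (b : ℤ) * n ^ 2 = i ^ 2 - m * j ^ 2 := by
    have : (b : ℚ) * n ^ 2 = i ^ 2 - m * j ^ 2 := by
      rw [h1, ← hi, ← hj]; ring
    exact_mod_cast this
  have hbi : (b : ℤ) ∣ i := by
    have hsf : Squarefree (b : ℤ) := by
      rw [Int.squarefree_natCast]; apply Squarefree.of_mul_left (n := c); rw [hbc]; exact h.sf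
    refine (hsf.dvd_pow_iff_dvd two_ne_zero).mp ⟨n ^ 2 + c * j ^ 2, ?_⟩
    have : (m : ℤ) = b * c := by exact_mod_cast hbc.symm
    rw [this] at e
    linarith
  obtain ⟨i, rfl⟩ := hbi
  refine ⟨i, j, n, fun h => hn h.2.2, ?_⟩
  have hb' : (b : ℤ) ≠ 0 := by exact_mod_cast hb0
  apply mul_left_cancel₀ hb'
  have : (m : ℤ) = b * c := by exact_mod_cast hbc.symm
  rw [this] at e
  linarith

theorem sq_of_sol (h : AuxQF F m s) {b c : ℕ} (hbc : b * c = m) {B : FractionalIdeal (𝓞 F)⁰ F}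
    (hB0 : B ≠ 0) (hB : B ^ 2 = auxSp (b : F)) (hs : auxSol b c) :
    ∃ γ : F, auxTP γ ∧ ∃ J : FractionalIdeal (𝓞 F)⁰ F, J ≠ 0 ∧ B = auxSp γ * J ^ 2 := by
  have hm := h.one_lt
  have hb0 : b ≠ 0 := by rintro rfl; omega
  have hbF : (b : F) ≠ 0 := by exact_mod_cast hb0
  have hmF : (m : F) = b * c := by rw [← hbc]; push_cast; rfl
  obtain ⟨hbB, hsB⟩ : (b : F) ∈ B ∧ s ∈ B := by
    obtain ⟨B', h0, h1, h2, h3⟩ := h.exists_B hbc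
    rw [aux_sqrt_unique h0 (hB.trans h1.symm)]; exact ⟨h2, h3⟩
  obtain ⟨x, y, z, hpr, e, hx0⟩ : ∃ x y z : ℤ,
    (∀ p : ℕ, p.Prime → ¬ ((p : ℤ) ∣ x ∧ (p : ℤ) ∣ y ∧ (p : ℤ) ∣ z)) ∧
      b * x ^ 2 - c * y ^ 2 = z ^ 2 ∧ 0 ≤ x := by
    obtain ⟨x, y, z, hpr, e⟩ := auxSol_prim hs
    refine ⟨|x|, y, z, ?_, by rw [sq_abs]; exact e, abs_nonneg x⟩
    intro p hp; rw [dvd_abs]; exact hpr p hp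
  have hz : z ≠ 0 := by
    rintro rfl
    have e1 : ((b * x : ℤ) : ℚ) ^ 2 = m * (y : ℚ) ^ 2 := by
      have : ((b : ℤ) * x) ^ 2 = m * y ^ 2 := by
        rw [← hbc]; push_cast
        linear_combination (b : ℤ) * e
      exact_mod_cast this
    have e2 := h.eq_zero e1
    have hy : y = 0 := by exact_mod_cast e2.2
    have hx : x = 0 := by
      have : (b : ℤ) * x = 0 := by exact_mod_cast e2.1
      rcases mul_eq_zero.mp this with h | h
      · exact absurd (by exact_mod_cast h) hb0
      · exact h
    exact hpr 2 Nat.prime_two (by simp [hx, hy])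
  have hzF : (z : F) ≠ 0 := by exact_mod_cast hz
  have hx : 0 < x := by
    rcases hx0.lt_or_eq with h | h
    · exact h
    · exfalso
      subst h
      have : 0 < z ^ 2 := by positivity
      have : 0 ≤ (c : ℤ) * y ^ 2 := by positivity
      linarith
  have eF : (b : F) * x ^ 2 - c * y ^ 2 = z ^ 2 := by exact_mod_cast congrArg (fun t : ℤ => (t : F)) e
  set γ : F := b * x + y * s with hγ
  set γ' : F := b * x - y * s with hγ'
  have hgg : γ * γ' = b * z ^ 2 := by
    rw [hγ, hγ']
    linear_combination (b : F) * eF - (y : F) ^ 2 * h.ssq - (y : F) ^ 2 * hmF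
  have hγ0 : γ ≠ 0 := by
    intro h0
    rw [h0, zero_mul] at hgg
    exact (mul_ne_zero hbF (pow_ne_zero 2 hzF)) hgg.symm
  have hTP : auxTP γ := by
    have := (h.pos (b * x) y).mpr ⟨by positivity, by
      have e1 : ((b : ℚ) * x) ^ 2 - m * y ^ 2 = b * z ^ 2 := by
        have : ((b : ℤ) * x) ^ 2 - m * y ^ 2 = b * z ^ 2 := by
          rw [← hbc]; push_cast; linear_combination (b : ℤ) * e
        exact_mod_cast this
      have : 0 < (b : ℚ) * z ^ 2 := by positivity
      linarith⟩
    simpa using this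
  have hIntg : ∀ n : ℤ, IsIntegral ℤ (n : F) := fun n => isIntegral_algebraMap (R := ℤ) (A := F) (x := n)
  have hγB : γ ∈ B := by
    refine aux_add_mem ?_ (aux_int_mul (hIntg y) hsB)
    rw [mul_comm]; exact aux_int_mul (hIntg x) hbB
  have hγB' : γ' ∈ B := by
    rw [hγ', sub_eq_add_neg]
    refine aux_add_mem ?_ ?_
    · rw [mul_comm]; exact aux_int_mul (hIntg x) hbB
    · have := aux_int_mul (hIntg (-y)) hsB
      push_cast at this; rwa [neg_mul] at this
  have hBinv : B⁻¹ = auxSp (b : F)⁻¹ * B := by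
    rw [auxSp_inv, ← hB]
    field_simp
  have h1i : (1 : F) ∈ B⁻¹ := by
    rw [hBinv, ← inv_mul_cancel₀ hbF]
    exact FractionalIdeal.mul_mem_mul (aux_mem_sp_self _) hbB
  have hsi : (b : F)⁻¹ * s ∈ B⁻¹ := by
    rw [hBinv]
    exact FractionalIdeal.mul_mem_mul (aux_mem_sp_self _) hsB
  set C := auxSp γ * B⁻¹ with hC
  set C' := auxSp γ' * B⁻¹ with hC'
  have hCC : C * C' = auxSp (z : F) ^ 2 := by
    rw [hC, hC', mul_mul_mul_comm, ← auxSp_mul, hgg, auxSp_mul, ← hB, auxSp_pow]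
    field_simp
  have hsum : C' + auxSp (z : F) + C = 1 := by
    apply le_antisymm
    · refine aux_add_le (aux_add_le ?_ ?_) ?_
      · rw [hC', ← mul_inv_cancel₀ hB0]
        exact mul_le_mul' (auxSp_le.mpr hγB') le_rfl
      · rw [auxSp_le, aux_mem_one]; exact hIntg z
      · rw [hC, ← mul_inv_cancel₀ hB0]
        exact mul_le_mul' (auxSp_le.mpr hγB) le_rfl
    · apply aux_one_le
      obtain ⟨u, v, w, hb⟩ := aux_bezout _ _ _ (aux_gcd3 (by rw [hbc]; exact h.sf)
        (by rw [hbc]; have := h.mod; omega) hpr e)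
      have hCle : C ≤ C' + auxSp (z : F) + C := aux_le_add_right _ _
      have hCle' : C' ≤ C' + auxSp (z : F) + C := (aux_le_add_left _ _).trans (aux_le_add_left _ _)
      have hzle : auxSp (z : F) ≤ C' + auxSp (z : F) + C :=
        (aux_le_add_right _ _).trans (aux_le_add_left _ _)
      have m1 : 2 * (b : F) * x ∈ C' + auxSp (z : F) + C := by
        have : 2 * (b : F) * x = γ * 1 + γ' * 1 := by rw [hγ, hγ']; ring
        rw [this]
        exact aux_add_mem (hCle (FractionalIdeal.mul_mem_mul (aux_mem_sp_self _) h1i))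
          (hCle' (FractionalIdeal.mul_mem_mul (aux_mem_sp_self _) h1i))
      have m2 : 2 * (c : F) * y ∈ C' + auxSp (z : F) + C := by
        have : 2 * (c : F) * y = γ * ((b : F)⁻¹ * s) + ((-1 : ℤ) : F) * (γ' * ((b : F)⁻¹ * s)) := by
          have : (b : F)⁻¹ * s * s = c := by
            rw [mul_assoc, ← sq, h.ssq, hmF]; field_simp
          rw [hγ, hγ', ← this]; push_cast; ring
        rw [this]
        exact aux_add_mem (hCle (FractionalIdeal.mul_mem_mul (aux_mem_sp_self _) hsi))
          (aux_int_mul (hIntg _) (hCle' (FractionalIdeal.mul_mem_mul (aux_mem_sp_self _) hsi)))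
      have hb' : (1 : F) = u * (2 * b * x) + v * (2 * c * y) + w * z := by exact_mod_cast hb.symm
      rw [hb']
      exact aux_add_mem (aux_add_mem (aux_int_mul (hIntg u) m1) (aux_int_mul (hIntg v) m2))
        (aux_int_mul (hIntg w) (hzle (aux_mem_sp_self _)))
  set J := auxSp (z : F) + C with hJ
  have hC0 : C ≠ 0 := mul_ne_zero (auxSp_ne hγ0) (inv_ne_zero hB0)
  have hJ2 : J ^ 2 = C := by
    have e1 : J ^ 2 = auxSp (z : F) ^ 2 + (auxSp (z : F) * C + auxSp (z : F) * C) + C ^ 2 := by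
      rw [hJ]; ring
    rw [e1, aux_add_self, ← hCC]
    have e2 : C * C' + auxSp (z : F) * C + C ^ 2 = C * (C' + auxSp (z : F) + C) := by ring
    rw [e2, hsum, mul_one]
  have hJ0 : J ≠ 0 := by
    intro h0; rw [h0] at hJ2; exact hC0 (by rw [← hJ2]; simp)
  refine ⟨γ, hTP, J⁻¹, inv_ne_zero hJ0, ?_⟩
  have := auxSp_ne hγ0
  rw [inv_pow, hJ2, hC]
  field_simp

end AuxQF

namespace AuxQF

variable {F : Type*} [Field F] [NumberField F] {m : ℕ} {s : F}

/-- The embedding of the group of Pell solutions. -/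
noncomputable def pellHom (h : AuxQF F m s) : Pell.Solution₁ (m : ℤ) →* F where
  toFun a := (a.x : F) + a.y * s
  map_one' := by simp
  map_mul' a b := by
    simp only [Pell.Solution₁.x_mul, Pell.Solution₁.y_mul]
    push_cast
    linear_combination (-(a.y : F) * b.y) * h.ssq

theorem tp_ne {x : F} (h : AuxQF F m s) (hx : auxTP x) : x ≠ 0 := by
  rintro rfl
  have := (h.pos 0 0).mp (by simpa using hx)
  exact lt_irrefl _ this.1

theorem units (h : AuxQF F m s) : ∃ (E : F) (X Y : ℤ), E = X + Y * s ∧ 0 < X ∧ X ^ 2 - m * Y ^ 2 = 1 ∧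
    auxTP E ∧ auxSp E = 1 ∧ (∀ ε : F, auxTP ε → auxSp ε = 1 → ∃ n : ℤ, ε = E ^ n) ∧
    (∀ n : ℤ, E ^ n = 1 → n = 0) := by
  have hm := h.one_lt
  have hns : ¬ IsSquare (m : ℤ) := by
    rintro ⟨r, hr⟩
    have := (h.eq_zero (x := (r : ℚ)) (y := 1) (by
      rw [one_pow, mul_one, sq]; exact_mod_cast hr.symm)).2
    norm_num at this
  obtain ⟨a, ha⟩ := Pell.IsFundamental.exists_of_not_isSquare (by exact_mod_cast (by omega : 0 < m)) hns
  have hz : ∀ n : ℤ, h.pellHom a ^ n = h.pellHom (a ^ n) := fun n => by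
    have := map_zpow (MonoidHom.toHomUnits h.pellHom) a n
    have := congrArg Units.val this
    simpa using this.symm
  have htp : auxTP (h.pellHom a) := by
    have := (h.pos a.x a.y).mpr ⟨by exact_mod_cast ha.x_pos, by
      have := a.prop
      have : (a.x : ℚ) ^ 2 - m * a.y ^ 2 = 1 := by exact_mod_cast this
      linarith⟩
    simpa [pellHom] using this
  refine ⟨h.pellHom a, a.x, a.y, rfl, ha.x_pos, a.prop, htp, ?_, ?_, ?_⟩
  · apply le_antisymm
    · rw [auxSp_le, aux_mem_one]; exact h.isInt_mk _ _
    · apply aux_one_le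
      have : (1 : F) = h.pellHom a⁻¹ * h.pellHom a := by rw [← map_mul]; simp
      rw [this]
      exact aux_int_mul (h.isInt_mk _ _) (aux_mem_sp_self _)
  · intro ε hε h1
    obtain ⟨i1, i2⟩ := auxSp_eq_one h1
    have hε0 := h.tp_ne hε
    have hN : Algebra.norm ℚ ε * Algebra.norm ℚ ε⁻¹ = 1 := by
      rw [← map_mul, mul_inv_cancel₀ hε0, map_one]
    obtain ⟨x, y, rfl⟩ := h.span ε
    obtain ⟨x', y', e⟩ := h.span ((x : F) + y * s)⁻¹
    rw [e] at i2 hN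
    rw [h.norm, h.norm] at hN
    obtain ⟨hx, hxy⟩ := (h.pos _ _).mp hε
    obtain ⟨x, y, rfl, rfl⟩ := h.integral i1
    obtain ⟨x', y', rfl, rfl⟩ := h.integral i2
    have hN' : (x ^ 2 - m * y ^ 2) * (x' ^ 2 - m * y' ^ 2) = 1 := by exact_mod_cast hN
    have hxy' : (0 : ℤ) ≤ x ^ 2 - m * y ^ 2 := by
      have : (m : ℤ) * y ^ 2 < x ^ 2 := by exact_mod_cast hxy
      linarith
    have hx' : 0 < x := by exact_mod_cast hx
    have hone := Int.eq_one_of_mul_eq_one_right hxy' hN'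
    have hε2 : (((x : ℤ) : ℚ) : F) + ((y : ℤ) : ℚ) * s = h.pellHom (Pell.Solution₁.mk x y hone) := by
      simp [pellHom]
    rcases ha.eq_zpow_or_neg_zpow (Pell.Solution₁.mk x y hone) with ⟨n, hn | hn⟩
    · exact ⟨n, by rw [hz, ← hn, hε2]⟩
    · exfalso
      have h3 := Pell.Solution₁.x_zpow_pos ha.x_pos n
      have h4 := congrArg Pell.Solution₁.x hn
      rw [Pell.Solution₁.x_neg, Pell.Solution₁.x_mk] at h4
      omega
  · intro n hn
    rw [hz] at hn
    rw [← ha.zpow_eq_one_iff]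
    have := h.coord (x := (a ^ n).x) (y := (a ^ n).y) (x' := 1) (y' := 0) (by
      simpa [pellHom] using hn)
    apply Pell.Solution₁.ext
    · rw [Pell.Solution₁.x_one]; exact_mod_cast this.1
    · rw [Pell.Solution₁.y_one]; exact_mod_cast this.2

theorem auxTP_zpow {x : F} (hx : auxTP x) (n : ℤ) : auxTP (x ^ n) :=
  fun φ => by rw [map_zpow₀]; exact zpow_pos (hx φ) n

theorem kernel (h : AuxQF F m s) : ∃ b0 : ℕ, b0 ∣ m ∧ b0 ≠ 1 ∧
    (∃ α : F, auxTP α ∧ auxSp α ^ 2 = auxSp (b0 : F)) ∧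
    ∀ b : ℕ, b ∣ m → ∀ α : F, auxTP α → auxSp α ^ 2 = auxSp (b : F) → b = 1 ∨ b = b0 := by
  obtain ⟨E, X, Y, hE, hX, hXY, hETP, hE1, hEgen, hEinj⟩ := h.units
  have hE0 := h.tp_ne hETP
  obtain ⟨b0, k, hbk, hb0⟩ := Nat.sq_mul_squarefree (2 * (1 + X)).natAbs
  have hbk' : (k : ℤ) ^ 2 * b0 = 2 * (1 + X) := by
    have : (((2 * (1 + X)).natAbs : ℕ) : ℤ) = 2 * (1 + X) := by omega
    rw [← this]; exact_mod_cast hbk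
  have hk : 0 < k := by
    rcases Nat.eq_zero_or_pos k with rfl | hk
    · exfalso; norm_num at hbk'; omega
    · exact hk
  have hkF : (k : F) ≠ 0 := by exact_mod_cast hk.ne'
  have hbF : (k : F) ^ 2 * b0 = 2 * (1 + X) := by exact_mod_cast congrArg (fun t : ℤ => (t : F)) hbk'
  have hXYF : (X : F) ^ 2 - m * Y ^ 2 = 1 := by exact_mod_cast congrArg (fun t : ℤ => (t : F)) hXY
  have h1E : (1 + E) ^ 2 = E * (2 * (1 + X)) := by
    rw [hE]; linear_combination (Y : F) ^ 2 * h.ssq - hXYF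
  have hα0 : auxTP ((1 + E) * ((k : ℚ)⁻¹ : ℚ)) := by
    refine auxTP_mul ?_ (h.tp_rat (by positivity))
    intro φ
    rw [map_add, map_one]
    have := hETP φ
    positivity
  set α0 : F := (1 + E) * ((k : ℚ)⁻¹ : ℚ) with hα0e
  have hα02 : α0 ^ 2 = b0 * E := by
    rw [hα0e, mul_pow, h1E, ← hbF]; push_cast; field_simp
  have hα0n := h.tp_ne hα0
  have hsp0 : auxSp α0 ^ 2 = auxSp (b0 : F) := by
    rw [← auxSp_pow, hα02, auxSp_mul, hE1, mul_one]
  have hb0F : (b0 : F) ≠ 0 := by exact_mod_cast hb0.ne_zero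
  refine ⟨b0, h.dvd_of_sq hb0 hsp0, ?_, ⟨α0, hα0, hsp0⟩, ?_⟩
  · rintro rfl
    have h1 : auxSp α0 = 1 := aux_sqrt_unique one_ne_zero (by
      rw [hsp0, one_pow, Nat.cast_one, auxSp_one])
    obtain ⟨n, hn⟩ := hEgen α0 hα0 h1
    have := hEinj (2 * n - 1) (by
      rw [zpow_sub₀ hE0, zpow_one, mul_comm, zpow_mul, ← hn]
      have : α0 ^ (2 : ℤ) = E := by rw [zpow_ofNat, hα02]; simp
      rw [this, div_self hE0])
    omega
  · intro b hb α hα hsp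
    have hbs : Squarefree b := h.sf.squarefree_of_dvd hb
    have hb0' : 0 < b := Nat.pos_of_ne_zero hbs.ne_zero
    have hbF' : (b : F) ≠ 0 := by exact_mod_cast hb0'.ne'
    have hbTP : auxTP ((b : F)⁻¹) := by
      have := h.tp_rat (q := (b : ℚ)⁻¹) (by positivity)
      simpa using this
    have hsp1 : auxSp (α ^ 2 * (b : F)⁻¹) = 1 := by
      rw [auxSp_mul, auxSp_pow, hsp, ← auxSp_mul, mul_inv_cancel₀ hbF', auxSp_one]
    obtain ⟨n, hn⟩ := hEgen _ (auxTP_mul (auxTP_sq (h.tp_ne hα)) hbTP) hsp1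
    have hα2 : α ^ 2 = b * E ^ n := by rw [← hn]; field_simp
    rcases Int.even_or_odd' n with ⟨k, rfl | rfl⟩
    · left
      have hz : E ^ (2 * k) = (E ^ k) ^ 2 := by rw [mul_comm, zpow_mul, zpow_ofNat]
      have hEk : E ^ k ≠ 0 := zpow_ne_zero _ hE0
      obtain ⟨u, hu, e⟩ := h.tp_sq (η := α * (E ^ k)⁻¹) (q := b)
        (auxTP_mul hα (auxTP_inv (auxTP_zpow hETP k))) (by
          rw [mul_pow, hα2, hz, inv_pow]; push_cast; field_simp)
      exact aux_sf_unique_rat hbs squarefree_one u hu.ne' (by rw [e]; simp)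
    · right
      have hz : E ^ (2 * k + 1) = (E ^ k) ^ 2 * E := by
        rw [zpow_add₀ hE0, mul_comm 2 k, zpow_mul, zpow_one, zpow_ofNat]
      have hEk : E ^ k ≠ 0 := zpow_ne_zero _ hE0
      obtain ⟨u, hu, e⟩ := h.tp_sq (η := α * (E ^ k)⁻¹ * α0⁻¹) (q := b / b0)
        (auxTP_mul (auxTP_mul hα (auxTP_inv (auxTP_zpow hETP k))) (auxTP_inv hα0)) (by
          rw [mul_pow, mul_pow, hα2, hz, inv_pow, inv_pow, hα02]; push_cast; field_simp)
      have hb00 : (b0 : ℚ) ≠ 0 := by exact_mod_cast hb0.ne_zero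
      exact aux_sf_unique_rat hbs hb0 u hu.ne' (by rw [← e]; field_simp)

end AuxQF

theorem aux_star {m b b' : ℕ} (hm : Squarefree m) (hb : b ∣ m) (hb' : b' ∣ m) :
    ∃ c k : ℕ, c ∣ m ∧ k ≠ 0 ∧ b * b' = k ^ 2 * c := by
  have hb0 : 0 < b := Nat.pos_of_dvd_of_pos hb (Nat.pos_of_ne_zero hm.ne_zero)
  have hg : 0 < Nat.gcd b b' := Nat.gcd_pos_of_pos_left _ hb0
  refine ⟨(b / Nat.gcd b b') * (b' / Nat.gcd b b'), Nat.gcd b b', ?_, hg.ne', ?_⟩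
  · apply Nat.Coprime.mul_dvd_of_dvd_of_dvd
    · exact Nat.coprime_div_gcd_div_gcd hg
    · exact (Nat.div_dvd_of_dvd (Nat.gcd_dvd_left _ _)).trans hb
    · exact (Nat.div_dvd_of_dvd (Nat.gcd_dvd_right _ _)).trans hb'
  · have h1 := Nat.mul_div_cancel' (Nat.gcd_dvd_left b b')
    have h2 := Nat.mul_div_cancel' (Nat.gcd_dvd_right b b')
    nth_rewrite 1 [← h1]
    nth_rewrite 3 [← h2]
    ring

open Classical in
theorem aux_abs {G : Type*} [CommGroup G] {m b0 : ℕ} (hm : Squarefree m) (cl : ℕ → G)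
    (hmul : ∀ b b' c k : ℕ, b ∣ m → b' ∣ m → c ∣ m → k ≠ 0 → b * b' = k ^ 2 * c →
      cl b * cl b' = cl c) (hb0 : b0 ∣ m) (hb01 : b0 ≠ 1) (hcl0 : cl b0 = 1)
    (hker : ∀ b : ℕ, b ∣ m → cl b = 1 → b = 1 ∨ b = b0) (H : Subgroup G)
    (hsurj : ∀ g ∈ H, g ^ 2 = 1 → ∃ b : ℕ, b ∣ m ∧ cl b = g) :
    (m.divisors.filter (fun b => cl b ∈ H)).card = 2 * Nat.card {g : G // g ∈ H ∧ g ^ 2 = 1} := by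
  have hm0 := hm.ne_zero
  have hcl1 : cl 1 = 1 := by
    have := hmul 1 1 1 1 (one_dvd m) (one_dvd m) (one_dvd m) one_ne_zero (by norm_num)
    simpa using this
  have hne : ∀ b : ℕ, b ∣ m → b ≠ 0 := fun b hb => by
    rintro rfl; exact hm0 (zero_dvd_iff.mp hb)
  have hsq : ∀ b : ℕ, b ∣ m → cl b * cl b = 1 := fun b hb => by
    rw [hmul b b 1 b hb hb (one_dvd m) (hne b hb) (by ring), hcl1]
  set S := m.divisors.filter (fun b => cl b ∈ H) with hS
  have hT : Nat.card {g : G // g ∈ H ∧ g ^ 2 = 1} = (S.image cl).card := by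
    apply Nat.subtype_card
    intro g
    rw [Finset.mem_image]
    constructor
    · rintro ⟨b, hb, rfl⟩
      rw [hS, Finset.mem_filter, Nat.mem_divisors] at hb
      exact ⟨hb.2, by rw [sq]; exact hsq b hb.1.1⟩
    · rintro ⟨hg, hg2⟩
      obtain ⟨b, hb, rfl⟩ := hsurj g hg hg2
      exact ⟨b, by rw [hS, Finset.mem_filter, Nat.mem_divisors]; exact ⟨⟨hb, hm0⟩, hg⟩, rfl⟩
  rw [hT, Finset.card_eq_sum_card_image cl S, mul_comm, ← smul_eq_mul]
  apply Finset.sum_const_nat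
  intro g hg
  obtain ⟨b, hbS, rfl⟩ := Finset.mem_image.mp hg
  have hb := hbS
  rw [hS, Finset.mem_filter, Nat.mem_divisors] at hb
  obtain ⟨⟨hbm, -⟩, hbH⟩ := hb
  obtain ⟨c, k, hc, hk, e⟩ := aux_star hm hbm hb0
  have hclc : cl c = cl b := by
    rw [← hmul b b0 c k hbm hb0 hc hk e, hcl0, mul_one]
  have hbc : b ≠ c := by
    rintro rfl
    apply hb01
    have hb0sf := hm.squarefree_of_dvd hb0
    have : b0 = k ^ 2 := by
      apply Nat.eq_of_mul_eq_mul_left (Nat.pos_of_ne_zero (hne b hbm))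
      rw [e]; ring
    exact aux_sf_unique (k := 1) (l := k) hb0sf squarefree_one one_ne_zero hk (by rw [this]; ring)
  have : S.filter (fun x => cl x = cl b) = {b, c} := by
    ext x
    rw [Finset.mem_filter, hS, Finset.mem_filter, Nat.mem_divisors, Finset.mem_insert,
      Finset.mem_singleton]
    constructor
    · rintro ⟨⟨⟨hx, -⟩, -⟩, hxb⟩
      obtain ⟨y, l, hy, hl, e2⟩ := aux_star hm hbm hx
      have hxs := hm.squarefree_of_dvd hx
      have hcly : cl y = 1 := by rw [← hmul b x y l hbm hx hy hl e2, hxb, hsq b hbm]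
      rcases hker y hy hcly with rfl | rfl
      · left
        refine aux_sf_unique (k := b) (l := l) hxs (hm.squarefree_of_dvd hbm) (hne b hbm) hl ?_
        rw [sq, mul_assoc, e2]; ring
      · right
        refine aux_sf_unique (k := b) (l := l * k) hxs (hm.squarefree_of_dvd hc) (hne b hbm)
          (Nat.mul_ne_zero hl hk) ?_
        rw [sq, mul_assoc, e2, mul_pow, mul_assoc, ← e]; ring
    · rintro (rfl | rfl)
      · exact ⟨⟨⟨hbm, hm0⟩, hbH⟩, rfl⟩
      · exact ⟨⟨⟨hc, hm0⟩, by rw [hclc]; exact hbH⟩, hclc⟩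
  rw [this, Finset.card_pair hbc]

open Classical in
theorem aux_abs2 {G : Type*} [CommGroup G] {d : ℕ} (hd : Squarefree d) (hodd : Odd d) (cl : ℕ → G)
    (H : Subgroup G) (h2 : cl 2 ∈ H) (hmul : ∀ b : ℕ, b ∣ d → cl 2 * cl b = cl (2 * b)) :
    ((2 * d).divisors.filter (fun b => cl b ∈ H)).card =
      2 * (d.divisors.filter (fun b => cl b ∈ H)).card := by
  have hd0 := hd.ne_zero
  have key : (2 * d).divisors.filter (fun b => cl b ∈ H) =
      d.divisors.filter (fun b => cl b ∈ H) ∪ (d.divisors.filter (fun b => cl b ∈ H)).image (2 * ·) := by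
    ext x
    simp only [Finset.mem_union, Finset.mem_image, Finset.mem_filter, Nat.mem_divisors]
    constructor
    · rintro ⟨⟨hx, -⟩, hH⟩
      rcases Nat.even_or_odd' x with ⟨y, rfl | rfl⟩
      · right
        have hy : y ∣ d := Nat.dvd_of_mul_dvd_mul_left two_pos hx
        refine ⟨y, ⟨⟨hy, hd0⟩, ?_⟩, rfl⟩
        rw [← hmul y hy] at hH
        exact (H.mul_mem_cancel_left h2).mp hH
      · left
        refine ⟨⟨?_, hd0⟩, hH⟩
        exact Nat.Coprime.dvd_of_dvd_mul_left (by simp) hx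
    · rintro (⟨⟨hx, -⟩, hH⟩ | ⟨y, ⟨⟨hy, -⟩, hH⟩, rfl⟩)
      · exact ⟨⟨hx.mul_left 2, by omega⟩, hH⟩
      · refine ⟨⟨Nat.mul_dvd_mul_left 2 hy, by omega⟩, ?_⟩
        rw [← hmul y hy]; exact H.mul_mem h2 hH
  rw [key, Finset.card_union_of_disjoint, Finset.card_image_of_injective, two_mul]
  · intro a b hab; simpa using hab
  · rw [Finset.disjoint_left]
    intro x hx hx'
    obtain ⟨y, -, rfl⟩ := Finset.mem_image.mp hx'
    simp only [Finset.mem_filter, Nat.mem_divisors] at hx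
    have h2d : 2 ∣ d := (Dvd.intro _ rfl).trans hx.1.1
    exact (Nat.not_even_iff_odd.mpr hodd) (even_iff_two_dvd.mpr h2d)

namespace AuxQF

variable {F : Type*} [Field F] [NumberField F] {m : ℕ} {s : F}

theorem mk_eq_one_iff (h : AuxQF F m s) (I : (FractionalIdeal (𝓞 F)⁰ F)ˣ) :
    (QuotientGroup.mk I : NarrowClassGroup F) = 1 ↔
      ∃ α : F, auxTP α ∧ (I : FractionalIdeal (𝓞 F)⁰ F) = auxSp α := by
  rw [QuotientGroup.eq_one_iff, aux_mem_narrow]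
  constructor
  · rintro ⟨u, hu, rfl⟩
    exact ⟨u, hu, by rw [coe_toPrincipalIdeal]; rfl⟩
  · rintro ⟨α, hα, e⟩
    refine ⟨Units.mk0 α (h.tp_ne hα), hα, ?_⟩
    rw [toPrincipalIdeal_eq_iff, e]; rfl

open Classical in
theorem final {d : ℕ} (h : AuxQF F (2 * d) s) (hodd : Odd d) (hd : Squarefree d) (hsol : auxSol 2 d) :
    Nat.card {g : NarrowClassGroup F // g ∈ auxSq (NarrowClassGroup F) ∧ g ^ 2 = 1} =
      (d.divisors.filter (fun b => auxSol b (2 * (d / b)))).card := by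
  have hex : ∀ b : ℕ, ∃ B : (FractionalIdeal (𝓞 F)⁰ F)ˣ, b ∣ 2 * d →
      (B : FractionalIdeal (𝓞 F)⁰ F) ^ 2 = auxSp (b : F) := by
    intro b
    by_cases hb : b ∣ 2 * d
    · obtain ⟨B, hB0, hB, -, -⟩ := h.exists_B (Nat.mul_div_cancel' hb)
      exact ⟨Units.mk0 B hB0, fun _ => hB⟩
    · exact ⟨1, fun hb' => absurd hb' hb⟩
  choose B hB using hex
  set cl : ℕ → NarrowClassGroup F := fun b => QuotientGroup.mk (B b) with hcl
  have hmul : ∀ b b' c k : ℕ, b ∣ 2 * d → b' ∣ 2 * d → c ∣ 2 * d → k ≠ 0 → b * b' = k ^ 2 * c →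
      cl b * cl b' = cl c := by
    intro b b' c k hb hb' hc hk e
    have hkF : (k : F) ≠ 0 := by exact_mod_cast hk
    have hk' : (0 : ℚ) < k := by positivity
    have h1 : (B b : FractionalIdeal (𝓞 F)⁰ F) * B b' = auxSp (k : F) * B c := by
      apply aux_sqrt_unique (mul_ne_zero (auxSp_ne hkF) (B c).ne_zero)
      rw [mul_pow, mul_pow, hB b hb, hB b' hb', hB c hc, ← auxSp_mul, ← auxSp_pow, ← auxSp_mul]
      congr 1
      exact_mod_cast congrArg (fun t : ℕ => (t : F)) e
    have h2 : (QuotientGroup.mk (B b * B b' * (B c)⁻¹) : NarrowClassGroup F) = 1 := by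
      rw [h.mk_eq_one_iff]
      refine ⟨k, by simpa using h.tp_rat hk', ?_⟩
      rw [Units.val_mul, Units.val_mul, h1, mul_assoc, Units.mul_inv, mul_one]
    have h3 : cl b * cl b' * (cl c)⁻¹ = 1 := h2
    exact mul_inv_eq_one.mp h3
  obtain ⟨b0, hb0, hb01, ⟨α0, hα0, hα02⟩, hker⟩ := h.kernel
  have hcl0 : cl b0 = 1 := by
    refine (h.mk_eq_one_iff _).mpr ⟨α0, hα0, ?_⟩
    exact aux_sqrt_unique (auxSp_ne (h.tp_ne hα0)) ((hB b0 hb0).trans hα02.symm)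
  have hker' : ∀ b : ℕ, b ∣ 2 * d → cl b = 1 → b = 1 ∨ b = b0 := by
    intro b hb hb1
    obtain ⟨α, hα, e⟩ := (h.mk_eq_one_iff _).mp hb1
    exact hker b hb α hα (by rw [← e]; exact hB b hb)
  have hsurj : ∀ g ∈ auxSq (NarrowClassGroup F), g ^ 2 = 1 → ∃ b : ℕ, b ∣ 2 * d ∧ cl b = g := by
    intro g _ hg
    obtain ⟨J, rfl⟩ := QuotientGroup.mk_surjective g
    have hg' : (QuotientGroup.mk (J ^ 2) : NarrowClassGroup F) = 1 := hg
    obtain ⟨α, hα, e⟩ := (h.mk_eq_one_iff _).mp hg'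
    obtain ⟨b, hb, β, hβ, hh⟩ := h.tors hα (J := J) (by rw [← e]; simp)
    refine ⟨b, hb, ?_⟩
    have h1 := hh (B b) (B b).ne_zero (hB b hb)
    have h2 : (QuotientGroup.mk (J * (B b)⁻¹) : NarrowClassGroup F) = 1 := by
      rw [h.mk_eq_one_iff]
      refine ⟨β, hβ, ?_⟩
      rw [Units.val_mul, h1, mul_assoc, Units.mul_inv, mul_one]
    have h3 : (QuotientGroup.mk J : NarrowClassGroup F) * (cl b)⁻¹ = 1 := h2
    exact (mul_inv_eq_one.mp h3).symm
  have hiff : ∀ b : ℕ, b ∣ 2 * d → (cl b ∈ auxSq (NarrowClassGroup F) ↔ auxSol b (2 * d / b)) := by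
    intro b hb
    have hbc := Nat.mul_div_cancel' hb
    constructor
    · rintro ⟨g, hg⟩
      obtain ⟨J, rfl⟩ := QuotientGroup.mk_surjective g
      have hg' : (QuotientGroup.mk J : NarrowClassGroup F) ^ 2 = cl b := hg
      have h2 : (QuotientGroup.mk (B b * (J ^ 2)⁻¹) : NarrowClassGroup F) = 1 := by
        have : cl b * ((QuotientGroup.mk J : NarrowClassGroup F) ^ 2)⁻¹ = 1 := by
          rw [hg', mul_inv_cancel]
        exact this
      obtain ⟨γ, hγ, e⟩ := (h.mk_eq_one_iff _).mp h2
      refine h.sol_of_sq hbc (hB b hb) hγ (J := J) ?_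
      rw [← e, Units.val_mul, mul_assoc, ← Units.val_pow_eq_pow_val, Units.inv_mul, mul_one]
    · intro hs
      obtain ⟨γ, hγ, J, hJ0, e⟩ := h.sq_of_sol hbc (B b).ne_zero (hB b hb) hs
      refine ⟨QuotientGroup.mk (Units.mk0 J hJ0), ?_⟩
      have h2 : (QuotientGroup.mk (B b * ((Units.mk0 J hJ0) ^ 2)⁻¹) : NarrowClassGroup F) = 1 := by
        rw [h.mk_eq_one_iff]
        refine ⟨γ, hγ, ?_⟩
        have : (B b : FractionalIdeal (𝓞 F)⁰ F) = auxSp γ * ((Units.mk0 J hJ0 ^ 2 : (FractionalIdeal (𝓞 F)⁰ F)ˣ) : FractionalIdeal (𝓞 F)⁰ F) := by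
          rw [e]; simp
        rw [Units.val_mul, this, mul_assoc, Units.mul_inv, mul_one]
      have h3 : cl b * ((QuotientGroup.mk (Units.mk0 J hJ0) : NarrowClassGroup F) ^ 2)⁻¹ = 1 := h2
      exact (mul_inv_eq_one.mp h3).symm
  have r1 := aux_abs h.sf cl hmul hb0 hb01 hcl0 hker' (auxSq (NarrowClassGroup F)) hsurj
  have r2 := aux_abs2 hd hodd cl (auxSq (NarrowClassGroup F))
    ((hiff 2 (Dvd.intro _ rfl)).mpr (by simpa using hsol))
    (fun b hb => hmul 2 b (2 * b) 1 (Dvd.intro _ rfl) (hb.mul_left 2) (Nat.mul_dvd_mul_left 2 hb)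
      one_ne_zero (by ring))
  have r3 : Nat.card {g : NarrowClassGroup F // g ∈ auxSq (NarrowClassGroup F) ∧ g ^ 2 = 1} =
      (d.divisors.filter (fun b => cl b ∈ auxSq (NarrowClassGroup F))).card := by omega
  rw [r3]
  congr 1
  apply Finset.filter_congr
  intro b hb
  have hb' := Nat.dvd_of_mem_divisors hb
  rw [hiff b (hb'.mul_left 2), Nat.mul_div_assoc 2 hb']

end AuxQF

theorem aux_quad_gen {F : Type*} [Field F] [NumberField F] (pb : PowerBasis ℚ F) (m : ℕ)
    (hsf : Squarefree m) (hmod : m % 4 = 2)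
    (hgmin : minpoly ℚ pb.gen = Polynomial.X ^ 2 - Polynomial.C (m : ℚ)) : AuxQF F m pb.gen := by
  have hdim : pb.dim = 2 := by
    rw [← pb.natDegree_minpoly, hgmin]; exact Polynomial.natDegree_X_pow_sub_C
  have hss : pb.gen ^ 2 = (m : F) := by
    have := minpoly.aeval ℚ pb.gen
    rw [hgmin] at this
    simpa [sub_eq_zero] using this
  refine ⟨hss, ?_, ?_, ?_, ?_, hsf, hmod⟩
  · intro z
    obtain ⟨f, hf, e⟩ : ∃ g : Polynomial ℚ, g.degree < (minpoly ℚ pb.gen).degree ∧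
        z = Polynomial.aeval pb.gen g := by
      obtain ⟨f, e⟩ := pb.exists_eq_aeval' z
      refine ⟨f %ₘ minpoly ℚ pb.gen,
        Polynomial.degree_modByMonic_lt f (minpoly.monic pb.isIntegral_gen), ?_⟩
      rw [e, Polynomial.modByMonic_eq_sub_mul_div]; simp
    rw [hgmin, Polynomial.degree_X_pow_sub_C two_pos] at hf
    have := Polynomial.eq_X_add_C_of_degree_le_one (p := f) (by
      by_cases hf0 : f = 0
      · rw [hf0]; simp
      · exact Polynomial.degree_le_of_natDegree_le (n := 1) (Nat.le_of_lt_succ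
          ((Polynomial.natDegree_lt_iff_degree_lt hf0).mpr hf)))
    rw [this] at e
    refine ⟨f.coeff 0, f.coeff 1, ?_⟩
    rw [e]; simp; ring
  · intro x y
    let b := pb.basis.reindex (finCongr hdim)
    have hb0 : b 0 = 1 := by simp [b]
    have hb1 : b 1 = pb.gen := by simp [b]
    have hr : ∀ u v : ℚ, b.repr ((u : F) + v * pb.gen) = Finsupp.single 0 u + Finsupp.single 1 v := by
      intro u v
      have : (u : F) + v * pb.gen = u • b 0 + v • b 1 := by
        rw [hb0, hb1, Algebra.smul_def, Algebra.smul_def]; simp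
      rw [this]; simp
    have e0 : b.repr (((x : F) + y * pb.gen) * b 0) = Finsupp.single 0 x + Finsupp.single 1 y := by
      rw [hb0, mul_one, hr]
    have e1 : b.repr (((x : F) + y * pb.gen) * b 1) =
        Finsupp.single 0 (m * y) + Finsupp.single 1 x := by
      rw [hb1, ← hr]
      congr 1
      push_cast
      linear_combination (y : F) * hss
    rw [Algebra.norm_eq_matrix_det b, Matrix.det_fin_two]
    simp only [Algebra.leftMulMatrix_eq_repr_mul, e0, e1]
    simp
    ring
  · refine ⟨(pb.lift (-pb.gen) ?_).toRingHom, ?_⟩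
    · rw [hgmin]; simp [hss]
    · simp
  · intro x y
    have hm2 : (Real.sqrt m) ^ 2 = m := Real.sq_sqrt (Nat.cast_nonneg m)
    constructor
    · intro hp
      have h1 := hp (pb.lift (Real.sqrt m) (by rw [hgmin]; simp)).toRingHom
      have h2 := hp (pb.lift (-Real.sqrt m) (by rw [hgmin]; simp)).toRingHom
      simp at h1 h2
      constructor
      · have : (0 : ℝ) < x := by linarith
        exact_mod_cast this
      · have : (m : ℝ) * y ^ 2 < x ^ 2 := by
          have h3 := mul_pos h1 (sub_pos.mpr h2)
          rw [← hm2]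
          nlinarith
        exact_mod_cast this
    · rintro ⟨hx, hxy⟩ φ
      rw [map_add, map_mul, map_ratCast, map_ratCast]
      have ht : (φ pb.gen) ^ 2 = m := by rw [← map_pow, hss, map_natCast]
      have hx' : (0 : ℝ) < x := by exact_mod_cast hx
      have hxy' : (m : ℝ) * y ^ 2 < x ^ 2 := by exact_mod_cast hxy
      have := abs_lt_of_sq_lt_sq (a := (y : ℝ) * φ pb.gen) (b := x) (by
        rw [mul_pow, ht]; linarith) hx'.le
      have := neg_lt_of_abs_lt this
      linarith

theorem aux_quad (m : ℕ) (hsf : Squarefree m) (hmod : m % 4 = 2) :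
    ∃ (_ : NumberField (quadField m)) (s : quadField m), AuxQF (quadField m) m s := by
  have hm0 : 0 < m := by omega
  unfold quadField
  set θ : ℂ := (Real.sqrt m : ℂ) with hθ
  have hθ2 : θ ^ 2 = m := by
    rw [hθ]
    have := Real.sq_sqrt (Nat.cast_nonneg (α := ℝ) m)
    exact_mod_cast congrArg (fun t : ℝ => (t : ℂ)) this
  have hnsq : ∀ r : ℚ, r ^ 2 ≠ m := by
    intro r hr
    have hr0 : r ≠ 0 := by
      rintro rfl
      have : (m : ℚ) ≠ 0 := by positivity
      exact this (by rw [← hr]; ring)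
    have := aux_sf_unique_rat hsf squarefree_one r hr0 (by rw [hr]; simp)
    omega
  have hmon : (Polynomial.X ^ 2 - Polynomial.C (m : ℚ)).Monic :=
    Polynomial.monic_X_pow_sub_C _ two_ne_zero
  have hirr : Irreducible (Polynomial.X ^ 2 - Polynomial.C (m : ℚ)) := by
    rw [X_pow_sub_C_irreducible_iff_of_prime Nat.prime_two]
    exact hnsq
  have hmin : minpoly ℚ θ = Polynomial.X ^ 2 - Polynomial.C (m : ℚ) := by
    refine (minpoly.eq_of_irreducible_of_monic hirr ?_ hmon).symm
    simp [hθ2]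
  have hIntg : IsIntegral ℚ θ := ⟨_, hmon, by simp [hθ2]⟩
  have hfd : FiniteDimensional ℚ ℚ⟮θ⟯ := IntermediateField.adjoin.finiteDimensional hIntg
  have hnf : NumberField ℚ⟮θ⟯ := ⟨⟩
  refine ⟨hnf, (IntermediateField.adjoin.powerBasis hIntg).gen,
    aux_quad_gen (IntermediateField.adjoin.powerBasis hIntg) m hsf hmod ?_⟩
  rw [IntermediateField.adjoin.powerBasis_gen]
  exact (IntermediateField.minpoly_gen ℚ θ).trans hmin

/-- for `d` a positive odd squarefree integer all of whose prime divisors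
`p` satisfy `(2/p) = 1`,
`2^{rk₄ Cl⁺(8d)} = 2^{-ω(d)} Σ_{d = D₀D₁D₂D₃} (-1/D₃)(D₂/D₀)(D₁/D₃)(D₃/D₀)(D₀/D₃)`,
the sum being over ordered 4-tuples of positive integers with product `d`, the symbols
being Jacobi symbols. -/
theorem stmt10 (d : ℕ) (hpos : 0 < d) (hodd : Odd d) (hsf : Squarefree d)
    (hleg : ∀ p : ℕ, p.Prime → p ∣ d → jacobiSym 2 p = 1) :
    (fourRankPow (NarrowClassGroup (quadField (2 * d))) : ℚ) =
      (2 : ℚ) ^ (-(d.primeFactors.card : ℤ)) *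
        ∑ t ∈ (d.divisors ×ˢ d.divisors ×ˢ d.divisors ×ˢ d.divisors).filter
            (fun t : ℕ × ℕ × ℕ × ℕ => t.1 * t.2.1 * t.2.2.1 * t.2.2.2 = d),
          ((jacobiSym (-1) t.2.2.2 * jacobiSym t.2.2.1 t.1 * jacobiSym t.2.1 t.2.2.2 *
            jacobiSym t.2.2.2 t.1 * jacobiSym t.1 t.2.2.2 : ℤ) : ℚ) := by
  classical
  have hsf2 : Squarefree (2 * d) := by
    rw [Nat.squarefree_mul (by simpa using hodd)]
    exact ⟨Nat.prime_two.prime.squarefree, hsf⟩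
  have hmod : 2 * d % 4 = 2 := by
    obtain ⟨k, rfl⟩ := hodd
    omega
  obtain ⟨hnf, s, h⟩ := aux_quad (2 * d) hsf2 hmod
  have hfin : Finite (auxSq (NarrowClassGroup (quadField (2 * d)))) := aux_finite
  rw [aux_fourRank, h.final hodd hsf (auxSol_two d hodd hsf hleg)]
  have hc := aux_count d hpos hodd hsf hleg
  rw [← Int.cast_sum, ← hc, zpow_neg, zpow_natCast]
  push_cast
  rw [← mul_assoc, inv_mul_cancel₀ (by positivity), one_mul]
end

section
/- Let k ≥ 1. Define λ_k : 𝔽₂^{2k} → 𝔽₂ by λ_k(u) = Σ_{j=0}^{k−1} u_{2j+1}·u_{2j+2}, and Φ_k : 𝔽₂^{2k} × 𝔽₂^{2k} → 𝔽₂ by Φ_k(u, v) = Σ_{j=0}^{k−1} (u_{2j+1} + v_{2j+1})·(u_{2j+1} + v_{2j+2}). Call u, v ∈ 𝔽₂^{2k} unlinked if Φ_k(u, v) = Φ_k(v, u), call a subset of 𝔽₂^{2k} unlinked if its elements are pairwise unlinked, and call an unlinked subset maximal if it is maximal with respect to inclusion among unlinked subsets. For a maximal unlinked subset U, define γ⁺(U,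 1) = Σ_{S ⊆ U, |S| odd} (−1)^{e⁺(S)}, where e⁺(S) = Σ_{u ∈ S} λ_k(u) + Σ_{{u,v} ⊆ S, u ≠ v} Φ_k(u, v) ∈ 𝔽₂ and (−1)^x means 1 if x = 0 and −1 if x = 1. Then Σ_U γ⁺(U, 1) = 2^{2^k − 1}·N(k, 2), where the sum is over all maximal unlinked subsets U of 𝔽₂^{2k} and N(k, 2) is the total number of 𝔽₂-vector subspaces of 𝔽₂^k. -/
open scoped Classical

/-- `λ_k(u) = Σ_{j=0}^{k-1} u_{2j+1}·u_{2j+2} ∈ 𝔽₂` (coordinates indexed by `Fin (2k)`). -/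
def lambdaK {k : ℕ} (u : Fin (2 * k) → ZMod 2) : ZMod 2 :=
  ∑ j : Fin k,
    u ⟨2 * j.1, by have := j.2; omega⟩ * u ⟨2 * j.1 + 1, by have := j.2; omega⟩

/-- `Φ_k(u,v) = Σ_{j=0}^{k-1} (u_{2j+1} + v_{2j+1})·(u_{2j+1} + v_{2j+2}) ∈ 𝔽₂`. -/
def phiK {k : ℕ} (u v : Fin (2 * k) → ZMod 2) : ZMod 2 :=
  ∑ j : Fin k,
    (u ⟨2 * j.1, by have := j.2; omega⟩ + v ⟨2 * j.1, by have := j.2; omega⟩) *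
      (u ⟨2 * j.1, by have := j.2; omega⟩ + v ⟨2 * j.1 + 1, by have := j.2; omega⟩)

/-- `u` and `v` are unlinked if `Φ_k(u,v) = Φ_k(v,u)`. -/
def Unlinked {k : ℕ} (u v : Fin (2 * k) → ZMod 2) : Prop := phiK u v = phiK v u

/-- A maximal unlinked subset of `𝔽₂^{2k}`: pairwise unlinked and maximal with respect
to inclusion among unlinked subsets. -/
def IsMaxUnlinked {k : ℕ} (U : Finset (Fin (2 * k) → ZMod 2)) : Prop :=
  (∀ u ∈ U, ∀ v ∈ U, Unlinked u v) ∧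
    ∀ U' : Finset (Fin (2 * k) → ZMod 2),
      (∀ u ∈ U', ∀ v ∈ U', Unlinked u v) → U ⊆ U' → U' = U

/-- An explicit injective encoding of `𝔽₂^{2k}` into `ℕ`, used to enumerate each
unordered pair of distinct elements exactly once. -/
def encV {k : ℕ} (v : Fin (2 * k) → ZMod 2) : ℕ := ∑ i, (v i).val * 2 ^ (i : ℕ)

/-- `e⁺(S) = Σ_{u ∈ S} λ_k(u) + Σ_{{u,v} ⊆ S, u ≠ v} Φ_k(u,v) ∈ 𝔽₂`, the second sum
over unordered pairs of distinct elements of `S`. -/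
def ePlus {k : ℕ} (S : Finset (Fin (2 * k) → ZMod 2)) : ZMod 2 :=
  ∑ u ∈ S, lambdaK u +
    ∑ p ∈ (S ×ˢ S).filter (fun p => encV p.1 < encV p.2), phiK p.1 p.2

/-- `γ⁺(U, 1) = Σ_{S ⊆ U, |S| odd} (-1)^{e⁺(S)}`. -/
def gammaPlus {k : ℕ} (U : Finset (Fin (2 * k) → ZMod 2)) : ℤ :=
  ∑ S ∈ U.powerset.filter (fun S => Odd S.card), if ePlus S = 0 then 1 else -1

def cA {k : ℕ} (u : Fin (2 * k) → ZMod 2) : Fin k → ZMod 2 :=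
  fun j => u ⟨2 * j.1, by have := j.2; omega⟩

def cC {k : ℕ} (u : Fin (2 * k) → ZMod 2) : Fin k → ZMod 2 :=
  fun j => u ⟨2 * j.1, by have := j.2; omega⟩ + u ⟨2 * j.1 + 1, by have := j.2; omega⟩

theorem z2 (x : ZMod 2) : x + x = 0 := by revert x; decide

theorem v2 {k : ℕ} (x : Fin k → ZMod 2) : x + x = 0 := by
  funext j; exact z2 _

theorem cA_add {k : ℕ} (u v : Fin (2 * k) → ZMod 2) : cA (u + v) = cA u + cA v := rfl

theorem cC_add {k : ℕ} (u v : Fin (2 * k) → ZMod 2) : cC (u + v) = cC u + cC v := by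
  funext j; simp only [cC, Pi.add_apply]; ring

def mkV {k : ℕ} (a c : Fin k → ZMod 2) : Fin (2 * k) → ZMod 2 :=
  fun i => if i.1 % 2 = 0 then a ⟨i.1 / 2, by have := i.2; omega⟩
    else a ⟨i.1 / 2, by have := i.2; omega⟩ + c ⟨i.1 / 2, by have := i.2; omega⟩

theorem cA_mkV {k : ℕ} (a c : Fin k → ZMod 2) : cA (mkV a c) = a := by
  funext j
  simp [cA, mkV]

theorem cC_mkV {k : ℕ} (a c : Fin k → ZMod 2) : cC (mkV a c) = c := by
  funext j
  have h1 : (2 * j.1 + 1) / 2 = j.1 := by omega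
  have h2 : (2 * j.1 + 1) % 2 = 1 := by omega
  simp [cC, mkV, h1, h2, ← add_assoc, z2]

theorem mkV_eq {k : ℕ} (u : Fin (2 * k) → ZMod 2) : mkV (cA u) (cC u) = u := by
  funext i
  by_cases h : i.1 % 2 = 0
  · have : 2 * (i.1 / 2) = i.1 := by omega
    simp [cA, mkV, h, this]
  · have h1 : 2 * (i.1 / 2) + 1 = i.1 := by omega
    simp [cA, cC, mkV, h, h1, ← add_assoc, z2]

theorem phi_eq {k : ℕ} (u v : Fin (2 * k) → ZMod 2) :
    phiK u v = (cA u + cA v) ⬝ᵥ (cA u + cA v + cC v) := by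
  unfold phiK dotProduct
  refine Finset.sum_congr rfl fun j _ => ?_
  simp only [cA, cC, Pi.add_apply]
  generalize u _ = x
  generalize v ⟨2 * j.1, _⟩ = y
  generalize v _ = z
  revert x y z; decide

theorem lam_eq {k : ℕ} (u : Fin (2 * k) → ZMod 2) :
    lambdaK u = cA u ⬝ᵥ (1 + cC u) := by
  unfold lambdaK dotProduct
  refine Finset.sum_congr rfl fun j _ => ?_
  simp only [cA, cC, Pi.add_apply, Pi.one_apply]
  generalize u ⟨2 * j.1, _⟩ = y
  generalize u _ = z
  revert y z; decide

theorem dot_self {k : ℕ} (a : Fin k → ZMod 2) : a ⬝ᵥ a = a ⬝ᵥ 1 := by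
  unfold dotProduct
  refine Finset.sum_congr rfl fun j _ => ?_
  simp only [Pi.one_apply]
  generalize a j = x
  revert x; decide

theorem unl_iff {k : ℕ} (u v : Fin (2 * k) → ZMod 2) :
    Unlinked u v ↔ (cA u + cA v) ⬝ᵥ (cC u + cC v) = 0 := by
  unfold Unlinked
  rw [phi_eq, phi_eq, add_comm (cA v) (cA u), dotProduct_add, dotProduct_add (cA u + cA v) _ (cC u),
    add_right_inj, dotProduct_add]
  generalize (cA u + cA v) ⬝ᵥ cC v = x
  generalize (cA u + cA v) ⬝ᵥ cC u = y
  revert x y; decide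

theorem phi_self {k : ℕ} (u : Fin (2 * k) → ZMod 2) : phiK u u = 0 := by
  rw [phi_eq, v2, zero_dotProduct]

/-- triangle sum -/
theorem tri_eq {k : ℕ} (x y z : Fin (2 * k) → ZMod 2) :
    phiK x y + phiK y z + phiK x z = (cA x + cA y) ⬝ᵥ (cC y + cC z) := by
  simp only [phi_eq, dotProduct_add, add_dotProduct]
  rw [dotProduct_comm (cA y) (cA x), dotProduct_comm (cA z) (cA x), dotProduct_comm (cA z) (cA y)]
  grind

theorem unl_add {k : ℕ} (x y z u : Fin (2 * k) → ZMod 2) (hxy : Unlinked x y) (hyz : Unlinked y z)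
    (hxz : Unlinked x z) (hx : Unlinked x u) (hy : Unlinked y u) (hz : Unlinked z u) :
    Unlinked (x + y + z) u := by
  rw [unl_iff] at *
  simp only [cA_add, cC_add, dotProduct_add, add_dotProduct] at *
  grind

theorem phi_add {k : ℕ} (x y z s : Fin (2 * k) → ZMod 2) :
    phiK s x + phiK s y + phiK s z + phiK s (x + y + z)
      = lambdaK x + lambdaK y + lambdaK z + lambdaK (x + y + z) := by
  simp only [phi_eq, lam_eq, cA_add, cC_add, dotProduct_add, add_dotProduct, ← dot_self]
  grind [dotProduct_comm]

theorem phi_add' {k : ℕ} (x y z : Fin (2 * k) → ZMod 2) (hxy : Unlinked x y) (hyz : Unlinked y z)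
    (hxz : Unlinked x z) :
    phiK x (x + y + z) + phiK y (x + y + z) + phiK z (x + y + z) = 0 := by
  rw [unl_iff] at *
  simp only [phi_eq, cA_add, cC_add, dotProduct_add, add_dotProduct] at *
  grind [dotProduct_comm]

theorem enc_inj_aux (n : ℕ) (v w : Fin n → ZMod 2)
    (h : ∑ i, (v i).val * 2 ^ (i : ℕ) = ∑ i, (w i).val * 2 ^ (i : ℕ)) : v = w := by
  induction n with
  | zero => exact Subsingleton.elim _ _
  | succ n ih =>
    rw [Fin.sum_univ_succ, Fin.sum_univ_succ] at h
    simp only [Fin.val_zero, pow_zero, mul_one, Fin.val_succ, pow_succ, ← mul_assoc,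
      ← Finset.sum_mul] at h
    have h1 := ZMod.val_lt (v 0)
    have h2 := ZMod.val_lt (w 0)
    have h3 : (v 0).val = (w 0).val := by omega
    have h4 := ih (fun i => v i.succ) (fun i => w i.succ) (by omega)
    funext i
    refine Fin.cases ?_ (fun j => ?_) i
    · exact ZMod.val_injective _ h3
    · exact congrFun h4 j

theorem enc_inj {k : ℕ} {v w : Fin (2 * k) → ZMod 2} (h : encV v = encV w) : v = w :=
  enc_inj_aux _ v w h

theorem ePlus_insert {k : ℕ} (S : Finset (Fin (2 * k) → ZMod 2)) (x : Fin (2 * k) → ZMod 2)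
    (hx : x ∉ S) (hS : ∀ s ∈ S, Unlinked s x) :
    ePlus (insert x S) = ePlus S + lambdaK x + ∑ s ∈ S, phiK s x := by
  unfold ePlus
  rw [Finset.sum_insert hx]
  simp only [Finset.sum_filter, Finset.sum_product]
  rw [Finset.sum_insert hx, Finset.sum_insert hx]
  simp only [Finset.sum_insert hx, lt_irrefl, if_false, Finset.sum_add_distrib]
  have : ∑ s ∈ S, phiK s x = ∑ s ∈ S, (if encV x < encV s then phiK x s else 0)
      + ∑ s ∈ S, (if encV s < encV x then phiK s x else 0) := by
    rw [← Finset.sum_add_distrib]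
    refine Finset.sum_congr rfl fun s hs => ?_
    rcases lt_trichotomy (encV x) (encV s) with h | h | h
    · simp [h, h.le.not_gt, show phiK s x = phiK x s from hS s hs]
    · exact absurd (enc_inj h ▸ hs) hx
    · simp [h, h.le.not_gt]
  rw [this]
  ring

theorem sum_tog {k : ℕ} (S : Finset (Fin (2 * k) → ZMod 2)) (x : Fin (2 * k) → ZMod 2)
    (g : (Fin (2 * k) → ZMod 2) → ZMod 2) :
    ∑ s ∈ symmDiff S {x}, g s = ∑ s ∈ S, g s + g x := by
  by_cases hx : x ∈ S
  · have : symmDiff S {x} = S.erase x := by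
      ext y; simp only [Finset.mem_symmDiff, Finset.mem_singleton, Finset.mem_erase]; grind
    rw [this, ← Finset.sum_erase_add S g hx, add_assoc, z2, add_zero]
  · have : symmDiff S {x} = insert x S := by
      ext y; simp only [Finset.mem_symmDiff, Finset.mem_singleton, Finset.mem_insert]; grind
    rw [this, Finset.sum_insert hx, add_comm]

theorem e_tog {k : ℕ} (S : Finset (Fin (2 * k) → ZMod 2)) (x : Fin (2 * k) → ZMod 2)
    (hS : ∀ s ∈ S, Unlinked s x) :
    ePlus (symmDiff S {x}) = ePlus S + lambdaK x + ∑ s ∈ S, phiK s x := by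
  by_cases hx : x ∈ S
  · have h1 : symmDiff S {x} = S.erase x := by
      ext y; simp only [Finset.mem_symmDiff, Finset.mem_singleton, Finset.mem_erase]; grind
    have h2 := ePlus_insert (S.erase x) x (Finset.notMem_erase _ _)
      (fun s hs => hS s (Finset.mem_of_mem_erase hs))
    rw [Finset.insert_erase hx] at h2
    rw [h1, h2, ← Finset.sum_erase_add S _ hx, phi_self]
    grind
  · have : symmDiff S {x} = insert x S := by
      ext y; simp only [Finset.mem_symmDiff, Finset.mem_singleton, Finset.mem_insert]; grind
    rw [this, ePlus_insert S x hx hS]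

theorem tog_sub {k : ℕ} {U S : Finset (Fin (2 * k) → ZMod 2)} {x : Fin (2 * k) → ZMod 2}
    (hS : S ⊆ U) (hx : x ∈ U) : symmDiff S {x} ⊆ U := by
  intro y; simp only [Finset.mem_symmDiff, Finset.mem_singleton]; grind

theorem card_tog {k : ℕ} (S : Finset (Fin (2 * k) → ZMod 2)) (x : Fin (2 * k) → ZMod 2) :
    ((symmDiff S {x}).card : ZMod 2) = S.card + 1 := by
  have := sum_tog S x (fun _ => 1)
  simpa using this

theorem odd_cast (n : ℕ) : Odd n ↔ (n : ZMod 2) = 1 := (ZMod.natCast_eq_one_iff_odd).symm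

/-- A fixed toggling set `T` that flips `e` on odd subsets kills `γ`. -/
theorem gamma_zero {k : ℕ} (U T : Finset (Fin (2 * k) → ZMod 2))
    (h : ∀ S ⊆ U, Odd S.card → symmDiff S T ⊆ U ∧ Odd (symmDiff S T).card ∧
      ePlus (symmDiff S T) = ePlus S + 1) : gammaPlus U = 0 := by
  unfold gammaPlus
  have key : ∀ x : ZMod 2, ((if x = 0 then 1 else -1 : ℤ) + if x + 1 = 0 then 1 else -1) = 0 := by
    decide
  refine Finset.sum_involution (fun S _ => symmDiff S T) ?_ ?_ ?_ ?_
  · intro S hS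
    simp only [Finset.mem_filter, Finset.mem_powerset] at hS
    simp only [(h S hS.1 hS.2).2.2]
    exact key _
  · intro S hS _ heq
    simp only [Finset.mem_filter, Finset.mem_powerset] at hS
    have := (h S hS.1 hS.2).2.2
    rw [heq] at this
    simp at this
  · intro S hS
    simp only [Finset.mem_filter, Finset.mem_powerset] at hS ⊢
    exact ⟨(h S hS.1 hS.2).1, (h S hS.1 hS.2).2.1⟩
  · intro S hS
    exact symmDiff_symmDiff_cancel_right _ _

theorem mem_of_unl {k : ℕ} {U : Finset (Fin (2 * k) → ZMod 2)} (hU : IsMaxUnlinked U)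
    (t : Fin (2 * k) → ZMod 2) (ht : ∀ u ∈ U, Unlinked t u) : t ∈ U := by
  have := hU.2 (insert t U) (by
    intro u hu v hv
    rw [Finset.mem_insert] at hu hv
    rcases hu with rfl | hu <;> rcases hv with rfl | hv
    · rfl
    · exact ht v hv
    · exact (ht u hu).symm
    · exact hU.1 u hu v hv) (Finset.subset_insert _ _)
  rw [← this]; exact Finset.mem_insert_self _ _

theorem tri_zero {k : ℕ} {U : Finset (Fin (2 * k) → ZMod 2)} (hU : IsMaxUnlinked U)
    (hg : gammaPlus U ≠ 0) (x y z : Fin (2 * k) → ZMod 2) (hx : x ∈ U) (hy : y ∈ U) (hz : z ∈ U) :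
    phiK x y + phiK y z + phiK x z = 0 := by
  by_contra hne
  have hne1 : phiK x y + phiK y z + phiK x z = 1 := by
    revert hne; generalize phiK x y + phiK y z + phiK x z = w; revert w; decide
  apply hg
  have ht : x + y + z ∈ U := mem_of_unl hU _ fun u hu =>
    unl_add x y z u (hU.1 _ hx _ hy) (hU.1 _ hy _ hz) (hU.1 _ hx _ hz) (hU.1 _ hx _ hu)
      (hU.1 _ hy _ hu) (hU.1 _ hz _ hu)
  have hp := phi_add' x y z (hU.1 _ hx _ hy) (hU.1 _ hy _ hz) (hU.1 _ hx _ hz)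
  have hq := phi_add x y z
  generalize x + y + z = t at *
  refine gamma_zero U (symmDiff (symmDiff (symmDiff {x} {y}) {z}) {t}) ?_
  intro S hS hodd
  simp only [← symmDiff_assoc]
  have s1 := tog_sub hS hx
  have s2 := tog_sub s1 hy
  have s3 := tog_sub s2 hz
  have s4 := tog_sub s3 ht
  refine ⟨s4, ?_, ?_⟩
  · rw [odd_cast] at hodd ⊢
    simp only [card_tog, hodd]
    decide
  · rw [e_tog _ _ (fun s hs => hU.1 _ (s3 hs) _ ht), e_tog _ _ (fun s hs => hU.1 _ (s2 hs) _ hz),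
      e_tog _ _ (fun s hs => hU.1 _ (s1 hs) _ hy), e_tog _ _ (fun s hs => hU.1 _ (hS hs) _ hx)]
    simp only [sum_tog]
    have h5 : ∑ s ∈ S, phiK s x + ∑ s ∈ S, phiK s y + ∑ s ∈ S, phiK s z + ∑ s ∈ S, phiK s t
        = lambdaK x + lambdaK y + lambdaK z + lambdaK t := by
      simp only [← Finset.sum_add_distrib, hq]
      rw [Finset.sum_const, nsmul_eq_mul, (odd_cast _).1 hodd, one_mul]
    grind

theorem lam_const {k : ℕ} {U : Finset (Fin (2 * k) → ZMod 2)} (hU : IsMaxUnlinked U)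
    (hg : gammaPlus U ≠ 0) (x y : Fin (2 * k) → ZMod 2) (hx : x ∈ U) (hy : y ∈ U) :
    lambdaK x = lambdaK y := by
  by_contra hne
  have hne1 : lambdaK x + lambdaK y = 1 := by
    revert hne; generalize lambdaK x = w; generalize lambdaK y = v; revert w v; decide
  apply hg
  refine gamma_zero U (symmDiff {x} {y}) ?_
  intro S hS hodd
  simp only [← symmDiff_assoc]
  have s1 := tog_sub hS hx
  have s2 := tog_sub s1 hy
  refine ⟨s2, ?_, ?_⟩
  · rw [odd_cast] at hodd ⊢
    simp only [card_tog, hodd]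
    decide
  · rw [e_tog _ _ (fun s hs => hU.1 _ (s1 hs) _ hy), e_tog _ _ (fun s hs => hU.1 _ (hS hs) _ hx)]
    simp only [sum_tog]
    have h5 : ∑ s ∈ S, phiK s x + ∑ s ∈ S, phiK s y = phiK x y := by
      rw [← Finset.sum_add_distrib, Finset.sum_congr rfl (g := fun _ => phiK x y)]
      · rw [Finset.sum_const, nsmul_eq_mul, (odd_cast _).1 hodd, one_mul]
      · intro s hs
        have := tri_zero hU hg s x y (hS hs) hx hy
        grind
    grind

/-- the dot product as a bilinear form -/
noncomputable def dotB (k : ℕ) : LinearMap.BilinForm (ZMod 2) (Fin k → ZMod 2) :=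
  dotProductBilin (ZMod 2) (ZMod 2)

theorem dotB_apply {k : ℕ} (a b : Fin k → ZMod 2) : dotB k a b = a ⬝ᵥ b := rfl

theorem dotB_refl (k : ℕ) : (dotB k).IsRefl := by
  intro a b h
  rw [dotB_apply] at *
  rw [dotProduct_comm]; exact h

theorem dotB_nondeg (k : ℕ) : (dotB k).Nondegenerate := by
  refine ⟨fun a h => dotProduct_eq_zero a h, fun a h => dotProduct_eq_zero a fun w => ?_⟩
  rw [dotProduct_comm]; exact h w

theorem mem_perp {k : ℕ} (P : Submodule (ZMod 2) (Fin k → ZMod 2)) (q : Fin k → ZMod 2) :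
    q ∈ (dotB k).orthogonal P ↔ ∀ p ∈ P, p ⬝ᵥ q = 0 := Iff.rfl

theorem mem_of_perp {k : ℕ} (P : Submodule (ZMod 2) (Fin k → ZMod 2)) (a : Fin k → ZMod 2)
    (h : ∀ q ∈ (dotB k).orthogonal P, a ⬝ᵥ q = 0) : a ∈ P := by
  rw [← LinearMap.BilinForm.orthogonal_orthogonal (dotB_nondeg k) (dotB_refl k) P, mem_perp]
  intro q hq
  rw [dotProduct_comm]; exact h q hq

noncomputable def setP {k : ℕ} (P : Submodule (ZMod 2) (Fin k → ZMod 2)) :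
    Finset (Fin (2 * k) → ZMod 2) :=
  Finset.univ.filter fun u => cA u ∈ P ∧ 1 + cC u ∈ (dotB k).orthogonal P

theorem mem_setP {k : ℕ} (P : Submodule (ZMod 2) (Fin k → ZMod 2)) (u : Fin (2 * k) → ZMod 2) :
    u ∈ setP P ↔ cA u ∈ P ∧ 1 + cC u ∈ (dotB k).orthogonal P := by
  simp [setP]

theorem one_one_add {k : ℕ} (c : Fin k → ZMod 2) : 1 + (1 + c) = c := by
  rw [← add_assoc, v2, zero_add]

theorem card_setP {k : ℕ} (P : Submodule (ZMod 2) (Fin k → ZMod 2)) :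
    (setP P).card = 2 ^ k := by
  have h1 : (setP P).card = Fintype.card (P × (dotB k).orthogonal P) := by
    rw [← Finset.card_univ]
    symm
    refine Finset.card_bij (fun x _ => mkV x.1.1 (1 + x.2.1)) ?_ ?_ ?_
    · intro x _
      rw [mem_setP, cA_mkV, cC_mkV, one_one_add]
      exact ⟨x.1.2, x.2.2⟩
    · intro x _ y _ h
      have ha := congrArg cA h
      have hc := congrArg cC h
      rw [cA_mkV, cA_mkV] at ha
      rw [cC_mkV, cC_mkV, add_right_inj] at hc
      exact Prod.ext (Subtype.ext ha) (Subtype.ext hc)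
    · intro u hu
      rw [mem_setP] at hu
      exact ⟨(⟨_, hu.1⟩, ⟨_, hu.2⟩), Finset.mem_univ _, by simp only [one_one_add, mkV_eq]⟩
  rw [h1, Fintype.card_prod, Module.card_eq_pow_finrank (K := ZMod 2),
    Module.card_eq_pow_finrank (K := ZMod 2) (V := (dotB k).orthogonal P), ← pow_add, ZMod.card,
    LinearMap.BilinForm.finrank_orthogonal (dotB_nondeg k)]
  have := Submodule.finrank_le P
  rw [Module.finrank_fin_fun] at *
  congr 1; omega

theorem setP_inj {k : ℕ} : Function.Injective (setP (k := k)) := by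
  intro P Q h
  ext a
  have h1 : ∀ R : Submodule (ZMod 2) (Fin k → ZMod 2), mkV a 1 ∈ setP R ↔ a ∈ R := by
    intro R
    rw [mem_setP, cA_mkV, cC_mkV, v2]
    simp
  rw [← h1 P, h, h1]

theorem add_mem_aux {k : ℕ} {P : Submodule (ZMod 2) (Fin k → ZMod 2)} {c c' : Fin k → ZMod 2}
    (hc : 1 + c ∈ P) (hc' : 1 + c' ∈ P) : c + c' ∈ P := by
  have := P.add_mem hc hc'
  rwa [add_add_add_comm, v2, zero_add] at this

theorem phi_setP {k : ℕ} (P : Submodule (ZMod 2) (Fin k → ZMod 2)) (u v : Fin (2 * k) → ZMod 2)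
    (hu : u ∈ setP P) (hv : v ∈ setP P) : phiK u v = 0 := by
  rw [mem_setP] at *
  have h := hv.2 _ (P.add_mem hu.1 hv.1)
  change (cA u + cA v) ⬝ᵥ (1 + cC v) = 0 at h
  rw [phi_eq, dotProduct_add, dot_self, ← dotProduct_add, h]

theorem lam_setP {k : ℕ} (P : Submodule (ZMod 2) (Fin k → ZMod 2)) (u : Fin (2 * k) → ZMod 2)
    (hu : u ∈ setP P) : lambdaK u = 0 := by
  rw [mem_setP] at hu
  rw [lam_eq]
  exact hu.2 _ hu.1

theorem setP_max {k : ℕ} (P : Submodule (ZMod 2) (Fin k → ZMod 2)) : IsMaxUnlinked (setP P) := by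
  refine ⟨fun u hu v hv => ?_, fun U' hU' hsub => ?_⟩
  · unfold Unlinked
    rw [phi_setP P u v hu hv, phi_setP P v u hv hu]
  · refine Finset.Subset.antisymm (fun u hu => ?_) hsub
    have key : ∀ p ∈ P, ∀ q ∈ (dotB k).orthogonal P, (cA u + p) ⬝ᵥ (1 + cC u + q) = 0 := by
      intro p hp q hq
      have h1 : mkV p (1 + q) ∈ setP P := by
        rw [mem_setP, cA_mkV, cC_mkV, one_one_add]; exact ⟨hp, hq⟩
      have h2 := (unl_iff _ _).1 (hU' u hu _ (hsub h1))
      rw [cA_mkV, cC_mkV] at h2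
      rw [← h2]; congr 1; abel
    have h0 := key 0 P.zero_mem 0 (Submodule.zero_mem _)
    rw [add_zero, add_zero] at h0
    rw [mem_setP]
    constructor
    · apply mem_of_perp
      intro q hq
      have := key 0 P.zero_mem q hq
      rwa [add_zero, dotProduct_add, h0, zero_add] at this
    · rw [mem_perp]
      intro p hp
      have := key p hp 0 (Submodule.zero_mem _)
      rwa [add_zero, add_dotProduct, h0, zero_add] at this

theorem card_odd {k : ℕ} (U : Finset (Fin (2 * k) → ZMod 2)) (hU : U.Nonempty) :
    (U.powerset.filter (fun S => Odd S.card)).card = 2 ^ (U.card - 1) := by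
  obtain ⟨x, hx⟩ := hU
  have h1 : (U.powerset.filter (fun S => Odd S.card)).card
      = (U.powerset.filter (fun S => ¬ Odd S.card)).card := by
    refine Finset.card_bij (fun S _ => symmDiff S {x}) ?_ ?_ ?_
    · intro S hS
      simp only [Finset.mem_filter, Finset.mem_powerset, odd_cast, card_tog] at *
      exact ⟨tog_sub hS.1 hx, by rw [hS.2]; decide⟩
    · intro S _ T _ h
      exact symmDiff_left_injective _ h
    · intro S hS
      refine ⟨symmDiff S {x}, ?_, symmDiff_symmDiff_cancel_right _ _⟩
      simp only [Finset.mem_filter, Finset.mem_powerset, odd_cast, card_tog] at *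
      refine ⟨tog_sub hS.1 hx, ?_⟩
      have h := hS.2
      revert h
      generalize (S.card : ZMod 2) = w
      revert w; decide
  have h2 := Finset.card_filter_add_card_filter_not (s := U.powerset) (fun S => Odd S.card)
  rw [← h1, Finset.card_powerset] at h2
  have h3 : 0 < U.card := Finset.card_pos.2 ⟨x, hx⟩
  obtain ⟨n, hn⟩ : ∃ n, U.card = n + 1 := ⟨U.card - 1, by omega⟩
  rw [hn, pow_succ] at h2
  rw [hn, Nat.add_sub_cancel]
  omega

theorem gamma_setP {k : ℕ} (P : Submodule (ZMod 2) (Fin k → ZMod 2)) :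
    gammaPlus (setP P) = 2 ^ (2 ^ k - 1) := by
  unfold gammaPlus
  have he : ∀ S ∈ (setP P).powerset.filter (fun S => Odd S.card),
      (if ePlus S = 0 then 1 else -1 : ℤ) = 1 := by
    intro S hS
    have hS' := Finset.mem_powerset.1 (Finset.mem_filter.1 hS).1
    rw [if_pos]
    unfold ePlus
    rw [Finset.sum_eq_zero fun u hu => lam_setP P u (hS' hu), Finset.sum_eq_zero, add_zero]
    intro p hp
    have := Finset.mem_product.1 (Finset.mem_filter.1 hp).1
    exact phi_setP P _ _ (hS' this.1) (hS' this.2)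
  rw [Finset.sum_congr rfl he, Finset.sum_const, card_odd, card_setP]
  · simp
  · rw [← Finset.card_pos, card_setP]; positivity

theorem exists_setP {k : ℕ} {U : Finset (Fin (2 * k) → ZMod 2)} (hU : IsMaxUnlinked U)
    (hg : gammaPlus U ≠ 0) : ∃ P, setP P = U := by
  obtain ⟨o, ho⟩ : U.Nonempty := by
    rw [Finset.nonempty_iff_ne_empty]
    rintro rfl
    exact absurd (mem_of_unl hU 0 (by simp)) (by simp)
  have tri : ∀ x ∈ U, ∀ z ∈ U, (cA x + cA o) ⬝ᵥ (cC o + cC z) = 0 := fun x hx z hz => by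
    rw [← tri_eq]; exact tri_zero hU hg x o z hx ho hz
  let P : Submodule (ZMod 2) (Fin k → ZMod 2) :=
    Submodule.span (ZMod 2) {a | ∃ x ∈ U, a = cA x + cA o}
  have hP : ∀ x ∈ U, cA x + cA o ∈ P := fun x hx => Submodule.subset_span ⟨x, hx, rfl⟩
  have hQ : ∀ z ∈ U, cC o + cC z ∈ (dotB k).orthogonal P := by
    intro z hz
    rw [mem_perp]
    intro p hp
    induction hp using Submodule.span_induction with
    | mem a ha => obtain ⟨x, hx, rfl⟩ := ha; exact tri x hx z hz
    | zero => exact zero_dotProduct _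
    | add a b _ _ h1 h2 => rw [add_dotProduct, h1, h2, add_zero]
    | smul r a _ h => rw [smul_dotProduct, h, smul_zero]
  -- all of the coset lies in U
  have hin : ∀ p ∈ P, ∀ q ∈ (dotB k).orthogonal P, mkV (cA o + p) (cC o + q) ∈ U := by
    intro p hp q hq
    apply mem_of_unl hU
    intro u hu
    rw [unl_iff, cA_mkV, cC_mkV]
    have e1 : cA o + p + cA u = (cA u + cA o) + p := by abel
    have e2 : cC o + q + cC u = (cC o + cC u) + q := by abel
    rw [e1, e2]
    exact (Submodule.add_mem _ (hQ u hu) hq) _ (P.add_mem (hP u hu) hp)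
  have hl : ∀ p ∈ P, ∀ q ∈ (dotB k).orthogonal P,
      (cA o + p) ⬝ᵥ (1 + (cC o + q)) = cA o ⬝ᵥ (1 + cC o) := by
    intro p hp q hq
    have := lam_const hU hg _ _ (hin p hp q hq) ho
    rwa [lam_eq, lam_eq, cA_mkV, cC_mkV] at this
  have ha : cA o ∈ P := by
    apply mem_of_perp
    intro q hq
    have := hl 0 P.zero_mem q hq
    rwa [add_zero, ← add_assoc, dotProduct_add, add_eq_left] at this
  have hc : 1 + cC o ∈ (dotB k).orthogonal P := by
    rw [mem_perp]
    intro p hp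
    have := hl p hp 0 (Submodule.zero_mem _)
    rwa [add_zero, add_dotProduct, add_eq_left] at this
  refine ⟨P, ?_⟩
  ext u
  rw [mem_setP]
  constructor
  · rintro ⟨h1, h2⟩
    have := hin (cA o + cA u) (P.add_mem ha h1) (cC o + cC u) (add_mem_aux hc h2)
    rwa [← add_assoc, ← add_assoc, v2, v2, zero_add, zero_add, mkV_eq] at this
  · intro hu
    constructor
    · have := P.add_mem (hP u hu) ha
      rwa [add_assoc, v2, add_zero] at this
    · have := Submodule.add_mem _ hc (hQ u hu)
      rwa [add_assoc, ← add_assoc (cC o), v2, zero_add] at this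

/-- `Σ_U γ⁺(U, 1) = 2^{2^k - 1}·N(k, 2)`, the sum being over all maximal
unlinked subsets `U` of `𝔽₂^{2k}`, where `N(k, 2)` is the number of `𝔽₂`-subspaces
of `𝔽₂^k`. -/
theorem stmt14 (k : ℕ) (hk : 1 ≤ k) :
    ∑ U ∈ Finset.univ.filter
        (fun U : Finset (Fin (2 * k) → ZMod 2) => IsMaxUnlinked U), gammaPlus U =
      2 ^ (2 ^ k - 1) * (Nat.card (Submodule (ZMod 2) (Fin k → ZMod 2)) : ℤ) := by
  have hfin : Finite (Submodule (ZMod 2) (Fin k → ZMod 2)) := Finite.of_injective _ setP_inj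
  letI := Fintype.ofFinite (Submodule (ZMod 2) (Fin k → ZMod 2))
  rw [← Finset.sum_subset (s₁ := Finset.univ.image setP)]
  · rw [Finset.sum_image (fun P _ Q _ h => setP_inj h), Finset.sum_congr rfl
      (fun P _ => gamma_setP P), Finset.sum_const, Nat.card_eq_fintype_card, Finset.card_univ,
      nsmul_eq_mul, mul_comm]
  · intro U hU
    obtain ⟨P, _, rfl⟩ := Finset.mem_image.1 hU
    exact Finset.mem_filter.2 ⟨Finset.mem_univ _, setP_max P⟩
  · intro U hU hn
    by_contra hg
    obtain ⟨P, rfl⟩ := exists_setP (Finset.mem_filter.1 hU).2 hg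
    exact hn (Finset.mem_image_of_mem _ (Finset.mem_univ _))
end

section
/- Let d > 1 be an odd squarefree integer with d ≡ 1 (mod 4) such that every prime p dividing d satisfies (2/p) = 1. Then rk₄ Cl⁺(8d) ≥ 1, i.e., the narrow class group of ℚ(√(2d)) contains an element of order 4. -/
open NumberField IntermediateField
open scoped nonZeroDivisors

/-! ### Group theory -/

lemma sq_inj_contra {G : Type*} [CommGroup G] [Finite G] (χ : G →* ℤˣ)
    (hχ : ∃ g, χ g ≠ 1) (h2 : ∀ g, g ^ 2 = 1 → χ g = 1) :
    ∃ g : G, g ^ 2 ≠ 1 ∧ g ^ 4 = 1 := by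
  by_contra hcon
  push Not at hcon
  obtain ⟨g, hg⟩ := hχ
  have hfin : Finite (powMonoidHom 2 : G →* G).range := inferInstance
  let f : (powMonoidHom 2 : G →* G).range → (powMonoidHom 2 : G →* G).range :=
    fun x => x ^ 2
  have hinj : Function.Injective f := by
    rintro ⟨x, a, rfl⟩ ⟨y, b, rfl⟩ hxy
    have h1 : (a ^ 2) ^ 2 = (b ^ 2) ^ 2 := by simpa [f, Subtype.ext_iff] using hxy
    have h3 : (a * b⁻¹) ^ 4 = 1 := by
      rw [mul_pow, inv_pow, mul_inv_eq_one, show 4 = 2 * 2 from rfl, pow_mul, pow_mul, h1]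
    have h4 : (a * b⁻¹) ^ 2 = 1 := by
      by_contra h
      exact hcon _ h h3
    rw [mul_pow, inv_pow, mul_inv_eq_one] at h4
    exact Subtype.ext h4
  obtain ⟨⟨x, k, rfl⟩, hk⟩ := Finite.injective_iff_surjective.mp hinj ⟨g ^ 2, g, rfl⟩
  have hk' : (k ^ 2) ^ 2 = g ^ 2 := by simpa [f, Subtype.ext_iff] using hk
  have h5 : (g * (k ^ 2)⁻¹) ^ 2 = 1 := by
    rw [mul_pow, inv_pow, mul_inv_eq_one, hk']
  have h6 := h2 _ h5
  rw [map_mul, map_inv, map_pow, Int.units_sq, inv_one, mul_one] at h6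
  exact hg h6

lemma group_final {G : Type*} [CommGroup G] [Finite G] (χ : G →* ℤˣ)
    (hχ : ∃ g, χ g ≠ 1) (h2 : ∀ g, g ^ 2 = 1 → χ g = 1) :
    2 ≤ fourRankPow G ∧ ∃ g : G, orderOf g = 4 := by
  obtain ⟨g, hg2, hg4⟩ := sq_inj_contra χ hχ h2
  refine ⟨?_, g, ?_⟩
  · by_contra hlt
    unfold fourRankPow at hlt
    have hpos : 0 < Nat.card ((powMonoidHom 2 : G →* G).range ⧸
      ((powMonoidHom 4 : G →* G).range.subgroupOf (powMonoidHom 2 : G →* G).range)) :=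
      Nat.card_pos
    have h1 : ((powMonoidHom 4 : G →* G).range.subgroupOf
        (powMonoidHom 2 : G →* G).range).index = 1 := by
      unfold Subgroup.index; omega
    rw [Subgroup.index_eq_one, Subgroup.subgroupOf_eq_top] at h1
    let f : (powMonoidHom 2 : G →* G).range → (powMonoidHom 2 : G →* G).range :=
      fun x => x ^ 2
    have hsurj : Function.Surjective f := by
      rintro ⟨x, hx⟩
      obtain ⟨y, hy⟩ := h1 hx
      refine ⟨⟨y ^ 2, y, rfl⟩, Subtype.ext ?_⟩
      have : y ^ 4 = x := hy
      change (y ^ 2) ^ 2 = x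
      rw [← pow_mul, this]
    have hinj := Finite.injective_iff_surjective.mpr hsurj
    have h3 : f ⟨g ^ 2, g, rfl⟩ = f 1 := by
      refine Subtype.ext ?_
      change (g ^ 2) ^ 2 = 1 ^ 2
      rw [← pow_mul, one_pow]; exact hg4
    have h4 := hinj h3
    exact hg2 (congrArg Subtype.val h4)
  · exact orderOf_eq_prime_pow (p := 2) (n := 1) (by simpa using hg2) (by simpa using hg4)

/-! ### The character of the positive rationals -/

/-- Jacobi symbol of 2 over the odd part. -/
def oddJac (n : ℕ) : ℤ := jacobiSym 2 (ordCompl[2] n)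

lemma oddJac_mul {a b : ℕ} (ha : a ≠ 0) (hb : b ≠ 0) : oddJac (a * b) = oddJac a * oddJac b := by
  unfold oddJac
  rw [Nat.ordCompl_mul, jacobiSym.mul_right']
  · exact (Nat.ordCompl_pos 2 ha).ne'
  · exact (Nat.ordCompl_pos 2 hb).ne'

lemma odd_ordCompl {a : ℕ} (ha : a ≠ 0) : Odd (ordCompl[2] a) := by
  rw [← Nat.not_even_iff_odd, even_iff_two_dvd]
  exact Nat.not_dvd_ordCompl Nat.prime_two ha

lemma oddJac_sq {a : ℕ} (ha : a ≠ 0) : oddJac a * oddJac a = 1 := by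
  rw [← sq]
  unfold oddJac
  apply jacobiSym.sq_one
  have := odd_ordCompl ha
  change Nat.gcd 2 _ = 1
  exact (Nat.coprime_two_left).mpr this

lemma oddJac_one : oddJac 1 = 1 := by simp [oddJac]

lemma oddJac_two : oddJac 2 = 1 := by
  have : ordCompl[2] 2 = 1 := by
    rw [Nat.Prime.factorization_self Nat.prime_two]; norm_num
  simp [oddJac, this]

lemma oddJac_odd {a : ℕ} (ha : Odd a) : oddJac a = jacobiSym 2 a := by
  unfold oddJac
  rw [(Nat.ordCompl_eq_self_iff_zero_or_not_dvd a Nat.prime_two).mpr (Or.inr ?_)]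
  rw [← even_iff_two_dvd, Nat.not_even_iff_odd]; exact ha

/-- If all odd primes dividing squarefree `m` ... -/
lemma oddJac_of_primes (m : ℕ) (hm : m ≠ 0)
    (h : ∀ p : ℕ, p.Prime → p ∣ m → p ≠ 2 → jacobiSym 2 p = 1) : oddJac m = 1 := by
  induction m using Nat.recOnMul with
  | zero => exact absurd rfl hm
  | one => exact oddJac_one
  | prime p hp =>
    by_cases h2 : p = 2
    · subst h2; exact oddJac_two
    · rw [oddJac_odd (hp.odd_of_ne_two h2)]; exact h p hp dvd_rfl h2
  | mul a b iha ihb =>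
    have ha : a ≠ 0 := left_ne_zero_of_mul hm
    have hb : b ≠ 0 := right_ne_zero_of_mul hm
    rw [oddJac_mul ha hb, iha ha, ihb hb, one_mul]
    · intro p hp hpb; exact h p hp (hpb.mul_left _)
    · intro p hp hpb; exact h p hp (hpb.mul_right _)

/-- Extension to nonzero rationals. -/
def ratJac (q : ℚ) : ℤ := oddJac q.num.natAbs * oddJac q.den

lemma ratJac_eq {q : ℚ} {a b : ℕ} (ha : a ≠ 0) (hb : b ≠ 0) (h : |q| = a / b) :
    ratJac q = oddJac a * oddJac b := by
  have hb' : (b : ℚ) ≠ 0 := by exact_mod_cast hb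
  have ha' : (a : ℚ) ≠ 0 := by exact_mod_cast ha
  have hq : q ≠ 0 := by
    rintro rfl
    rw [abs_zero, eq_comm, div_eq_zero_iff] at h
    tauto
  have hn : q.num.natAbs ≠ 0 := by simpa using hq
  have key : q.num.natAbs * b = a * q.den := by
    have h1 : |q| = (q.num.natAbs : ℚ) / q.den := by
      conv_lhs => rw [← Rat.num_div_den q]
      rw [abs_div, Nat.abs_cast, Nat.cast_natAbs, Int.cast_abs]
    rw [h1, div_eq_div_iff (by exact_mod_cast q.den_ne_zero) hb'] at h
    exact_mod_cast h
  have h2 := congrArg oddJac key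
  rw [oddJac_mul hn hb, oddJac_mul ha q.den_ne_zero] at h2
  unfold ratJac
  have s1 := oddJac_sq hb
  have s2 := oddJac_sq q.den_ne_zero
  calc oddJac q.num.natAbs * oddJac q.den
      = oddJac q.num.natAbs * oddJac q.den * (oddJac b * oddJac b) := by rw [s1, mul_one]
    _ = (oddJac q.num.natAbs * oddJac b) * (oddJac b * oddJac q.den) := by ring
    _ = oddJac a * oddJac b * (oddJac q.den * oddJac q.den) := by rw [h2]; ring
    _ = _ := by rw [s2, mul_one]

lemma rat_abs_eq (q : ℚ) : |q| = (q.num.natAbs : ℚ) / q.den := by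
  conv_lhs => rw [← Rat.num_div_den q]
  rw [abs_div, Nat.abs_cast, Nat.cast_natAbs, Int.cast_abs]

lemma ratJac_mul {x y : ℚ} (hx : x ≠ 0) (hy : y ≠ 0) : ratJac (x * y) = ratJac x * ratJac y := by
  have hxn : x.num.natAbs ≠ 0 := by simpa using hx
  have hyn : y.num.natAbs ≠ 0 := by simpa using hy
  rw [ratJac_eq (a := x.num.natAbs * y.num.natAbs) (b := x.den * y.den)
    (mul_ne_zero hxn hyn) (mul_ne_zero x.den_ne_zero y.den_ne_zero),
    oddJac_mul hxn hyn, oddJac_mul x.den_ne_zero y.den_ne_zero]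
  · unfold ratJac; ring
  · rw [abs_mul, rat_abs_eq x, rat_abs_eq y]; push_cast; rw [div_mul_div_comm]

lemma ratJac_nat {n : ℕ} (hn : n ≠ 0) : ratJac n = oddJac n := by
  rw [ratJac_eq (a := n) (b := 1) hn one_ne_zero (by simp), oddJac_one, mul_one]

lemma ratJac_sq {x : ℚ} (hx : x ≠ 0) : ratJac x * ratJac x = 1 := by
  have hxn : x.num.natAbs ≠ 0 := by simpa using hx
  have s1 := oddJac_sq hxn
  have s2 := oddJac_sq x.den_ne_zero
  unfold ratJac
  calc _ = (oddJac x.num.natAbs * oddJac x.num.natAbs) * (oddJac x.den * oddJac x.den) := by ring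
    _ = 1 := by rw [s1, s2, one_mul]

lemma oddJac_of_mod {n : ℕ} (hn : n % 8 = 1 ∨ n % 8 = 7) : oddJac n = 1 := by
  have ho : Odd n := by rw [Nat.odd_iff]; omega
  rw [oddJac_odd ho, jacobiSym.at_two ho, ZMod.χ₈_nat_eq_if_mod_eight]
  rcases hn with h | h <;> simp [h] <;> omega

/-- Norms from `ℚ(√(2d))` that are positive, coprime integral form. -/
lemma oddJac_norm_coprime {d : ℕ} (hd : d % 8 = 1) {x y : ℤ} (hxy : ¬ (2 ∣ x ∧ 2 ∣ y))
    {n : ℕ} (hn : (n : ℤ) = x ^ 2 - 2 * d * y ^ 2) : oddJac n = 1 := by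
  have hsq : ∀ z : ℤ, ¬ 2 ∣ z → z ^ 2 % 8 = 1 := by
    intro z hz
    have : z % 8 = 1 ∨ z % 8 = 3 ∨ z % 8 = 5 ∨ z % 8 = 7 := by omega
    rcases this with h | h | h | h <;> simp [pow_two, Int.mul_emod, h]
  have hd' : (d : ℤ) = 8 * (d / 8 : ℕ) + 1 := by omega
  generalize ((d / 8 : ℕ) : ℤ) = e at hd'
  rw [hd'] at hn
  by_cases hx : 2 ∣ x
  · obtain ⟨u, rfl⟩ := hx
    have hy : ¬ 2 ∣ y := fun h => hxy ⟨⟨u, rfl⟩, h⟩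
    have hy2 := hsq y hy
    have hu2 : u ^ 2 % 8 = 1 ∨ u ^ 2 % 4 = 0 := by
      by_cases hu : 2 ∣ u
      · right; obtain ⟨v, rfl⟩ := hu; ring_nf; omega
      · left; exact hsq u hu
    have hn2 : (n : ℤ) = 2 * (2 * u ^ 2 - y ^ 2 - 8 * (e * y ^ 2)) := by rw [hn]; ring
    generalize e * y ^ 2 = f at hn2
    obtain ⟨m, rfl⟩ : ∃ m : ℕ, n = 2 * m := ⟨n / 2, by omega⟩
    have hm : m % 8 = 1 ∨ m % 8 = 7 := by omega
    rw [oddJac_mul two_ne_zero (by omega), oddJac_two, one_mul, oddJac_of_mod hm]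
  · have hx2 := hsq x hx
    have hu2 : y ^ 2 % 8 = 1 ∨ y ^ 2 % 4 = 0 := by
      by_cases hu : 2 ∣ y
      · right; obtain ⟨v, rfl⟩ := hu; ring_nf; omega
      · left; exact hsq y hu
    have hn2 : (n : ℤ) = x ^ 2 - 2 * y ^ 2 - 8 * (2 * (e * y ^ 2)) := by rw [hn]; ring
    apply oddJac_of_mod
    omega

lemma ratJac_norm {d : ℕ} (hd : d % 8 = 1) {a b : ℚ} (h : 0 < a ^ 2 - 2 * d * b ^ 2) :
    ratJac (a ^ 2 - 2 * d * b ^ 2) = 1 := by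
  -- clear denominators and common factors
  have key : ∃ (s : ℚ) (x y : ℤ), s ≠ 0 ∧ ¬ (2 ∣ x ∧ 2 ∣ y) ∧ a = s * x ∧ b = s * y := by
    have hden : (a.den : ℚ) ≠ 0 := by exact_mod_cast a.den_ne_zero
    have hden' : (b.den : ℚ) ≠ 0 := by exact_mod_cast b.den_ne_zero
    let X : ℤ := a.num * b.den
    let Y : ℤ := b.num * a.den
    have hX : (X : ℚ) = a * a.den * b.den := by
      simp only [X]; push_cast; rw [Rat.mul_den_eq_num]
    have hY : (Y : ℚ) = b * b.den * a.den := by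
      simp only [Y]; push_cast; rw [Rat.mul_den_eq_num]
    have hne : X ≠ 0 ∨ Y ≠ 0 := by
      by_contra hc
      push Not at hc
      rw [hc.1] at hX; rw [hc.2] at hY
      have ha : a = 0 := by simpa [hden, hden'] using hX.symm
      have hb : b = 0 := by simpa [hden, hden'] using hY.symm
      rw [ha, hb] at h; norm_num at h
    have hg : 0 < Int.gcd X Y := Int.gcd_pos_iff.mpr hne
    obtain ⟨x, y, hc, hx, hy⟩ := Int.exists_gcd_one hg
    have hgq : ((Int.gcd X Y : ℕ) : ℚ) ≠ 0 := by exact_mod_cast hg.ne'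
    refine ⟨(Int.gcd X Y : ℕ) / (a.den * b.den), x, y, by positivity, ?_, ?_, ?_⟩
    · rintro ⟨h1, h2⟩
      have := Int.dvd_gcd h1 h2
      rw [hc] at this; norm_num at this
    · have : (X : ℚ) = x * (Int.gcd X Y : ℕ) := by exact_mod_cast hx
      rw [hX] at this; field_simp; linarith
    · have : (Y : ℚ) = y * (Int.gcd X Y : ℕ) := by exact_mod_cast hy
      rw [hY] at this; field_simp; linarith
  obtain ⟨s, x, y, hs, hxy, rfl, rfl⟩ := key
  have e : (s * x) ^ 2 - 2 * d * (s * y) ^ 2 = s * s * ((x : ℚ) ^ 2 - 2 * d * y ^ 2) := by ring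
  rw [e] at h ⊢
  have hpos : 0 < ((x : ℚ) ^ 2 - 2 * d * y ^ 2) := by
    by_contra hc
    push Not at hc
    nlinarith [mul_self_nonneg s]
  have hposZ : 0 < x ^ 2 - 2 * d * y ^ 2 := by exact_mod_cast hpos
  obtain ⟨n, hn⟩ := Int.eq_ofNat_of_zero_le hposZ.le
  have hn0 : n ≠ 0 := by rintro rfl; simp at hn; omega
  have hq : ((x : ℚ) ^ 2 - 2 * d * y ^ 2) = n := by exact_mod_cast hn
  rw [ratJac_mul (mul_ne_zero hs hs) hpos.ne', ratJac_mul hs hs, ratJac_sq hs, one_mul, hq,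
    ratJac_nat hn0]
  exact oddJac_norm_coprime hd hxy hn.symm

/-! ### Auxiliary prime -/

lemma d_mod_eight {d : ℕ} (hodd : Odd d) (hmod : d % 4 = 1)
    (hleg : ∀ p : ℕ, p.Prime → p ∣ d → jacobiSym 2 p = 1) : d % 8 = 1 := by
  have h0 : d ≠ 0 := by rintro rfl; simp at hmod
  have h1 := oddJac_of_primes d h0 (fun p hp hpd _ => hleg p hp hpd)
  rw [oddJac_odd hodd, jacobiSym.at_two hodd, ZMod.χ₈_nat_eq_if_mod_eight] at h1
  by_contra hc
  have h5 : d % 8 = 5 := by omega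
  have h2 : d % 2 = 1 := by omega
  simp [h5, h2] at h1

lemma exists_jac_neg {d : ℕ} (hd : 1 < d) (hodd : Odd d) (hsf : Squarefree d) :
    ∃ a : ℕ, a.Coprime d ∧ jacobiSym a d = -1 := by
  obtain ⟨p, hp, e, rfl⟩ := Nat.exists_prime_and_dvd hd.ne'
  have hpo : p ≠ 2 := by
    rintro rfl
    rw [Nat.odd_mul] at hodd
    exact absurd hodd.1 (by decide)
  have hcop : p.Coprime e := Nat.coprime_of_squarefree_mul hsf
  have he0 : e ≠ 0 := by rintro rfl; simp at hd
  have : Fact p.Prime := ⟨hp⟩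
  obtain ⟨b, hb⟩ := FiniteField.exists_nonsquare (F := ZMod p) (by simpa [ZMod.ringChar_zmod_n] using hpo)
  obtain ⟨a, ha1, ha2⟩ := Nat.chineseRemainder hcop b.val 1
  have hap : (a : ZMod p) = b := by
    rw [(ZMod.natCast_eq_natCast_iff _ _ _).mpr ha1, ZMod.natCast_zmod_val]
  have hJp : jacobiSym a p = -1 := by
    refine (ZMod.nonsquare_iff_jacobiSym_eq_neg_one (p := p)).mpr ?_
    push_cast
    rwa [hap]
  have hJe : jacobiSym a e = 1 := by
    rw [jacobiSym.mod_left' (a₂ := 1), jacobiSym.one_left]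
    exact_mod_cast ha2
  have hJ : jacobiSym a (p * e) = -1 := by
    rw [jacobiSym.mul_right' _ hp.ne_zero he0, hJp, hJe, mul_one]
  refine ⟨a, ?_, hJ⟩
  by_contra hc
  have : NeZero (p * e) := ⟨mul_ne_zero hp.ne_zero he0⟩
  have := (jacobiSym.eq_zero_iff_not_coprime (a := (a : ℤ)) (b := p * e)).mpr hc
  rw [hJ] at this
  norm_num at this

lemma exists_aux_prime {d : ℕ} (hd : 1 < d) (hodd : Odd d) (hsf : Squarefree d)
    (hmod : d % 4 = 1) :
    ∃ (q : ℕ) (x : ℤ), q.Prime ∧ oddJac q = -1 ∧ q ≠ 2 ∧ (q : ℤ) ∣ x ^ 2 - (2 * d : ℕ) ∧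
      ¬ (q : ℤ) ∣ 2 * x := by
  obtain ⟨a, hac, haJ⟩ := exists_jac_neg hd hodd hsf
  have hc8 : Nat.Coprime 8 d := by
    rw [show 8 = 2 ^ 3 from rfl]
    exact Nat.Coprime.pow_left _ (Nat.coprime_two_left.mpr hodd)
  obtain ⟨c, hc1, hc2⟩ := Nat.chineseRemainder hc8 5 a
  have hcc : c.Coprime (8 * d) := by
    apply Nat.Coprime.mul_right
    · have := hc1.gcd_eq
      change Nat.gcd c 8 = 1
      rw [this]; decide
    · have := hc2.gcd_eq
      change Nat.gcd c d = 1
      rw [this]; exact hac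
  obtain ⟨q, hqgt, hq, hqc⟩ := Nat.forall_exists_prime_gt_and_modEq (8 * d)
    (show 8 * d ≠ 0 by omega) hcc
  have : Fact q.Prime := ⟨hq⟩
  have hq8 : q % 8 = 5 := (Nat.ModEq.of_mul_right _ hqc).trans hc1
  have hqd : q ≡ a [MOD d] := (Nat.ModEq.of_mul_left _ hqc).trans hc2
  have hqo : Odd q := by rw [Nat.odd_iff]; omega
  have hJ2 : jacobiSym 2 q = -1 := by
    rw [jacobiSym.at_two hqo, ZMod.χ₈_nat_eq_if_mod_eight]
    have h2 : q % 2 = 1 := by omega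
    simp [hq8, h2]
  have hJd : jacobiSym d q = -1 := by
    rw [jacobiSym.quadratic_reciprocity_one_mod_four hmod hqo,
      jacobiSym.mod_left' (a₂ := (a : ℤ)), haJ]
    exact_mod_cast hqd
  have hJ : jacobiSym ((2 * d : ℕ) : ℤ) q = 1 := by
    push_cast
    rw [jacobiSym.mul_left, hJ2, hJd]; norm_num
  obtain ⟨y, hy⟩ := ZMod.isSquare_of_jacobiSym_eq_one hJ
  have hdv : (q : ℤ) ∣ (y.val : ℤ) ^ 2 - (2 * d : ℕ) := by
    rw [← ZMod.intCast_zmod_eq_zero_iff_dvd, Int.cast_sub, hy]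
    simp [sq]
  refine ⟨q, (y.val : ℤ), hq, ?_, by omega, hdv, ?_⟩
  · rw [oddJac_odd hqo, hJ2]
  · intro hdx
    have hqp : Prime (q : ℤ) := Nat.prime_iff_prime_int.mp hq
    have hq2 : ¬ (q : ℤ) ∣ 2 := by
      intro h
      have := Int.le_of_dvd (by norm_num) h
      omega
    have hx := (hqp.dvd_or_dvd hdx).resolve_left hq2
    have h3 : (q : ℤ) ∣ ((2 * d : ℕ) : ℤ) := by
      have := (dvd_sub_right (hx.pow two_ne_zero)).mp hdv
      exact this
    have h4 : q ∣ 2 * d := by exact_mod_cast h3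
    have := Nat.le_of_dvd (by omega) h4
    omega

/-! ### Narrow principal ideals -/

section general
variable (K : Type*) [Field K]

/-- Totally positive units of the field. -/
def totPos : Subgroup Kˣ where
  carrier := {u | ∀ φ : K →+* ℝ, 0 < φ u}
  one_mem' := by intro φ; simp
  mul_mem' := by
    intro a b ha hb φ
    rw [Units.val_mul, map_mul]
    exact mul_pos (ha φ) (hb φ)
  inv_mem' := by
    intro a ha φ
    rw [Units.val_inv_eq_inv_val, map_inv₀]
    exact inv_pos.mpr (ha φ)

lemma narrowPrincipals_eq [NumberField K] (φ₀ : K →+* ℝ) :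
    narrowPrincipals K = (totPos K).map (toPrincipalIdeal (𝓞 K) K) := by
  rw [narrowPrincipals, ← Subgroup.closure_eq ((totPos K).map (toPrincipalIdeal (𝓞 K) K))]
  congr 1
  ext I
  constructor
  · rintro ⟨x, hx, hI⟩
    have hx0 : x ≠ 0 := by
      rintro rfl
      have := hx φ₀
      simp at this
    refine ⟨Units.mk0 x hx0, hx, ?_⟩
    rw [toPrincipalIdeal_eq_iff]
    apply FractionalIdeal.coeToSubmodule_injective
    simp only [Units.val_mk0, FractionalIdeal.coe_spanSingleton]
    exact hI.symm
  · rintro ⟨u, hu, rfl⟩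
    refine ⟨u, hu, ?_⟩
    rw [coe_toPrincipalIdeal, FractionalIdeal.coe_spanSingleton]

lemma totPos_finiteIndex [NumberField K] : (totPos K).FiniteIndex := by
  have hfin : Finite (K →+* ℝ) := by
    apply Finite.of_injective (fun φ : K →+* ℝ => (Complex.ofRealHom.comp φ : K →+* ℂ))
    intro φ ψ h
    ext x
    have := congrArg (fun f : K →+* ℂ => f x) h
    simpa using this
  let f : Kˣ →* ((K →+* ℝ) → SignTypeˣ) :=
    MonoidHom.pi (fun φ => Units.map ((signHom : ℝ →*₀ SignType).toMonoidHom.comp φ.toMonoidHom))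
  have hk : f.ker = totPos K := by
    ext u
    rw [MonoidHom.mem_ker, funext_iff]
    apply forall_congr'
    intro φ
    rw [Units.ext_iff]
    change SignType.sign (φ u) = 1 ↔ _
    exact sign_eq_one_iff
  rw [← hk]
  infer_instance

lemma narrow_finite [NumberField K] (φ₀ : K →+* ℝ) : Finite (NarrowClassGroup K) := by
  have : (narrowPrincipals K).FiniteIndex := by
    constructor
    rw [narrowPrincipals_eq K φ₀]
    have hle : (totPos K).map (toPrincipalIdeal (𝓞 K) K) ≤ (toPrincipalIdeal (𝓞 K) K).range :=
      Subgroup.map_le_range _ _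
    rw [← Subgroup.relIndex_mul_index hle]
    apply mul_ne_zero
    · rw [MonoidHom.range_eq_map, Subgroup.relIndex_map_map, top_sup_eq, Subgroup.relIndex_top_right]
      have := totPos_finiteIndex K
      exact (Subgroup.finiteIndex_of_le (le_sup_left : totPos K ≤ totPos K ⊔ _)).index_ne_zero
    · have : Finite ((FractionalIdeal (𝓞 K)⁰ K)ˣ ⧸ (toPrincipalIdeal (𝓞 K) K).range) :=
        Finite.of_equiv _ (ClassGroup.equiv (R := 𝓞 K) K).toEquiv
      exact Subgroup.index_ne_zero_of_finite
  infer_instance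

end general

/-! ### Quadratic data -/

/-- Concrete description of a real quadratic field. -/
structure QData (K : Type*) [Field K] [NumberField K] (D : ℕ) where
  θ : K
  co : ∀ x : K, ∃ a b : ℚ, x = a + b * θ
  sq : θ * θ = D
  φ₁ : K →+* ℝ
  φ₂ : K →+* ℝ
  hφ₁ : φ₁ θ = √(D : ℝ)
  hφ₂ : φ₂ θ = -√(D : ℝ)
  norm : ∀ a b : ℚ, Algebra.norm ℚ (a + b * θ : K) = a ^ 2 - D * b ^ 2

namespace QData
variable {K : Type*} [Field K] [NumberField K] {D : ℕ} (Q : QData K D)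

lemma uniq (hD : 0 < D) {a b a' b' : ℚ} (h : (a + b * Q.θ : K) = a' + b' * Q.θ) :
    a = a' ∧ b = b' := by
  have h1 := congrArg Q.φ₁ h
  have h2 := congrArg Q.φ₂ h
  simp only [map_add, map_mul, map_ratCast, Q.hφ₁, Q.hφ₂] at h1 h2
  have hs : 0 < √(D : ℝ) := Real.sqrt_pos.mpr (by exact_mod_cast hD)
  have ha : (a : ℝ) = a' := by linarith
  have hb : (b : ℝ) = b' := by
    have : (b : ℝ) * √D = b' * √D := by linarith
    exact mul_right_cancel₀ hs.ne' this
  exact ⟨by exact_mod_cast ha, by exact_mod_cast hb⟩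

lemma uniqZ (hD : 0 < D) {a b a' b' : ℤ} (h : (a + b * Q.θ : K) = a' + b' * Q.θ) :
    a = a' ∧ b = b' := by
  have := Q.uniq hD (a := a) (b := b) (a' := a') (b' := b') (by push_cast; exact h)
  exact ⟨by exact_mod_cast this.1, by exact_mod_cast this.2⟩

lemma norm_pos {a b : ℚ} (h : ∀ φ : K →+* ℝ, 0 < φ (a + b * Q.θ : K)) :
    0 < a ∧ 0 < a ^ 2 - D * b ^ 2 := by
  have h1 := h Q.φ₁
  have h2 := h Q.φ₂
  simp only [map_add, map_mul, map_ratCast, Q.hφ₁, Q.hφ₂] at h1 h2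
  constructor
  · have : (0 : ℝ) < a := by linarith
    exact_mod_cast this
  · have h3 := mul_pos h1 h2
    have hs : √(D : ℝ) * √D = D := Real.mul_self_sqrt (Nat.cast_nonneg D)
    have : (0 : ℝ) < a ^ 2 - D * b ^ 2 := by
      calc (0 : ℝ) < _ := h3
        _ = a ^ 2 - (√D * √D) * b ^ 2 := by ring
        _ = _ := by rw [hs]
    exact_mod_cast this

lemma norm_int {x : K} (hx : IsIntegral ℤ x) : ∃ n : ℤ, (n : ℚ) = Algebra.norm ℚ x := by
  have := Algebra.isIntegral_norm ℚ hx
  obtain ⟨n, hn⟩ := IsIntegrallyClosed.isIntegral_iff.mp this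
  exact ⟨n, by simpa using hn⟩

lemma int_co (hsf : Squarefree D) (hD4 : D % 4 = 2) {x : K} (hx : IsIntegral ℤ x) :
    ∃ a b : ℤ, x = a + b * Q.θ := by
  obtain ⟨a, b, rfl⟩ := Q.co x
  obtain ⟨n, hn⟩ := norm_int hx
  obtain ⟨m, hm⟩ := norm_int (isIntegral_one.add hx)
  rw [Q.norm] at hn
  have e : (1 + (a + b * Q.θ) : K) = ((1 + a : ℚ) : K) + b * Q.θ := by push_cast; ring
  rw [e, Q.norm] at hm
  have h2a : 2 * a = ((m - n - 1 : ℤ) : ℚ) := by push_cast; linarith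
  obtain ⟨A, hA⟩ : ∃ A : ℤ, 2 * a = A := ⟨_, h2a⟩
  -- `D * (2b)^2` is an integer
  have hDb : (D : ℚ) * (2 * b) ^ 2 = ((A ^ 2 - 4 * n : ℤ) : ℚ) := by
    push_cast; rw [← hA, hn]; ring
  obtain ⟨B, hB⟩ : ∃ B : ℤ, 2 * b = B := by
    set c := 2 * b with hc
    set N : ℤ := A ^ 2 - 4 * n
    have hcd : (c.den : ℚ) ≠ 0 := by exact_mod_cast c.den_ne_zero
    have h3 : (D : ℤ) * c.num ^ 2 = N * (c.den : ℤ) ^ 2 := by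
      have : (D : ℚ) * (c * c.den) ^ 2 = N * (c.den : ℚ) ^ 2 := by rw [← hDb]; ring
      rw [Rat.mul_den_eq_num] at this
      exact_mod_cast this
    have h4 : ((c.den : ℤ)) ^ 2 ∣ (D : ℤ) * c.num ^ 2 := ⟨N, by rw [h3]; ring⟩
    have hcop : IsCoprime ((c.den : ℤ) ^ 2) (c.num ^ 2) := by
      apply IsCoprime.pow
      rw [Int.isCoprime_iff_gcd_eq_one, Int.gcd_comm]
      exact c.reduced
    have h5 := hcop.dvd_of_dvd_mul_right h4
    have h6 : c.den * c.den ∣ D := by rw [← pow_two]; exact_mod_cast h5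
    have h7 := Nat.isUnit_iff.mp (hsf _ h6)
    refine ⟨c.num, ?_⟩
    conv_lhs => rw [← Rat.num_div_den c]
    rw [h7]; simp
  rw [hB] at hDb
  have hZ : (D : ℤ) * B ^ 2 = A ^ 2 - 4 * n := by exact_mod_cast hDb
  have hD' : (D : ℤ) = 4 * (D / 4 : ℕ) + 2 := by omega
  generalize ((D / 4 : ℕ) : ℤ) = k at hD'
  rw [hD'] at hZ
  have hA2 : 2 ∣ A := by
    by_contra hc
    obtain ⟨u, hu⟩ : ∃ u, A = 2 * u + 1 := ⟨A / 2, by omega⟩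
    rw [hu] at hZ
    ring_nf at hZ
    omega
  obtain ⟨u, rfl⟩ := hA2
  have hB2 : 2 ∣ B := by
    by_contra hc
    obtain ⟨v, rfl⟩ : ∃ v, B = 2 * v + 1 := ⟨B / 2, by omega⟩
    ring_nf at hZ
    omega
  obtain ⟨v, rfl⟩ := hB2
  refine ⟨u, v, ?_⟩
  have ha : a = u := by push_cast at hA; linarith
  have hb : b = v := by push_cast at hB; linarith
  rw [ha, hb]; simp

lemma theta_int : IsIntegral ℤ Q.θ := by
  apply IsIntegral.of_pow (n := 2) two_pos
  rw [pow_two, Q.sq]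
  simpa using isIntegral_algebraMap (R := ℤ) (A := K) (x := (D : ℤ))

end QData

namespace QData
variable {K : Type*} [Field K] [NumberField K] {D : ℕ}

open FractionalIdeal in
lemma sqfree_core (Q : QData K D) (hsf : Squarefree D) (hD4 : D % 4 = 2) {J : FractionalIdeal (𝓞 K)⁰ K} {m p : ℕ}
    (hm : Squarefree m) (hJ : J * J = spanSingleton (𝓞 K)⁰ (m : K)) (hp : p.Prime)
    (hpm : p ∣ m) (hp2 : p ≠ 2) : p ∣ D := by
  by_contra hpD
  have hD : 0 < D := by omega
  have hpZ : Prime (p : ℤ) := Nat.prime_iff_prime_int.mp hp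
  have hp2Z : ¬ (p : ℤ) ∣ 2 := by
    intro h
    have h' : p ∣ 2 := by exact_mod_cast h
    exact hp2 ((Nat.prime_dvd_prime_iff_eq hp Nat.prime_two).mp h')
  have hpDZ : ¬ (p : ℤ) ∣ (D : ℤ) := by exact_mod_cast hpD
  obtain ⟨m', rfl⟩ := hpm
  have hle : J ≤ spanSingleton (𝓞 K)⁰ (p : K) := by
    intro x hx
    have hxx : x * x ∈ J * J := mul_mem_mul hx hx
    rw [hJ, mem_spanSingleton] at hxx
    obtain ⟨y, hy⟩ := hxx
    rw [Algebra.smul_def] at hy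
    have hyint : IsIntegral ℤ (algebraMap (𝓞 K) K y) := RingOfIntegers.isIntegral_coe y
    have hmint : IsIntegral ℤ (((p * m' : ℕ)) : K) := by
      simpa using isIntegral_algebraMap (R := ℤ) (A := K) (x := ((p * m' : ℕ) : ℤ))
    have hxint : IsIntegral ℤ x := by
      apply IsIntegral.of_pow (n := 2) two_pos
      rw [pow_two, ← hy]
      exact hyint.mul hmint
    obtain ⟨a, b, hab⟩ := Q.int_co hsf hD4 hxint
    obtain ⟨c, e, hce⟩ := Q.int_co hsf hD4 hyint
    have hcoord : (((a ^ 2 + D * b ^ 2 : ℤ)) + ((2 * a * b : ℤ)) * Q.θ : K)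
        = ((p * m' * c : ℤ)) + ((p * m' * e : ℤ)) * Q.θ := by
      have : x * x = (a ^ 2 + (Q.θ * Q.θ) * b ^ 2) + 2 * a * b * Q.θ := by rw [hab]; ring
      rw [Q.sq] at this
      push_cast
      rw [← this, ← hy, hce]
      push_cast
      ring
    obtain ⟨h1, h2⟩ := Q.uniqZ hD hcoord
    have hd1 : (p : ℤ) ∣ a ^ 2 + D * b ^ 2 := ⟨m' * c, by rw [h1]; ring⟩
    have hd2 : (p : ℤ) ∣ 2 * a * b := ⟨m' * e, by rw [h2]; ring⟩
    have hab' : (p : ℤ) ∣ a ∧ (p : ℤ) ∣ b := by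
      rcases hpZ.dvd_or_dvd hd2 with h | h
      · have ha := (hpZ.dvd_or_dvd h).resolve_left hp2Z
        refine ⟨ha, ?_⟩
        have := (dvd_add_right (ha.pow two_ne_zero)).mp hd1
        exact hpZ.dvd_of_dvd_pow ((hpZ.dvd_or_dvd this).resolve_left hpDZ)
      · refine ⟨?_, h⟩
        have := (dvd_add_left ((h.pow two_ne_zero).mul_left (D : ℤ))).mp hd1
        exact hpZ.dvd_of_dvd_pow this
    obtain ⟨⟨a', rfl⟩, ⟨b', rfl⟩⟩ := hab'
    rw [mem_spanSingleton]
    refine ⟨(a' : 𝓞 K) + (b' : 𝓞 K) * ⟨Q.θ, Q.theta_int⟩, ?_⟩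
    rw [Algebra.smul_def, hab]
    simp only [map_add, map_intCast]
    push_cast
    change ((a' : K) + b' * Q.θ) * p = _
    ring
  have hle2 : J * J ≤ spanSingleton (𝓞 K)⁰ ((p : K) * p) := by
    rw [← spanSingleton_mul_spanSingleton]
    exact mul_le_mul' hle hle
  rw [hJ] at hle2
  have hmem := hle2 (mem_spanSingleton_self _ _)
  rw [mem_spanSingleton] at hmem
  obtain ⟨z, hz⟩ := hmem
  rw [Algebra.smul_def] at hz
  obtain ⟨c, e, hce⟩ := Q.int_co hsf hD4 (RingOfIntegers.isIntegral_coe z)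
  have hcoord : (((p * p * c : ℤ)) + ((p * p * e : ℤ)) * Q.θ : K)
      = ((p * m' : ℤ)) + ((0 : ℤ)) * Q.θ := by
    push_cast at hz ⊢
    rw [zero_mul, add_zero, ← hz, hce]; ring
  obtain ⟨h1, -⟩ := Q.uniqZ hD hcoord
  have h2 : p * p ∣ p * m' := by
    have : ((p * p : ℕ) : ℤ) ∣ ((p * m' : ℕ) : ℤ) := ⟨c, by push_cast; rw [h1]⟩
    exact_mod_cast this
  exact hp.one_lt.ne' (Nat.isUnit_iff.mp (hm p h2))

/-- The character on ideals. -/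
noncomputable def chiZ (K : Type*) [Field K] [NumberField K] :
    (FractionalIdeal (𝓞 K)⁰ K)ˣ →* ℤ where
  toFun I := ratJac (FractionalIdeal.absNorm (I : FractionalIdeal (𝓞 K)⁰ K))
  map_one' := by
    rw [Units.val_one, map_one]
    simpa [oddJac_one] using ratJac_nat (n := 1) one_ne_zero
  map_mul' I J := by
    rw [Units.val_mul, map_mul, ratJac_mul]
    · rw [Ne, FractionalIdeal.absNorm_eq_zero_iff]; exact I.ne_zero
    · rw [Ne, FractionalIdeal.absNorm_eq_zero_iff]; exact J.ne_zero

lemma ratJac_principal (Q : QData K D) {d : ℕ} (hD : D = 2 * d) (hd : d % 8 = 1) {x : K}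
    (hx : ∀ φ : K →+* ℝ, 0 < φ x) :
    ratJac (FractionalIdeal.absNorm (FractionalIdeal.spanSingleton (𝓞 K)⁰ x)) = 1 := by
  rw [FractionalIdeal.absNorm_span_singleton]
  obtain ⟨a, b, rfl⟩ := Q.co x
  obtain ⟨ha, hn⟩ := Q.norm_pos hx
  rw [Q.norm, abs_of_pos hn, hD]
  rw [hD] at hn
  push_cast at hn ⊢
  exact ratJac_norm hd hn

/-- A totally positive element of square norm is a squarefree natural number times a square. -/
lemma exists_gamma (Q : QData K D) {α : K} (hα : ∀ φ : K →+* ℝ, 0 < φ α) {n : ℚ} (hn : 0 < n)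
    (hN : n * n = |Algebra.norm ℚ α|) :
    ∃ (m : ℕ) (γ : K), Squarefree m ∧ (∀ φ : K →+* ℝ, 0 < φ γ) ∧ α = m * (γ * γ) := by
  obtain ⟨a, b, rfl⟩ := Q.co α
  obtain ⟨ha, hpos⟩ := Q.norm_pos hα
  rw [Q.norm, abs_of_pos hpos] at hN
  set α : K := a + b * Q.θ with hαdef
  set r : ℚ := 2 * n + 2 * a with hr
  have hrpos : 0 < r := by positivity
  have hnum : 0 < r.num := Rat.num_pos.mpr hrpos
  obtain ⟨m, s, hm0, hs0, hms, hmsf⟩ := Nat.sq_mul_squarefree_of_pos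
    (n := r.num.natAbs * r.den) (Nat.mul_pos (by omega) r.den_pos)
  have hrA : r = (r.num.natAbs : ℚ) / r.den := by rw [← rat_abs_eq, abs_of_pos hrpos]
  set A := r.num.natAbs
  set B := r.den
  have hA0 : (A : ℚ) ≠ 0 := by
    have : A ≠ 0 := by omega
    exact_mod_cast this
  have hB0 : (B : ℚ) ≠ 0 := by exact_mod_cast r.den_ne_zero
  -- `β = n + α`, `β² = r α`
  have hβ : ((n : K) + α) * (n + α) = r * α := by
    have hNK : (n : K) * n = (a : K) ^ 2 - D * b ^ 2 := by exact_mod_cast congrArg (Rat.cast : ℚ → K) hN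
    have hs := Q.sq
    rw [hr, hαdef]
    push_cast
    linear_combination hNK + (b : K) ^ 2 * hs
  have hmsQ : (s : ℚ) ^ 2 * m = A * B := by exact_mod_cast hms
  have hsQ : (s : ℚ) ≠ 0 := by exact_mod_cast hs0.ne'
  refine ⟨m, ((s / A : ℚ) : K) * (n + α), hmsf, ?_, ?_⟩
  · intro φ
    rw [map_mul, map_add, map_ratCast, map_ratCast]
    have h1 := hα φ
    have h2 : (0 : ℝ) < n := by exact_mod_cast hn
    have h3 : (0 : ℚ) < s / A := by
      apply div_pos
      · exact_mod_cast hs0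
      · exact lt_of_le_of_ne (Nat.cast_nonneg A) (Ne.symm hA0)
    have h4 : (0 : ℝ) < ((s / A : ℚ) : ℝ) := by exact_mod_cast h3
    positivity
  · have e1 : (m : ℚ) * ((s / A) * (s / A)) * r = 1 := by
      rw [hrA]; field_simp
      linarith
    have e2 : (m : K) * (((s / A : ℚ) : K) * ((s / A : ℚ) : K)) * (r : K) = 1 := by
      exact_mod_cast congrArg (Rat.cast : ℚ → K) e1
    calc α = ((m : K) * (((s / A : ℚ) : K) * ((s / A : ℚ) : K)) * (r : K)) * α := by
          rw [e2, one_mul]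
      _ = (m : K) * (((s / A : ℚ) : K) * ((s / A : ℚ) : K)) * ((r : K) * α) := by ring
      _ = _ := by rw [← hβ]; ring

open FractionalIdeal in
lemma torsion (Q : QData K D) {d : ℕ} (hD : D = 2 * d) (hd : d % 8 = 1) (hsf : Squarefree D)
    (hleg : ∀ p : ℕ, p.Prime → p ∣ d → jacobiSym 2 p = 1)
    {I : FractionalIdeal (𝓞 K)⁰ K} (hI0 : I ≠ 0) {α : K} (hα : ∀ φ : K →+* ℝ, 0 < φ α)
    (hI : I * I = spanSingleton (𝓞 K)⁰ α) : ratJac (absNorm I) = 1 := by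
  have hn0 : absNorm I ≠ 0 := by rwa [Ne, absNorm_eq_zero_iff]
  have hnpos : 0 < absNorm I := lt_of_le_of_ne (absNorm_nonneg I) hn0.symm
  have hN : absNorm I * absNorm I = |Algebra.norm ℚ α| := by
    rw [← map_mul, hI, absNorm_span_singleton]
  obtain ⟨m, γ, hm, hγ, rfl⟩ := Q.exists_gamma hα hnpos hN
  have hγ0 : γ ≠ 0 := by
    rintro rfl
    have := hγ Q.φ₁
    simp at this
  set J := I * spanSingleton (𝓞 K)⁰ γ⁻¹ with hJdef
  have hJJ : J * J = spanSingleton (𝓞 K)⁰ (m : K) := by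
    have : J * J = (I * I) * (spanSingleton (𝓞 K)⁰ γ⁻¹ * spanSingleton (𝓞 K)⁰ γ⁻¹) := by
      rw [hJdef]; ring
    rw [this, hI, spanSingleton_mul_spanSingleton, spanSingleton_mul_spanSingleton]
    congr 1
    field_simp
  have hIJ : I = J * spanSingleton (𝓞 K)⁰ γ := by
    rw [hJdef, mul_assoc, spanSingleton_mul_spanSingleton, inv_mul_cancel₀ hγ0, spanSingleton_one,
      mul_one]
  have hm0 : m ≠ 0 := hm.ne_zero
  have hNJ : absNorm J = m := by
    have h1 : absNorm J * absNorm J = (m : ℚ) * m := by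
      rw [← map_mul, hJJ, absNorm_span_singleton]
      have := Q.norm m 0
      simp only [Rat.cast_natCast, Rat.cast_zero, zero_mul, add_zero] at this
      rw [this]
      rw [abs_of_nonneg] <;> ring_nf <;> positivity
    exact (mul_self_inj (absNorm_nonneg J) (Nat.cast_nonneg m)).mp h1
  have hJ1 : ratJac (absNorm J) = 1 := by
    rw [hNJ, ratJac_nat hm0]
    apply oddJac_of_primes m hm0
    intro p hp hpm hp2
    have hpD := Q.sqfree_core hsf (by omega) hm hJJ hp hpm hp2
    rw [hD] at hpD
    apply hleg p hp
    rcases (Nat.Prime.dvd_mul hp).mp hpD with h | h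
    · exact absurd ((Nat.prime_dvd_prime_iff_eq hp Nat.prime_two).mp h) hp2
    · exact h
  have hJ0 : absNorm J ≠ 0 := by rw [hNJ]; exact_mod_cast hm0
  rw [hIJ, map_mul, ratJac_mul hJ0, hJ1, Q.ratJac_principal hD hd hγ, one_mul]
  rw [Ne, absNorm_eq_zero_iff, spanSingleton_eq_zero_iff]
  exact hγ0

lemma exists_ideal (Q : QData K D) (hsf : Squarefree D) (hD4 : D % 4 = 2) {q : ℕ} {X : ℤ} (hq : q.Prime)
    (h1 : (q : ℤ) ∣ X ^ 2 - D) (h2 : ¬ (q : ℤ) ∣ 2 * X) :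
    ∃ P : Ideal (𝓞 K), Ideal.absNorm P = q := by
  have hD : 0 < D := by omega
  let t : 𝓞 K := ⟨Q.θ, Q.theta_int⟩
  have htt : t * t = (D : 𝓞 K) := by
    apply RingOfIntegers.ext
    change Q.θ * Q.θ = _
    rw [Q.sq]; simp
  let P : Ideal (𝓞 K) := Ideal.span {(q : 𝓞 K), (X : 𝓞 K) + t}
  let P' : Ideal (𝓞 K) := Ideal.span {(q : 𝓞 K), (X : 𝓞 K) - t}
  have hprod : P * P' = Ideal.span {(q : 𝓞 K)} := by
    rw [Ideal.span_pair_mul_span_pair]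
    apply le_antisymm
    · rw [Ideal.span_le]
      obtain ⟨k, hk⟩ := h1
      have hk' : ((X : 𝓞 K) + t) * (X - t) = q * k := by
        have : ((X ^ 2 - D : ℤ) : 𝓞 K) = ((q * k : ℤ) : 𝓞 K) := by rw [hk]
        push_cast at this
        rw [← this, ← htt]; ring
      rintro z hz
      simp only [Set.mem_insert_iff, Set.mem_singleton_iff] at hz
      rw [SetLike.mem_coe, Ideal.mem_span_singleton]
      rcases hz with rfl | rfl | rfl | rfl
      · exact dvd_mul_right _ _
      · exact dvd_mul_right _ _
      · exact dvd_mul_left _ _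
      · exact ⟨_, hk'⟩
    · rw [Ideal.span_singleton_le_iff_mem]
      have hcop : IsCoprime (q : ℤ) (2 * X) :=
        ((Nat.prime_iff_prime_int.mp hq).coprime_iff_not_dvd).mpr h2
      obtain ⟨u, v, huv⟩ := hcop
      have huv' : (u : 𝓞 K) * q + v * (2 * X) = 1 := by exact_mod_cast congrArg (Int.cast : ℤ → 𝓞 K) huv
      have : (q : 𝓞 K) = u * (q * q) + v * (q * (X - t)) + v * ((X + t) * q) := by
        linear_combination (-(q : 𝓞 K)) * huv'
      refine (congrArg (· ∈ _) this).mpr ?_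
      refine Ideal.add_mem _ (Ideal.add_mem _ ?_ ?_) ?_ <;>
        refine Ideal.mul_mem_left _ _ (Ideal.subset_span ?_) <;> simp
  have hNq : Ideal.absNorm (Ideal.span {(q : 𝓞 K)}) = q ^ 2 := by
    have h3 := FractionalIdeal.coeIdeal_absNorm (K := K) (Ideal.span {(q : 𝓞 K)})
    rw [FractionalIdeal.coeIdeal_span_singleton, FractionalIdeal.absNorm_span_singleton] at h3
    have := Q.norm q 0
    simp only [Rat.cast_natCast, Rat.cast_zero, zero_mul, add_zero] at this
    rw [map_natCast, this] at h3
    have h4 : |(q : ℚ) ^ 2 - D * 0 ^ 2| = (q : ℚ) ^ 2 := by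
      rw [abs_of_nonneg] <;> ring_nf; positivity
    rw [h4] at h3
    exact_mod_cast h3.symm
  have hnot : ∀ ε : ℤ, ((X : 𝓞 K) + ε * t) ∉ Ideal.span {(q : 𝓞 K)} := by
    intro ε hmem
    rw [Ideal.mem_span_singleton] at hmem
    obtain ⟨z, hz⟩ := hmem
    obtain ⟨c, e, hce⟩ := Q.int_co hsf hD4 (RingOfIntegers.isIntegral_coe z)
    have hz' := congrArg (algebraMap (𝓞 K) K) hz
    simp only [map_add, map_mul, map_intCast, map_natCast] at hz'
    rw [hce] at hz'
    have ht : algebraMap (𝓞 K) K t = Q.θ := rfl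
    rw [ht] at hz'
    have hcoord : ((X : K) + (ε : ℤ) * Q.θ) = ((q * c : ℤ)) + ((q * e : ℤ)) * Q.θ := by
      rw [hz']; push_cast; ring
    obtain ⟨h5, -⟩ := Q.uniqZ hD hcoord
    exact h2 (Dvd.dvd.mul_left ⟨c, h5⟩ 2)
  have hmul : Ideal.absNorm P * Ideal.absNorm P' = q ^ 2 := by rw [← map_mul, hprod, hNq]
  have hdvd : Ideal.absNorm P ∣ q ^ 2 := ⟨_, hmul.symm⟩
  obtain ⟨i, hi, hPi⟩ := (Nat.dvd_prime_pow hq).mp hdvd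
  have hq0 := hq.pos
  interval_cases i
  · exfalso
    rw [pow_zero, Ideal.absNorm_eq_one_iff] at hPi
    rw [hPi, Ideal.top_mul] at hprod
    apply hnot (-1)
    rw [← hprod]
    apply Ideal.subset_span
    right; simp [sub_eq_add_neg]
  · exact ⟨P, by rw [hPi, pow_one]⟩
  · exfalso
    rw [hPi] at hmul
    have h6 : Ideal.absNorm P' = 1 := by
      have : q ^ 2 * Ideal.absNorm P' = q ^ 2 * 1 := by rw [hmul, mul_one]
      exact Nat.eq_of_mul_eq_mul_left (by positivity) this
    rw [Ideal.absNorm_eq_one_iff] at h6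
    rw [h6, Ideal.mul_top] at hprod
    apply hnot 1
    rw [← hprod]
    apply Ideal.subset_span
    right; simp

/-- Abstract main theorem. -/
theorem main (Q : QData K D) {d : ℕ} (hD : D = 2 * d) (hd : 1 < d) (hodd : Odd d) (hsf : Squarefree d)
    (hmod : d % 4 = 1)
    (hleg : ∀ p : ℕ, p.Prime → p ∣ d → jacobiSym 2 p = 1) :
    2 ≤ fourRankPow (NarrowClassGroup K) ∧ ∃ g : NarrowClassGroup K, orderOf g = 4 := by
  have hd8 := d_mod_eight hodd hmod hleg
  have hsfD : Squarefree D := by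
    rw [hD, Nat.squarefree_mul (Nat.coprime_two_left.mpr hodd)]
    exact ⟨Nat.prime_two.squarefree, hsf⟩
  have hD4 : D % 4 = 2 := by omega
  have hfin := narrow_finite K Q.φ₁
  have hmem : ∀ I ∈ narrowPrincipals K, ∃ x : K, (∀ φ : K →+* ℝ, 0 < φ x) ∧
      (I : FractionalIdeal (𝓞 K)⁰ K) = FractionalIdeal.spanSingleton (𝓞 K)⁰ x := by
    intro I hI
    rw [narrowPrincipals_eq K Q.φ₁] at hI
    obtain ⟨u, hu, rfl⟩ := hI
    exact ⟨u, hu, coe_toPrincipalIdeal _⟩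
  have hker : ∀ I ∈ narrowPrincipals K, (chiZ K).toHomUnits I = 1 := by
    intro I hI
    obtain ⟨x, hx, hIx⟩ := hmem I hI
    rw [Units.ext_iff]
    change ratJac (FractionalIdeal.absNorm (I : FractionalIdeal (𝓞 K)⁰ K)) = 1
    rw [hIx]
    exact Q.ratJac_principal hD hd8 hx
  let χ : NarrowClassGroup K →* ℤˣ := QuotientGroup.lift _ (chiZ K).toHomUnits hker
  apply group_final χ
  · obtain ⟨q, X, hq, hJ, hq2, h1, h2⟩ := exists_aux_prime hd hodd hsf hmod
    rw [← hD] at h1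
    obtain ⟨P, hP⟩ := Q.exists_ideal hsfD hD4 hq h1 h2
    have hN : FractionalIdeal.absNorm (P : FractionalIdeal (𝓞 K)⁰ K) = q := by
      rw [FractionalIdeal.coeIdeal_absNorm, hP]
    have hP0 : (P : FractionalIdeal (𝓞 K)⁰ K) ≠ 0 := by
      rw [Ne, ← FractionalIdeal.absNorm_eq_zero_iff, hN]
      exact_mod_cast hq.ne_zero
    refine ⟨QuotientGroup.mk (Units.mk0 _ hP0), ?_⟩
    intro hc
    rw [Units.ext_iff] at hc
    change ratJac (FractionalIdeal.absNorm (P : FractionalIdeal (𝓞 K)⁰ K)) = 1 at hc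
    rw [hN, ratJac_nat hq.ne_zero, hJ] at hc
    norm_num at hc
  · intro g
    induction g using QuotientGroup.induction_on with
    | H I =>
    intro hg
    rw [← QuotientGroup.mk_pow, QuotientGroup.eq_one_iff] at hg
    obtain ⟨x, hx, hIx⟩ := hmem _ hg
    rw [Units.ext_iff]
    change ratJac (FractionalIdeal.absNorm (I : FractionalIdeal (𝓞 K)⁰ K)) = 1
    refine Q.torsion hD hd8 hsfD hleg I.ne_zero hx ?_
    rw [← hIx, pow_two, Units.val_mul]

end QData

/-! ### The concrete field -/

lemma not_sq_rat {D : ℕ} (hsf : Squarefree D) (hD : D ≠ 1) (r : ℚ) : r ^ 2 ≠ (D : ℚ) := by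
  intro h
  have h1 : IsSquare (D : ℚ) := ⟨r, by rw [← h, sq]⟩
  rw [Rat.isSquare_natCast_iff] at h1
  obtain ⟨k, rfl⟩ := h1
  have := Nat.isUnit_iff.mp (hsf k dvd_rfl)
  exact hD (by rw [this])

lemma norm_quad {K : Type*} [Field K] [CharZero K] {D : ℕ}
    (e : QuadraticAlgebra ℚ (D : ℚ) 0 ≃+* K) (a b : ℚ) :
    Algebra.norm ℚ (e ⟨a, b⟩) = a ^ 2 - D * b ^ 2 := by
  let e' : QuadraticAlgebra ℚ (D : ℚ) 0 ≃ₐ[ℚ] K := AlgEquiv.ofRingEquiv (f := e) (fun r =>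
    RingHom.congr_fun (Subsingleton.elim
      (e.toRingHom.comp (algebraMap ℚ (QuadraticAlgebra ℚ (D : ℚ) 0))) (algebraMap ℚ K)) r)
  change Algebra.norm ℚ (e' ⟨a, b⟩) = _
  rw [Algebra.norm_eq_of_algEquiv e']
  have h2 := QuadraticAlgebra.det_toLinearMap_eq_norm (⟨a, b⟩ : QuadraticAlgebra ℚ (D : ℚ) 0)
  rw [QuadraticAlgebra.norm_def] at h2
  rw [Algebra.norm_apply]
  have h3 : (Algebra.lmul ℚ (QuadraticAlgebra ℚ (D : ℚ) 0)) ⟨a, b⟩ =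
      DistribSMul.toLinearMap ℚ (QuadraticAlgebra ℚ (D : ℚ) 0)
        (⟨a, b⟩ : QuadraticAlgebra ℚ (D : ℚ) 0) := rfl
  rw [h3, h2]
  ring

lemma exists_qdata {D : ℕ} (hsf : Squarefree D) (hD : D ≠ 1) :
    ∃ _ : NumberField (quadField D), Nonempty (QData (quadField D) D) := by
  have hss : ((√(D : ℝ) : ℝ) : ℂ) * ((√(D : ℝ) : ℝ) : ℂ) = D := by
    rw [← Complex.ofReal_mul, Real.mul_self_sqrt (Nat.cast_nonneg D)]; simp
  let θ : quadField D := ⟨((√(D : ℝ) : ℝ) : ℂ), mem_adjoin_simple_self ℚ _⟩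
  have hθ : θ * θ = (D : quadField D) := by
    apply Subtype.ext
    simpa [θ] using hss
  have hfact : Fact (∀ r : ℚ, r ^ 2 ≠ (D : ℚ) + 0 * r) := ⟨fun r => by
    rw [zero_mul, add_zero]; exact not_sq_rat hsf hD r⟩
  let f : QuadraticAlgebra ℚ (D : ℚ) 0 →ₐ[ℚ] quadField D :=
    QuadraticAlgebra.lift ⟨θ, by rw [hθ]; simp [Algebra.smul_def]⟩
  have hf : ∀ z, f z = (z.re : quadField D) + z.im * θ := by
    intro z
    change z.re • (1 : quadField D) + z.im • θ = _
    simp [Algebra.smul_def]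
  have hinj : Function.Injective f := f.toRingHom.injective
  have hsurj : Function.Surjective f := by
    rintro ⟨x, hx⟩
    have hIntegral : IsIntegral ℚ ((√(D : ℝ) : ℝ) : ℂ) := by
      apply IsIntegral.of_pow (n := 2) two_pos
      rw [pow_two, hss]
      simpa using isIntegral_algebraMap (R := ℚ) (A := ℂ) (x := (D : ℚ))
    have hx' : x ∈ (quadField D).toSubalgebra := hx
    rw [quadField, adjoin_simple_toSubalgebra_of_isAlgebraic hIntegral.isAlgebraic] at hx'
    have hle : Algebra.adjoin ℚ {((√(D : ℝ) : ℝ) : ℂ)} ≤ ((quadField D).val.comp f).range := by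
      rw [Algebra.adjoin_le_iff]
      rintro _ rfl
      refine ⟨⟨0, 1⟩, ?_⟩
      change ((f ⟨0, 1⟩ : quadField D) : ℂ) = _
      rw [hf]; simp [θ]
    obtain ⟨z, hz⟩ := hle hx'
    exact ⟨z, Subtype.ext hz⟩
  let e : QuadraticAlgebra ℚ (D : ℚ) 0 ≃ₐ[ℚ] quadField D := AlgEquiv.ofBijective f ⟨hinj, hsurj⟩
  have he : ∀ z, e z = (z.re : quadField D) + z.im * θ := hf
  have hfd : FiniteDimensional ℚ (quadField D) := Module.Finite.equiv e.toLinearEquiv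
  have hnf : NumberField (quadField D) := ⟨⟩
  refine ⟨hnf, ⟨?_⟩⟩
  have hemb : ∀ s : ℝ, s * s = D → ∃ φ : quadField D →+* ℝ, φ θ = s := by
    intro s hs
    let g : QuadraticAlgebra ℚ (D : ℚ) 0 →ₐ[ℚ] ℝ :=
      QuadraticAlgebra.lift ⟨s, by rw [hs]; simp [Algebra.smul_def]⟩
    have hg : g ⟨0, 1⟩ = s := by
      change (0 : ℚ) • (1 : ℝ) + (1 : ℚ) • s = s
      simp
    refine ⟨(g.comp e.symm.toAlgHom).toRingHom, ?_⟩
    have : e.symm θ = ⟨0, 1⟩ := by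
      rw [AlgEquiv.symm_apply_eq, he]; simp
    change g (e.symm θ) = s
    rw [this, hg]
  have hs : √(D : ℝ) * √D = D := Real.mul_self_sqrt (Nat.cast_nonneg D)
  exact
  { θ := θ
    co := fun x => by
      obtain ⟨z, rfl⟩ := e.surjective x
      exact ⟨z.re, z.im, he z⟩
    sq := hθ
    φ₁ := (hemb (√D) hs).choose
    φ₂ := (hemb (-√D) (by rw [neg_mul_neg, hs])).choose
    hφ₁ := (hemb (√D) hs).choose_spec
    hφ₂ := (hemb (-√D) (by rw [neg_mul_neg, hs])).choose_spec
    norm := fun a b => by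
      have h1 := he ⟨a, b⟩
      rw [← h1]
      exact norm_quad e.toRingEquiv a b }

/-- if `d > 1` is an odd squarefree integer with `d ≡ 1 (mod 4)` such that
every prime `p ∣ d` satisfies `(2/p) = 1`, then `rk₄ Cl⁺(8d) ≥ 1` (i.e. `|G²/G⁴| ≥ 2`),
i.e. the narrow class group of `ℚ(√(2d))` contains an element of order 4. -/
theorem stmt18 (d : ℕ) (hd : 1 < d) (hodd : Odd d) (hsf : Squarefree d)
    (hmod : d % 4 = 1)
    (hleg : ∀ p : ℕ, p.Prime → p ∣ d → jacobiSym 2 p = 1) :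
    2 ≤ fourRankPow (NarrowClassGroup (quadField (2 * d))) ∧
      ∃ g : NarrowClassGroup (quadField (2 * d)), orderOf g = 4 := by
  have hsfD : Squarefree (2 * d) := by
    rw [Nat.squarefree_mul (Nat.coprime_two_left.mpr hodd)]
    exact ⟨Nat.prime_two.squarefree, hsf⟩
  obtain ⟨hnf, ⟨Q⟩⟩ := exists_qdata hsfD (by omega)
  exact Q.main rfl hd hodd hsf hmod hleg
end
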